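/- arXiv:2401.06871 — 3 statements merged into one kernel-verified Lean document; each statement's English description precedes it below -/
import Mathlib

section
/- Fix real numbers ω₁, ω₂ ∈ ℝ. Suppose φ ∈ L¹(ℝ) satisfies ∫_ℝ e^{iπ(m+ω₁)t} φ(t) dt = 0 for every m ∈ ℤ and ∫_ℝ e^{−iπ(n+ω₂)/t} φ(t) dt = 0 for every n ∈ ℤ. Then φ = 0 almost everywhere on ℝ. -/
open MeasureTheory

namespace KleinGordon

open Set Filter Topology
open scoped ENNReal

/-- The integer `j` as the translation by `2 * j`. -/
noncomputable def intEquivZMultiplesTwo : ℤ ≃ AddSubgroup.zmultiples (2 : ℝ) :=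
  Equiv.ofBijective (fun j => ⟨j • (2 : ℝ), j, rfl⟩)
    ⟨fun _ _ h => (zsmul_left_strictMono (two_pos (α := ℝ))).injective (Subtype.ext_iff.1 h),
      fun ⟨_, j, h⟩ => ⟨j, Subtype.ext h⟩⟩

theorem isAddFundamentalDomain_Ioc_neg_one_one :
    IsAddFundamentalDomain (AddSubgroup.zmultiples (2 : ℝ)) (Ioc (-1 : ℝ) 1) volume := by
  have := isAddFundamentalDomain_Ioc (two_pos (α := ℝ)) (-1)
  norm_num at this
  exact this

theorem intEquivZMultiplesTwo_vadd (j : ℤ) (x : ℝ) :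
    intEquivZMultiplesTwo j +ᵥ x = x + 2 * j := by
  change j • (2 : ℝ) + x = _
  rw [zsmul_eq_mul]
  ring

theorem lintegral_eq_tsum_add_two_mul (f : ℝ → ℝ≥0∞) :
    ∫⁻ x, f x = ∑' j : ℤ, ∫⁻ x in Ioc (-1 : ℝ) 1, f (x + 2 * j) := by
  rw [isAddFundamentalDomain_Ioc_neg_one_one.lintegral_eq_tsum'' f,
    ← intEquivZMultiplesTwo.tsum_eq]
  simp only [intEquivZMultiplesTwo_vadd]

theorem integral_eq_tsum_add_two_mul {f : ℝ → ℂ} (hf : Integrable f) :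
    ∫ x, f x = ∑' j : ℤ, ∫ x in Ioc (-1 : ℝ) 1, f (x + 2 * j) := by
  rw [isAddFundamentalDomain_Ioc_neg_one_one.integral_eq_tsum'' f hf,
    ← intEquivZMultiplesTwo.tsum_eq]
  simp only [intEquivZMultiplesTwo_vadd]

instance : Fact (0 < (2 : ℝ)) := ⟨two_pos⟩

theorem integral_mul_continuousMap_eq_zero {χ : ℝ → ℂ} (hχ : Integrable χ)
    (h : ∀ m : ℤ, ∫ t : ℝ, fourier m (t : AddCircle (2 : ℝ)) * χ t = 0)
    (g : C(AddCircle (2 : ℝ), ℂ)) : ∫ t : ℝ, g (t : AddCircle (2 : ℝ)) * χ t = 0 := by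
  have hint : ∀ g : C(AddCircle (2 : ℝ), ℂ),
      Integrable fun t : ℝ => g (t : AddCircle (2 : ℝ)) * χ t := fun g =>
    hχ.bdd_mul (c := ‖g‖)
      (g.continuous.comp (AddCircle.continuous_mk' 2)).aestronglyMeasurable
      (ae_of_all _ fun t => g.norm_coe_le_norm _)
  let L : C(AddCircle (2 : ℝ), ℂ) →ₗ[ℂ] ℂ :=
    { toFun := fun g => ∫ t : ℝ, g (t : AddCircle (2 : ℝ)) * χ t
      map_add' := fun g₁ g₂ => by
        rw [← integral_add (hint g₁) (hint g₂)]
        simp [add_mul]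
      map_smul' := fun c g => by
        rw [RingHom.id_apply, smul_eq_mul, ← integral_const_mul]
        simp [mul_assoc] }
  let L' := L.mkContinuous (∫ t, ‖χ t‖) fun g => by
    refine (norm_integral_le_integral_norm _).trans ?_
    rw [← integral_mul_const]
    refine integral_mono (hint g).norm (hχ.norm.mul_const _) fun t => ?_
    rw [norm_mul, mul_comm]
    exact mul_le_mul_of_nonneg_left (g.norm_coe_le_norm _) (norm_nonneg _)
  have hle : (Submodule.span ℂ (range <| @fourier 2)).topologicalClosure ≤
      L'.toLinearMap.ker := by
    refine Submodule.topologicalClosure_minimal _ ?_ L'.isClosed_ker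
    rw [Submodule.span_le]
    rintro _ ⟨m, rfl⟩
    exact h m
  rw [span_fourier_closure_eq_top] at hle
  exact hle (Submodule.mem_top (x := g))

theorem tsum_lintegral_enorm_add_two_mul_lt_top {χ : ℝ → ℂ} (hχ : Integrable χ) :
    ∑' j : ℤ, ∫⁻ x in Ioc (-1 : ℝ) 1, ‖χ (x + 2 * j)‖ₑ < ∞ := by
  rw [← lintegral_eq_tsum_add_two_mul fun x => ‖χ x‖ₑ]
  exact hχ.2

theorem integrable_comp_add_two_mul {χ : ℝ → ℂ} (hχ : Integrable χ) (j : ℤ) :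
    Integrable fun x => χ (x + 2 * j) :=
  hχ.comp_add_right _

theorem ae_tsum_enorm_lt_top {χ : ℝ → ℂ} (hχ : Integrable χ) :
    ∀ᵐ t ∂(volume.restrict (Ioc (-1 : ℝ) 1)), ∑' j : ℤ, ‖χ (t + 2 * j)‖ₑ < ∞ := by
  refine ae_lt_top' ?_ ?_
  · exact AEMeasurable.tsum fun j =>
      (integrable_comp_add_two_mul hχ j).aestronglyMeasurable.enorm.restrict
  · rw [lintegral_tsum fun j =>
      (integrable_comp_add_two_mul hχ j).aestronglyMeasurable.enorm.restrict]
    exact (tsum_lintegral_enorm_add_two_mul_lt_top hχ).ne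

theorem summable_of_tsum_enorm_lt_top {f : ℤ → ℂ} (h : ∑' j, ‖f j‖ₑ < ∞) : Summable f := by
  refine Summable.of_norm ?_
  have := ENNReal.summable_toReal h.ne
  simpa using this

theorem integrableOn_tsum_add_two_mul {χ : ℝ → ℂ} (hχ : Integrable χ) :
    IntegrableOn (fun t => ∑' j : ℤ, χ (t + 2 * j)) (Ioc (-1 : ℝ) 1) := by
  refine ⟨?_, ?_⟩
  · refine aestronglyMeasurable_of_tendsto_ae (atTop : Filter (Finset ℤ))
      (f := fun s t => ∑ j ∈ s, χ (t + 2 * j)) (fun s => ?_) ?_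
    · exact Finset.aestronglyMeasurable_fun_sum s fun j _ =>
        (integrable_comp_add_two_mul hχ j).aestronglyMeasurable.restrict
    · filter_upwards [ae_tsum_enorm_lt_top hχ] with t ht
      exact (summable_of_tsum_enorm_lt_top ht).hasSum
  · refine lt_of_le_of_lt (lintegral_mono fun t => enorm_tsum_le_tsum_enorm) ?_
    rw [lintegral_tsum fun j =>
      (integrable_comp_add_two_mul hχ j).aestronglyMeasurable.enorm.restrict]
    exact tsum_lintegral_enorm_add_two_mul_lt_top hχ

/-- If all Fourier coefficients of `χ` at the integer frequencies vanish, so does its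
`2`-periodization. -/
theorem ae_tsum_add_two_mul_eq_zero {χ : ℝ → ℂ} (hχ : Integrable χ)
    (h : ∀ m : ℤ, ∫ t : ℝ, fourier m (t : AddCircle (2 : ℝ)) * χ t = 0) :
    ∀ᵐ t : ℝ, t ∈ Ioo (-1 : ℝ) 1 → ∑' j : ℤ, χ (t + 2 * j) = 0 := by
  refine isOpen_Ioo.ae_eq_zero_of_integral_contDiff_smul_eq_zero
    ((integrableOn_tsum_add_two_mul hχ).mono_set Ioo_subset_Ioc_self).locallyIntegrableOn ?_
  intro g hg _ hgU
  have hg0 : ∀ x ∉ Ioo (-1 : ℝ) 1, g x = 0 := fun x hx =>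
    image_eq_zero_of_notMem_tsupport fun h => hx (hgU h)
  let G : C(AddCircle (2 : ℝ), ℂ) :=
    ⟨AddCircle.liftIoc 2 (-1) fun x => (g x : ℂ), AddCircle.liftIoc_continuous
      (by rw [hg0 (-1) (by simp), hg0 (-1 + 2) (by norm_num)])
      (Complex.continuous_ofReal.comp hg.continuous).continuousOn⟩
  have hG : ∀ x ∈ Ioc (-1 : ℝ) 1, ∀ j : ℤ, G ((x + 2 * j : ℝ) : AddCircle (2 : ℝ)) = g x := by
    intro x hx j
    have : ((x + 2 * j : ℝ) : AddCircle (2 : ℝ)) = x := by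
      have h2 : ((2 * j : ℝ) : AddCircle (2 : ℝ)) = 0 :=
        (AddCircle.coe_eq_zero_iff 2).2 ⟨j, by rw [zsmul_eq_mul, mul_comm]⟩
      rw [AddCircle.coe_add, h2, add_zero]
    rw [this]
    exact AddCircle.liftIoc_coe_apply (f := fun x => (g x : ℂ)) ⟨hx.1, by linarith [hx.2]⟩
  have hint : Integrable fun t : ℝ => G (t : AddCircle (2 : ℝ)) * χ t :=
    hχ.bdd_mul (c := ‖G‖)
      (G.continuous.comp (AddCircle.continuous_mk' 2)).aestronglyMeasurable
      (ae_of_all _ fun t => G.norm_coe_le_norm _)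
  have key := integral_mul_continuousMap_eq_zero hχ h G
  rw [integral_eq_tsum_add_two_mul hint, ← integral_tsum
    (fun j => (integrable_comp_add_two_mul hint j).aestronglyMeasurable.restrict)
    (tsum_lintegral_enorm_add_two_mul_lt_top hint).ne] at key
  rw [← key, ← setIntegral_eq_integral_of_forall_compl_eq_zero (s := Ioc (-1 : ℝ) 1)]
  · refine setIntegral_congr_fun measurableSet_Ioc fun x hx => ?_
    simp only [hG x hx, tsum_mul_left, Complex.real_smul]
  · intro x hx
    rw [hg0 x fun h => hx (Ioo_subset_Ioc_self h), zero_smul]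

theorem ae_enorm_le_tsum_of_integral_exp_eq_zero {ψ : ℝ → ℂ} (hψ : Integrable ψ) (ω : ℝ)
    (h : ∀ m : ℤ, ∫ t : ℝ, Complex.exp
      (Complex.I * (Real.pi : ℂ) * ((m : ℂ) + (ω : ℂ)) * (t : ℂ)) * ψ t = 0) :
    ∀ᵐ t : ℝ, t ∈ Ioo (-1 : ℝ) 1 →
      ‖ψ t‖ₑ ≤ ∑' j : ℤ, if j = 0 then 0 else ‖ψ (t + 2 * j)‖ₑ := by
  let χ : ℝ → ℂ := fun t => Complex.exp ((Real.pi * ω * t : ℝ) * Complex.I) * ψ t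
  have hnorm : ∀ t, ‖χ t‖ₑ = ‖ψ t‖ₑ := fun t => by
    rw [← ofReal_norm, ← ofReal_norm, norm_mul,
      Complex.norm_exp_ofReal_mul_I, one_mul]
  have hχ : Integrable χ := hψ.bdd_mul (c := 1) (by fun_prop)
    (ae_of_all _ fun t => (Complex.norm_exp_ofReal_mul_I _).le)
  have h0 := ae_tsum_add_two_mul_eq_zero hχ fun m => by
    rw [← h m]
    congr 1
    ext t
    rw [fourier_coe_apply, ← mul_assoc, ← Complex.exp_add]
    congr 2
    push_cast
    ring
  filter_upwards [h0, (ae_restrict_iff' measurableSet_Ioc).1 (ae_tsum_enorm_lt_top hχ)]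
    with t ht hs htm
  have hsum := summable_of_tsum_enorm_lt_top (hs (Ioo_subset_Ioc_self htm))
  have := ht htm
  rw [hsum.tsum_eq_add_tsum_ite 0, Int.cast_zero, mul_zero, add_zero] at this
  rw [← hnorm, eq_neg_of_add_eq_zero_left this, enorm_neg]
  refine enorm_tsum_le_tsum_enorm.trans (ENNReal.tsum_le_tsum fun j => ?_)
  split_ifs
  · simp
  · rw [hnorm]

/-- The transfer operator of the Gauss-type map `t ↦ -1/t mod 2` of the interval `(-1, 1)`. -/
noncomputable def gaussTransfer (f : ℝ → ℝ≥0∞) (x : ℝ) : ℝ≥0∞ :=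
  ∑' j : ℤ, if j = 0 then 0 else ENNReal.ofReal ((x + 2 * j) ^ 2)⁻¹ * f (-(x + 2 * j)⁻¹)

theorem hasDerivWithinAt_neg_inv {x : ℝ} (hx : x ∈ ({0}ᶜ : Set ℝ)) :
    HasDerivWithinAt (fun y : ℝ => -y⁻¹) (x ^ 2)⁻¹ {0}ᶜ x := by
  have := (hasDerivAt_inv hx).neg.hasDerivWithinAt (s := {0}ᶜ)
  rw [neg_neg] at this
  exact this

theorem injOn_neg_inv (s : Set ℝ) : InjOn (fun y : ℝ => -y⁻¹) s :=
  fun _ _ _ _ h => inv_injective (neg_injective h)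

theorem image_neg_inv : (fun y : ℝ => -y⁻¹) '' {0}ᶜ = {0}ᶜ := by
  ext y
  constructor
  · rintro ⟨x, hx, rfl⟩
    simpa using hx
  · intro hy
    exact ⟨-y⁻¹, by simpa using hy, by simp⟩

theorem restrict_compl_zero : (volume : Measure ℝ).restrict {0}ᶜ = volume :=
  Measure.restrict_eq_self_of_ae_mem (by simp [ae_iff])

theorem lintegral_comp_neg_inv (g : ℝ → ℝ≥0∞) :
    ∫⁻ x, ENNReal.ofReal (x ^ 2)⁻¹ * g (-x⁻¹) = ∫⁻ x, g x := by
  have := lintegral_image_eq_lintegral_abs_deriv_mul (measurableSet_singleton (0 : ℝ)).compl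
    (fun x hx => hasDerivWithinAt_neg_inv hx) (injOn_neg_inv _) g
  rw [image_neg_inv, restrict_compl_zero] at this
  rw [this]
  refine lintegral_congr fun x => ?_
  rw [abs_of_nonneg (by positivity)]

theorem integral_comp_neg_inv (g : ℝ → ℂ) :
    ∫ x, (x ^ 2)⁻¹ • g (-x⁻¹) = ∫ x, g x := by
  have := integral_image_eq_integral_abs_deriv_smul (measurableSet_singleton (0 : ℝ)).compl
    (fun x hx => hasDerivWithinAt_neg_inv hx) (injOn_neg_inv _) g
  rw [image_neg_inv, restrict_compl_zero] at this
  rw [this]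
  refine integral_congr_ae (ae_of_all _ fun x => ?_)
  simp only
  rw [abs_of_nonneg (by positivity)]

theorem integrable_comp_neg_inv {g : ℝ → ℂ} (hg : Integrable g) :
    Integrable fun x : ℝ => (x ^ 2)⁻¹ • g (-x⁻¹) := by
  have := integrableOn_image_iff_integrableOn_abs_deriv_smul
    (measurableSet_singleton (0 : ℝ)).compl
    (fun x hx => hasDerivWithinAt_neg_inv hx) (injOn_neg_inv _) g
  rw [image_neg_inv, IntegrableOn, IntegrableOn, restrict_compl_zero] at this
  refine (this.1 hg).congr (ae_of_all _ fun x => ?_)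
  simp only
  rw [abs_of_nonneg (by positivity)]

theorem one_lt_abs_add_two_mul {x : ℝ} (hx : x ∈ Ioo (-1 : ℝ) 1) {j : ℤ} (hj : j ≠ 0) :
    1 < |x + 2 * j| := by
  rcases lt_or_gt_of_ne hj with h | h
  · have : (j : ℝ) ≤ -1 := by exact_mod_cast Int.le_sub_one_of_lt h
    rw [lt_abs]
    right
    linarith [hx.2]
  · have : (1 : ℝ) ≤ j := by exact_mod_cast h
    rw [lt_abs]
    left
    linarith [hx.1]

theorem neg_inv_mem_Ioo {y : ℝ} (hy : 1 < |y|) : -y⁻¹ ∈ Ioo (-1 : ℝ) 1 := by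
  rw [mem_Ioo, ← abs_lt, abs_neg, abs_inv]
  exact inv_lt_one_of_one_lt₀ hy

theorem neg_inv_add_two_mul_mem_Ioo {x : ℝ} (hx : x ∈ Ioo (-1 : ℝ) 1) {j : ℤ} (hj : j ≠ 0) :
    -(x + 2 * j)⁻¹ ∈ Ioo (-1 : ℝ) 1 :=
  neg_inv_mem_Ioo (one_lt_abs_add_two_mul hx hj)

theorem measurable_gaussTransfer {f : ℝ → ℝ≥0∞} (hf : Measurable f) :
    Measurable (gaussTransfer f) := by
  refine Measurable.tsum fun j => ?_
  split_ifs
  · exact measurable_const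
  · fun_prop

theorem lintegral_gaussTransfer {f : ℝ → ℝ≥0∞} (hf : Measurable f) :
    ∫⁻ x in Ioo (-1 : ℝ) 1, gaussTransfer f x = ∫⁻ x in Ioo (-1 : ℝ) 1, f x := by
  rw [← lintegral_indicator measurableSet_Ioo f, ← lintegral_comp_neg_inv (indicator _ f),
    lintegral_eq_tsum_add_two_mul]
  unfold gaussTransfer
  rw [lintegral_tsum fun j => ?_]
  · refine tsum_congr fun j => ?_
    rw [← setLIntegral_congr Ioo_ae_eq_Ioc]
    refine setLIntegral_congr_fun measurableSet_Ioo fun x hx => ?_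
    split_ifs with hj
    · rcases eq_or_ne x 0 with rfl | h0
      · simp [hj]
      · rw [indicator_of_notMem, mul_zero]
        rw [hj, Int.cast_zero, mul_zero, add_zero, mem_Ioo, ← abs_lt, abs_neg, abs_inv, not_lt]
        exact (one_le_inv₀ (abs_pos.2 h0)).2 (abs_lt.2 hx).le
    · rw [indicator_of_mem (neg_inv_add_two_mul_mem_Ioo hx hj)]
  · split_ifs
    · exact aemeasurable_const
    · fun_prop

theorem gaussTransfer_mono {f g : ℝ → ℝ≥0∞} (h : f ≤ g) : gaussTransfer f ≤ gaussTransfer g :=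
  fun x => ENNReal.tsum_le_tsum fun j => by
    split_ifs
    · exact le_rfl
    · gcongr
      exact h _

theorem gaussTransfer_add (f g : ℝ → ℝ≥0∞) :
    gaussTransfer (f + g) = gaussTransfer f + gaussTransfer g := by
  ext x
  rw [Pi.add_apply, gaussTransfer, gaussTransfer, gaussTransfer, ← ENNReal.tsum_add]
  refine tsum_congr fun j => ?_
  split_ifs
  · simp
  · rw [Pi.add_apply, mul_add]

theorem gaussTransfer_const_mul (c : ℝ≥0∞) (f : ℝ → ℝ≥0∞) :
    gaussTransfer (fun x => c * f x) = fun x => c * gaussTransfer f x := by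
  ext x
  rw [gaussTransfer, gaussTransfer, ← ENNReal.tsum_mul_left]
  refine tsum_congr fun j => ?_
  split_ifs
  · simp
  · ring

theorem gaussTransfer_ae_mono {f g : ℝ → ℝ≥0∞} (hf : Measurable f) (hg : Measurable g)
    (h : f ≤ᵐ[volume.restrict (Ioo (-1) 1)] g) :
    gaussTransfer f ≤ᵐ[volume.restrict (Ioo (-1) 1)] gaussTransfer g := by
  have h0 : ∫⁻ x in Ioo (-1 : ℝ) 1, gaussTransfer (f - g) x = 0 := by
    rw [lintegral_gaussTransfer (hf.sub hg), lintegral_eq_zero_iff (hf.sub hg)]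
    filter_upwards [h] with x hx using tsub_eq_zero_of_le hx
  rw [lintegral_eq_zero_iff (measurable_gaussTransfer (hf.sub hg))] at h0
  filter_upwards [h0] with x hx
  have h1 : f ≤ g + (f - g) := le_add_tsub
  refine (gaussTransfer_mono h1 x).trans ?_
  rw [gaussTransfer_add, Pi.add_apply, hx, Pi.zero_apply, add_zero]

theorem measurable_iterate_gaussTransfer {f : ℝ → ℝ≥0∞} (hf : Measurable f) (n : ℕ) :
    Measurable (gaussTransfer^[n] f) := by
  induction n with
  | zero => exact hf
  | succ n ih =>
    rw [Function.iterate_succ_apply']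
    exact measurable_gaussTransfer ih

theorem lintegral_iterate_gaussTransfer {f : ℝ → ℝ≥0∞} (hf : Measurable f) (n : ℕ) :
    ∫⁻ x in Ioo (-1 : ℝ) 1, (gaussTransfer^[n] f) x = ∫⁻ x in Ioo (-1 : ℝ) 1, f x := by
  induction n with
  | zero => rfl
  | succ n ih =>
    rw [Function.iterate_succ_apply', lintegral_gaussTransfer
      (measurable_iterate_gaussTransfer hf n), ih]

theorem iterate_gaussTransfer_add_const (f : ℝ → ℝ≥0∞) (c : ℝ≥0∞) (n : ℕ) :
    gaussTransfer^[n] (fun x => f x + c) =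
      fun x => (gaussTransfer^[n] f) x + c * (gaussTransfer^[n] 1) x := by
  induction n with
  | zero => simp
  | succ n ih =>
    rw [Function.iterate_succ_apply', ih, Function.iterate_succ_apply',
      Function.iterate_succ_apply']
    refine (gaussTransfer_add _ _).trans ?_
    rw [gaussTransfer_const_mul]
    rfl

theorem le_iterate_gaussTransfer {f : ℝ → ℝ≥0∞} (hf : Measurable f)
    (h : f ≤ᵐ[volume.restrict (Ioo (-1) 1)] gaussTransfer f) (n : ℕ) :
    f ≤ᵐ[volume.restrict (Ioo (-1) 1)] gaussTransfer^[n] f := by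
  induction n with
  | zero => exact ae_of_all _ fun _ => le_rfl
  | succ n ih =>
    rw [Function.iterate_succ_apply']
    exact h.trans (gaussTransfer_ae_mono hf (measurable_iterate_gaussTransfer hf n) ih)

theorem tendsto_lintegral_tsub_natCast {μ : Measure ℝ} {f : ℝ → ℝ≥0∞} (hf : Measurable f)
    (hfin : ∫⁻ x, f x ∂μ ≠ ∞) :
    Tendsto (fun M : ℕ => ∫⁻ x, (f x - M) ∂μ) atTop (𝓝 0) := by
  have := tendsto_lintegral_of_dominated_convergence (μ := μ) (F := fun (M : ℕ) x => f x - M)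
    (f := 0) f (fun M => hf.sub measurable_const) (fun M => ae_of_all _ fun x => tsub_le_self)
    hfin ?_
  · simpa using this
  · filter_upwards [ae_lt_top hf hfin] with x hx
    obtain ⟨N, hN⟩ := ENNReal.exists_nat_gt hx.ne
    refine tendsto_const_nhds.congr' ?_
    filter_upwards [eventually_ge_atTop N] with M hM
    exact (tsub_eq_zero_of_le (hN.le.trans (by exact_mod_cast hM))).symm

/-- An integrable subinvariant density vanishes, provided the iterates of `1` escape to `±1`. -/
theorem ae_eq_zero_of_le_gaussTransfer
    (hone : ∀ a ∈ Ioo (0 : ℝ) 1, ∀ δ : ℝ≥0∞, δ ≠ 0 →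
      ∃ n, ∫⁻ x in Ioo (-a) a, (gaussTransfer^[n] 1) x ≤ δ)
    {f : ℝ → ℝ≥0∞} (hf : Measurable f) (hfin : ∫⁻ x in Ioo (-1 : ℝ) 1, f x ≠ ∞)
    (h : f ≤ᵐ[volume.restrict (Ioo (-1) 1)] gaussTransfer f) :
    f =ᵐ[volume.restrict (Ioo (-1) 1)] 0 := by
  have hzero : ∀ a ∈ Ioo (0 : ℝ) 1, ∫⁻ x in Ioo (-a) a, f x = 0 := by
    intro a ha
    have hsub : Ioo (-a) a ⊆ Ioo (-1 : ℝ) 1 := Ioo_subset_Ioo (by linarith [ha.2]) ha.2.le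
    have hle : ∀ M n : ℕ, ∫⁻ x in Ioo (-a) a, f x ≤
        (∫⁻ x in Ioo (-1 : ℝ) 1, (f x - M)) +
          M * ∫⁻ x in Ioo (-a) a, (gaussTransfer^[n] 1) x := by
      intro M n
      have hm : Measurable fun x => f x - M := hf.sub measurable_const
      have h1 : f ≤ᵐ[volume.restrict (Ioo (-1) 1)] fun x =>
          (gaussTransfer^[n] fun x => f x - M) x + M * (gaussTransfer^[n] 1) x := by
        rw [← iterate_gaussTransfer_add_const]
        refine (le_iterate_gaussTransfer hf h n).trans (ae_of_all _ ?_)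
        have hmono : Monotone gaussTransfer := fun _ _ => gaussTransfer_mono
        exact hmono.iterate n fun x => le_tsub_add
      refine (lintegral_mono_ae (ae_restrict_of_ae_restrict_of_subset hsub h1)).trans ?_
      rw [lintegral_add_left (measurable_iterate_gaussTransfer hm n), lintegral_const_mul _
        (measurable_iterate_gaussTransfer measurable_one n),
        ← lintegral_iterate_gaussTransfer hm n]
      gcongr
    refine le_antisymm (ENNReal.le_of_forall_pos_le_add fun ε hε _ => ?_) bot_le
    have hε2 : (ε / 2 : ℝ≥0∞) ≠ 0 := by simp [hε.ne']
    obtain ⟨M, hM⟩ := ((tendsto_lintegral_tsub_natCast hf hfin).eventually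
      (eventually_le_nhds (pos_iff_ne_zero.2 hε2))).exists
    obtain ⟨n, hn⟩ := hone a ha (ε / 2 / (M : ℝ≥0∞)) (ENNReal.div_ne_zero.2 ⟨hε2, by simp⟩)
    refine (hle M n).trans ?_
    rw [zero_add, ← ENNReal.add_halves (ε : ℝ≥0∞)]
    refine add_le_add hM ((mul_le_mul_right hn _).trans ENNReal.mul_div_le)
  have hU : Ioo (-1 : ℝ) 1 = ⋃ k : ℕ, Ioo (-(1 - 1 / ((k : ℝ) + 2))) (1 - 1 / ((k : ℝ) + 2)) := by
    ext x
    simp only [mem_iUnion, mem_Ioo, ← abs_lt]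
    constructor
    · intro hx
      obtain ⟨k, hk⟩ := exists_nat_one_div_lt (sub_pos.2 hx)
      refine ⟨k, ?_⟩
      have : 1 / ((k : ℝ) + 2) ≤ 1 / ((k : ℝ) + 1) := by gcongr; norm_num
      linarith
    · rintro ⟨k, hk⟩
      have : 0 < 1 / ((k : ℝ) + 2) := by positivity
      linarith
  rw [hU]
  refine (ae_restrict_iUnion_iff _ _).2 fun k => ?_
  refine (lintegral_eq_zero_iff hf).1 (hzero _ ⟨?_, ?_⟩)
  · rw [sub_pos, div_lt_one (by positivity)]
    have : (0 : ℝ) ≤ k := k.cast_nonneg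
    linarith
  · have : 0 < 1 / ((k : ℝ) + 2) := by positivity
    linarith

/-- The invariant density of the Gauss-type map `t ↦ -1/t mod 2` on `(-1, 1)`. -/
noncomputable def invDensity (x : ℝ) : ℝ := (1 - x ^ 2)⁻¹

/-- The real-valued counterpart of `gaussTransfer`. -/
noncomputable def realTransfer (f : ℝ → ℝ) (x : ℝ) : ℝ :=
  ∑' j : ℤ, if j = 0 then 0 else ((x + 2 * j) ^ 2)⁻¹ * f (-(x + 2 * j)⁻¹)

theorem one_sub_sq_pos {x : ℝ} (hx : x ∈ Ioo (-1 : ℝ) 1) : 0 < 1 - x ^ 2 := by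
  nlinarith [hx.1, hx.2]

theorem hasSum_one_div_telescope {y : ℝ} (hy : 0 < y) :
    HasSum (fun n : ℕ => ((y + (2 * n + 1)) ^ 2 - 1)⁻¹) (2 * y)⁻¹ := by
  have hpos : ∀ n : ℕ, 0 < y + 2 * n := fun n => by positivity
  rw [hasSum_iff_tendsto_nat_of_nonneg fun n => ?_]
  · have hsum : ∀ N : ℕ, ∑ n ∈ Finset.range N, ((y + (2 * n + 1)) ^ 2 - 1)⁻¹ =
        (2 * y)⁻¹ - (2 * (y + 2 * N))⁻¹ := by
      intro N
      have : ∀ n : ℕ, ((y + (2 * n + 1)) ^ 2 - 1)⁻¹ =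
          (2 * (y + 2 * n))⁻¹ - (2 * (y + 2 * ((n + 1 : ℕ) : ℝ)))⁻¹ := by
        intro n
        have h1 := (hpos n).ne'
        have h2 := (hpos (n + 1)).ne'
        have h3 : (y + (2 * n + 1)) ^ 2 - 1 = (y + 2 * n) * (y + 2 * ((n + 1 : ℕ) : ℝ)) := by
          push_cast
          ring
        rw [h3]
        field_simp
        push_cast
        ring
      simp_rw [this]
      rw [Finset.sum_range_sub' fun n : ℕ => (2 * (y + 2 * (n : ℝ)))⁻¹]
      simp
    simp_rw [hsum]
    have : Tendsto (fun N : ℕ => (2 * (y + 2 * (N : ℝ)))⁻¹) atTop (𝓝 0) := by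
      refine tendsto_inv_atTop_zero.comp ?_
      refine Tendsto.const_mul_atTop two_pos (tendsto_atTop_add_const_left _ _ ?_)
      exact tendsto_natCast_atTop_atTop.const_mul_atTop two_pos
    simpa using tendsto_const_nhds.sub this
  · have := hpos n
    refine inv_nonneg.2 ?_
    nlinarith

theorem inv_sq_mul_invDensity {y : ℝ} (hy : 1 < |y|) :
    (y ^ 2)⁻¹ * invDensity (-y⁻¹) = (y ^ 2 - 1)⁻¹ := by
  have h0 : y ≠ 0 := abs_pos.1 (one_pos.trans hy)
  have h1 : y ^ 2 - 1 ≠ 0 := by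
    have := (one_lt_sq_iff_one_lt_abs y).2 hy
    linarith
  rw [invDensity, ← mul_inv]
  congr 1
  field_simp

theorem hasSum_invDensity {x : ℝ} (hx : x ∈ Ioo (-1 : ℝ) 1) :
    HasSum (fun j : ℤ => if j = 0 then 0 else
      ((x + 2 * j) ^ 2)⁻¹ * invDensity (-(x + 2 * j)⁻¹)) (invDensity x) := by
  have hp : HasSum (fun n : ℕ => ((x + 1 + (2 * n + 1)) ^ 2 - 1)⁻¹) (2 * (x + 1))⁻¹ :=
    hasSum_one_div_telescope (by linarith [hx.1])
  have hn : HasSum (fun n : ℕ => ((1 - x + (2 * n + 1)) ^ 2 - 1)⁻¹) (2 * (1 - x))⁻¹ :=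
    hasSum_one_div_telescope (by linarith [hx.2])
  have hterm : ∀ j : ℤ, (if j = 0 then 0 else
      ((x + 2 * j) ^ 2)⁻¹ * invDensity (-(x + 2 * j)⁻¹)) =
      if j = 0 then 0 else ((x + 2 * j) ^ 2 - 1)⁻¹ := fun j => by
    split_ifs with hj
    · rfl
    · exact inv_sq_mul_invDensity (one_lt_abs_add_two_mul hx hj)
  simp_rw [hterm]
  have hsum : invDensity x = (2 * (x + 1))⁻¹ + (2 * (1 - x))⁻¹ := by
    have h1 : x + 1 ≠ 0 := by linarith [hx.1]
    have h2 : 1 - x ≠ 0 := by linarith [hx.2]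
    have h3 : (1 : ℝ) - x ^ 2 = (x + 1) * (1 - x) := by ring
    rw [invDensity, h3]
    field_simp
    ring
  rw [hsum]
  refine HasSum.of_nat_of_neg_add_one ?_ ?_
  · rw [← hasSum_nat_add_iff' 1]
    simp only [Finset.range_one, Finset.sum_singleton, Nat.cast_zero, if_true, sub_zero]
    convert hp using 2 with n
    · rfl
    rw [if_neg (by lia)]
    push_cast
    ring_nf
  · convert hn using 2 with n
    rw [if_neg (by lia)]
    push_cast
    ring_nf

/-- The cone of even convex densities on `(-1, 1)` dominated by the invariant density. -/
structure EvenConvexDensity (f : ℝ → ℝ) : Prop where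
  nonneg : ∀ x ∈ Ioo (-1 : ℝ) 1, 0 ≤ f x
  le_invDensity : ∀ x ∈ Ioo (-1 : ℝ) 1, f x ≤ invDensity x
  even : ∀ x ∈ Ioo (-1 : ℝ) 1, f (-x) = f x
  convexOn : ConvexOn ℝ (Ioo (-1) 1) f

namespace EvenConvexDensity

variable {f : ℝ → ℝ}

theorem le_of_abs_le (hf : EvenConvexDensity f) {a b : ℝ} (hb : b ∈ Ioo (-1 : ℝ) 1)
    (hab : |a| ≤ b) : f a ≤ f b := by
  have hb' : -b ∈ Ioo (-1 : ℝ) 1 := ⟨by linarith [hb.2], by linarith [hb.1]⟩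
  have := hf.convexOn.le_max_of_mem_Icc hb' hb (abs_le.1 hab)
  rwa [hf.even b hb, max_self] at this

theorem convexOn_inv_sq_mul (hf : EvenConvexDensity f) :
    ConvexOn ℝ (Ioi 1) fun y : ℝ => (y ^ 2)⁻¹ * f (-y⁻¹) := by
  have hmem : ∀ y ∈ Ioi (1 : ℝ), y⁻¹ ∈ Ioo (-1 : ℝ) 1 := fun y hy =>
    ⟨by linarith [inv_pos.2 (one_pos.trans (mem_Ioi.1 hy))], inv_lt_one_of_one_lt₀ hy⟩
  have hinv : ConvexOn ℝ (Ioi 1) fun y : ℝ => y⁻¹ := by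
    have := (convexOn_zpow (𝕜 := ℝ) (-1)).subset
      (Ioi_subset_Ioi zero_le_one) (convex_Ioi 1)
    simpa using this
  have hsq : ConvexOn ℝ (Ioi 1) fun y : ℝ => (y ^ 2)⁻¹ := by
    have := (convexOn_zpow (𝕜 := ℝ) (-2)).subset
      (Ioi_subset_Ioi zero_le_one) (convex_Ioi 1)
    simpa [zpow_neg] using this
  have hanti : AntitoneOn (fun y : ℝ => f y⁻¹) (Ioi 1) := fun y hy z hz hyz => by
    have hz0 : (0 : ℝ) < z := one_pos.trans hz
    have hy0 : (0 : ℝ) < y := one_pos.trans hy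
    refine hf.le_of_abs_le (hmem y hy) ?_
    rw [abs_of_pos (inv_pos.2 hz0)]
    exact inv_anti₀ hy0 hyz
  have hcomp : ConvexOn ℝ (Ioi 1) fun y : ℝ => f y⁻¹ := by
    refine ⟨convex_Ioi 1, fun y hy z hz a b ha hb hab => ?_⟩
    have hyz := (convex_Ioi (1 : ℝ)) hy hz ha hb hab
    have h1 := hinv.2 hy hz ha hb hab
    have hm := (convex_Ioo (-1 : ℝ) 1) (hmem y hy) (hmem z hz) ha hb hab
    refine le_trans ?_ (hf.convexOn.2 (hmem y hy) (hmem z hz) ha hb hab)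
    refine hf.le_of_abs_le hm ?_
    rwa [abs_of_pos (inv_pos.2 (one_pos.trans hyz))]
  have hsqanti : AntitoneOn (fun y : ℝ => (y ^ 2)⁻¹) (Ioi 1) := fun y hy z hz hyz => by
    have hy0 : (0 : ℝ) < y := one_pos.trans hy
    exact inv_anti₀ (by positivity) (by gcongr)
  refine (hsq.mul hcomp (fun y _ => by positivity) (fun y hy => hf.nonneg _ (hmem y hy))
    (hsqanti.monovaryOn hanti)).congr fun y hy => ?_
  change (y ^ 2)⁻¹ * f y⁻¹ = _
  rw [hf.even _ (hmem y hy)]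

theorem summable (hf : EvenConvexDensity f) {x : ℝ} (hx : x ∈ Ioo (-1 : ℝ) 1) :
    Summable fun j : ℤ => if j = 0 then 0 else ((x + 2 * j) ^ 2)⁻¹ * f (-(x + 2 * j)⁻¹) := by
  refine Summable.of_nonneg_of_le (fun j => ?_) (fun j => ?_) (hasSum_invDensity hx).summable
  · split_ifs with hj
    · exact le_rfl
    · exact mul_nonneg (by positivity) (hf.nonneg _ (neg_inv_add_two_mul_mem_Ioo hx hj))
  · split_ifs with hj
    · exact le_rfl
    · exact mul_le_mul_of_nonneg_left
        (hf.le_invDensity _ (neg_inv_add_two_mul_mem_Ioo hx hj)) (by positivity)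

theorem realTransfer_nonneg (hf : EvenConvexDensity f) {x : ℝ} (hx : x ∈ Ioo (-1 : ℝ) 1) :
    0 ≤ realTransfer f x :=
  tsum_nonneg fun j => by
    split_ifs with hj
    · exact le_rfl
    · exact mul_nonneg (by positivity) (hf.nonneg _ (neg_inv_add_two_mul_mem_Ioo hx hj))

theorem convexOn_term (hf : EvenConvexDensity f) {j : ℤ} (hj : j ≠ 0) :
    ConvexOn ℝ (Ioo (-1) 1) fun x : ℝ => ((x + 2 * j) ^ 2)⁻¹ * f (-(x + 2 * j)⁻¹) := by
  refine ⟨convex_Ioo _ _, fun x hx z hz a b ha hb hab => ?_⟩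
  have key := hf.convexOn_inv_sq_mul.2
  rcases lt_or_gt_of_ne hj with h | h
  · have hj1 : (j : ℝ) ≤ -1 := by exact_mod_cast Int.le_sub_one_of_lt h
    have := @key (-(x + 2 * j)) (by rw [mem_Ioi]; linarith [hx.2])
      (-(z + 2 * j)) (by rw [mem_Ioi]; linarith [hz.2]) a b ha hb hab
    have e : a • -(x + 2 * (j : ℝ)) + b • -(z + 2 * j) = -((a • x + b • z) + 2 * j) := by
      simp only [smul_eq_mul]
      linear_combination (-2 * (j : ℝ)) * hab
    have hw := (convex_Ioo (-1 : ℝ) 1) hx hz ha hb hab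
    simp only [e, neg_sq, inv_neg, neg_neg] at this
    beta_reduce
    rwa [← hf.even _ (neg_inv_add_two_mul_mem_Ioo hw hj),
      ← hf.even _ (neg_inv_add_two_mul_mem_Ioo hx hj),
      ← hf.even _ (neg_inv_add_two_mul_mem_Ioo hz hj), neg_neg, neg_neg, neg_neg]
  · have hj1 : (1 : ℝ) ≤ j := by exact_mod_cast h
    have := @key (x + 2 * j) (by rw [mem_Ioi]; linarith [hx.1])
      (z + 2 * j) (by rw [mem_Ioi]; linarith [hz.1]) a b ha hb hab
    have e : a • (x + 2 * (j : ℝ)) + b • (z + 2 * j) = (a • x + b • z) + 2 * j := by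
      simp only [smul_eq_mul]
      linear_combination (2 * (j : ℝ)) * hab
    rwa [e] at this

theorem realTransfer (hf : EvenConvexDensity f) : EvenConvexDensity (realTransfer f) where
  nonneg _ hx := hf.realTransfer_nonneg hx
  le_invDensity x hx := by
    rw [← (hasSum_invDensity hx).tsum_eq]
    refine (hf.summable hx).tsum_le_tsum (fun j => ?_) (hasSum_invDensity hx).summable
    split_ifs with hj
    · exact le_rfl
    · exact mul_le_mul_of_nonneg_left
        (hf.le_invDensity _ (neg_inv_add_two_mul_mem_Ioo hx hj)) (by positivity)
  even x hx := by
    rw [KleinGordon.realTransfer, KleinGordon.realTransfer, ← (Equiv.neg ℤ).tsum_eq]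
    refine tsum_congr fun j => ?_
    simp only [Equiv.neg_apply, neg_eq_zero]
    split_ifs with hj
    · rfl
    · have e : -x + 2 * ((-j : ℤ) : ℝ) = -(x + 2 * j) := by
        push_cast
        ring
      rw [e, neg_sq, inv_neg, hf.even _ (neg_inv_add_two_mul_mem_Ioo hx hj)]
  convexOn := by
    refine ⟨convex_Ioo _ _, fun x hx z hz a b ha hb hab => ?_⟩
    have hw := (convex_Ioo (-1 : ℝ) 1) hx hz ha hb hab
    simp only [KleinGordon.realTransfer, smul_eq_mul]
    rw [← tsum_mul_left, ← tsum_mul_left,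
      ← ((hf.summable hx).mul_left a).tsum_add ((hf.summable hz).mul_left b)]
    refine (hf.summable hw).tsum_le_tsum (fun j => ?_)
      (((hf.summable hx).mul_left a).add ((hf.summable hz).mul_left b))
    split_ifs with hj
    · simp
    · exact (hf.convexOn_term hj).2 hx hz ha hb hab

theorem gaussTransfer_ofReal (hf : EvenConvexDensity f) {g : ℝ → ℝ≥0∞}
    (hg : ∀ x ∈ Ioo (-1 : ℝ) 1, g x = ENNReal.ofReal (f x)) {x : ℝ}
    (hx : x ∈ Ioo (-1 : ℝ) 1) :
    gaussTransfer g x = ENNReal.ofReal (KleinGordon.realTransfer f x) := by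
  rw [gaussTransfer, KleinGordon.realTransfer,
    ENNReal.ofReal_tsum_of_nonneg (fun j => ?_) (hf.summable hx)]
  · refine tsum_congr fun j => ?_
    split_ifs with hj
    · simp
    · rw [hg _ (neg_inv_add_two_mul_mem_Ioo hx hj), ENNReal.ofReal_mul (by positivity)]
  · split_ifs with hj
    · exact le_rfl
    · exact mul_nonneg (by positivity) (hf.nonneg _ (neg_inv_add_two_mul_mem_Ioo hx hj))

/-- An invariant even convex density `f` with `(1 - t ^ 2) f t → 0` at `±1` vanishes: otherwise
`(1 - t ^ 2) f t` has a smallest maximum point `t`, and `-1 / (t + 2) < t` is another one. -/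
theorem eq_zero_of_realTransfer_eq (hf : EvenConvexDensity f)
    (hinv : ∀ x ∈ Ioo (-1 : ℝ) 1, KleinGordon.realTransfer f x = f x)
    (hbd : ∀ ε > 0, ∃ r < 1, ∀ t, r ≤ |t| → |t| < 1 → (1 - t ^ 2) * f t ≤ ε) :
    ∀ x ∈ Ioo (-1 : ℝ) 1, f x = 0 := by
  intro x₁ hx₁
  by_contra hne
  have hpos : 0 < (1 - x₁ ^ 2) * f x₁ :=
    mul_pos (one_sub_sq_pos hx₁) ((hf.nonneg _ hx₁).lt_of_ne' hne)
  obtain ⟨r, hr1, hr⟩ := hbd _ (half_pos hpos)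
  have hlt : ∀ t ∈ Ioo (-1 : ℝ) 1, (1 - x₁ ^ 2) * f x₁ ≤ (1 - t ^ 2) * f t →
      t ∈ Icc (-r) r := by
    intro t ht hle
    rw [mem_Icc, ← abs_le]
    by_contra! h
    linarith [hr t h.le (abs_lt.2 ht)]
  have hsub : Icc (-r) r ⊆ Ioo (-1 : ℝ) 1 := fun t ht =>
    ⟨by linarith [ht.1], by linarith [ht.2]⟩
  have hcont : ContinuousOn (fun t => (1 - t ^ 2) * f t) (Icc (-r) r) :=
    (by fun_prop : Continuous fun t : ℝ => 1 - t ^ 2).continuousOn.mul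
      ((hf.convexOn.continuousOn isOpen_Ioo).mono hsub)
  obtain ⟨z, hz, hmax⟩ := isCompact_Icc.exists_isMaxOn ⟨x₁, hlt x₁ hx₁ le_rfl⟩ hcont
  obtain ⟨m, hm⟩ : ∃ m, m = (1 - z ^ 2) * f z := ⟨_, rfl⟩
  have hm₁ : (1 - x₁ ^ 2) * f x₁ ≤ m := hm ▸ hmax (hlt x₁ hx₁ le_rfl)
  have hle : ∀ t ∈ Ioo (-1 : ℝ) 1, (1 - t ^ 2) * f t ≤ m := by
    intro t ht
    by_contra! h
    exact absurd (hm ▸ hmax (hlt t ht (hm₁.trans h.le))) (not_le.2 h)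
  have hS : IsCompact (Icc (-r) r ∩ (fun t => (1 - t ^ 2) * f t) ⁻¹' {m}) :=
    isCompact_Icc.of_isClosed_subset
      (hcont.preimage_isClosed_of_isClosed isClosed_Icc isClosed_singleton) inter_subset_left
  obtain ⟨y, ⟨hyI, hym⟩, hymin⟩ := hS.exists_isLeast ⟨z, hz, hm.symm⟩
  have hy := hsub hyI
  rw [mem_preimage, mem_singleton_iff] at hym
  have hle' : ∀ t ∈ Ioo (-1 : ℝ) 1, f t ≤ m * invDensity t := fun t ht => by
    rw [invDensity, ← div_eq_mul_inv, le_div_iff₀ (one_sub_sq_pos ht), mul_comm]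
    exact hle t ht
  have hτ : -(y + 2 * (1 : ℤ))⁻¹ ∈ Ioo (-1 : ℝ) 1 :=
    neg_inv_add_two_mul_mem_Ioo hy one_ne_zero
  have hτm : m ≤ (1 - (-(y + 2 * (1 : ℤ))⁻¹) ^ 2) * f (-(y + 2 * (1 : ℤ))⁻¹) := by
    by_contra! h
    have hstrict : f (-(y + 2 * (1 : ℤ))⁻¹) < m * invDensity (-(y + 2 * (1 : ℤ))⁻¹) := by
      rw [invDensity, ← div_eq_mul_inv, lt_div_iff₀ (one_sub_sq_pos hτ), mul_comm]
      exact h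
    have hs := (hasSum_invDensity hy).mul_left m
    have := (hf.summable hy).tsum_lt_tsum (i := 1) (fun j => ?_) ?_ hs.summable
    · rw [hs.tsum_eq] at this
      have e := hinv y hy
      rw [KleinGordon.realTransfer] at e
      rw [e, invDensity, ← div_eq_mul_inv, lt_div_iff₀ (one_sub_sq_pos hy), mul_comm] at this
      exact this.ne hym
    · split_ifs with hj
      · simp
      · rw [mul_left_comm]
        exact mul_le_mul_of_nonneg_left
          (hle' _ (neg_inv_add_two_mul_mem_Ioo hy hj)) (by positivity)
    · rw [if_neg one_ne_zero, if_neg one_ne_zero, mul_left_comm]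
      have h1 := one_lt_abs_add_two_mul hy one_ne_zero
      have h0 : y + 2 * ((1 : ℤ) : ℝ) ≠ 0 := abs_pos.1 (one_pos.trans h1)
      exact mul_lt_mul_of_pos_left hstrict (by positivity)
  have hmem := hymin ⟨hlt _ hτ (hm₁.trans hτm), le_antisymm (hle _ hτ) hτm⟩
  have h2 : 0 < y + 2 * ((1 : ℤ) : ℝ) := by
    push_cast
    linarith [hy.1]
  have h3 := mul_le_mul_of_nonneg_right hmem h2.le
  rw [neg_mul, inv_mul_cancel₀ h2.ne'] at h3
  push_cast at h3
  nlinarith [hy.1]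

end EvenConvexDensity

theorem one_le_invDensity {x : ℝ} (hx : x ∈ Ioo (-1 : ℝ) 1) : 1 ≤ invDensity x :=
  (one_le_inv₀ (one_sub_sq_pos hx)).2 (by nlinarith [sq_nonneg x])

namespace EvenConvexDensity

theorem one : EvenConvexDensity 1 where
  nonneg _ _ := zero_le_one
  le_invDensity _ hx := one_le_invDensity hx
  even _ _ := rfl
  convexOn := convexOn_const 1 (convex_Ioo _ _)

theorem iterate {f : ℝ → ℝ} (hf : EvenConvexDensity f) (n : ℕ) :
    EvenConvexDensity (KleinGordon.realTransfer^[n] f) := by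
  induction n with
  | zero => exact hf
  | succ n ih =>
    rw [Function.iterate_succ_apply']
    exact ih.realTransfer

theorem average {F : ℕ → ℝ → ℝ} (hF : ∀ n, EvenConvexDensity (F n)) (N : ℕ) :
    EvenConvexDensity fun x => ((N : ℝ) + 1)⁻¹ * ∑ n ∈ Finset.range (N + 1), F n x where
  nonneg x hx := mul_nonneg (by positivity) (Finset.sum_nonneg fun n _ => (hF n).nonneg x hx)
  le_invDensity x hx := by
    rw [inv_mul_le_iff₀ (by positivity)]
    refine (Finset.sum_le_card_nsmul _ _ _ fun n _ => (hF n).le_invDensity x hx).trans_eq ?_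
    simp
  even x hx := by simp only [fun n => (hF n).even x hx]
  convexOn := by
    refine ⟨convex_Ioo _ _, fun x hx y hy a b ha hb hab => ?_⟩
    simp only [smul_eq_mul]
    rw [mul_left_comm a, mul_left_comm b, ← mul_add]
    refine mul_le_mul_of_nonneg_left ?_ (by positivity)
    rw [Finset.mul_sum, Finset.mul_sum, ← Finset.sum_add_distrib]
    exact Finset.sum_le_sum fun n _ => (hF n).convexOn.2 hx hy ha hb hab

theorem realTransfer_average {F : ℕ → ℝ → ℝ} (hF : ∀ n, EvenConvexDensity (F n)) (N : ℕ)
    {x : ℝ} (hx : x ∈ Ioo (-1 : ℝ) 1) :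
    KleinGordon.realTransfer
        (fun x => ((N : ℝ) + 1)⁻¹ * ∑ n ∈ Finset.range (N + 1), F n x) x =
      ((N : ℝ) + 1)⁻¹ * ∑ n ∈ Finset.range (N + 1), KleinGordon.realTransfer (F n) x := by
  simp only [KleinGordon.realTransfer]
  rw [← Summable.tsum_finsetSum fun n _ => (hF n).summable hx, ← tsum_mul_left]
  refine tsum_congr fun j => ?_
  split_ifs
  · simp
  · rw [← Finset.mul_sum, mul_left_comm]

variable {ι : Type*} {l : Filter ι} {F : ι → ℝ → ℝ} {f : ℝ → ℝ}

theorem of_tendsto [l.NeBot] (hF : ∀ i, EvenConvexDensity (F i))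
    (h : ∀ x ∈ Ioo (-1 : ℝ) 1, Tendsto (fun i => F i x) l (𝓝 (f x))) :
    EvenConvexDensity f where
  nonneg x hx := ge_of_tendsto' (h x hx) fun i => (hF i).nonneg x hx
  le_invDensity x hx := le_of_tendsto' (h x hx) fun i => (hF i).le_invDensity x hx
  even x hx := by
    have hx' : -x ∈ Ioo (-1 : ℝ) 1 := ⟨by linarith [hx.2], by linarith [hx.1]⟩
    refine tendsto_nhds_unique (h _ hx') ?_
    exact (h x hx).congr fun i => ((hF i).even x hx).symm
  convexOn := ⟨convex_Ioo _ _, fun x hx y hy a b ha hb hab =>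
    le_of_tendsto_of_tendsto' (h _ ((convex_Ioo (-1 : ℝ) 1) hx hy ha hb hab))
      (((h x hx).const_mul a).add ((h y hy).const_mul b))
      fun i => (hF i).convexOn.2 hx hy ha hb hab⟩

theorem tendsto_realTransfer (hF : ∀ i, EvenConvexDensity (F i))
    (h : ∀ x ∈ Ioo (-1 : ℝ) 1, Tendsto (fun i => F i x) l (𝓝 (f x)))
    {x : ℝ} (hx : x ∈ Ioo (-1 : ℝ) 1) :
    Tendsto (fun i => KleinGordon.realTransfer (F i) x) l
      (𝓝 (KleinGordon.realTransfer f x)) := by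
  refine tendsto_tsum_of_dominated_convergence (hasSum_invDensity hx).summable
    (fun j => ?_) (Eventually.of_forall fun i j => ?_)
  · split_ifs with hj
    · exact tendsto_const_nhds
    · exact (h _ (neg_inv_add_two_mul_mem_Ioo hx hj)).const_mul _
  · split_ifs with hj
    · simp
    · have hm := neg_inv_add_two_mul_mem_Ioo hx hj
      rw [Real.norm_of_nonneg (mul_nonneg (by positivity) ((hF i).nonneg _ hm))]
      exact mul_le_mul_of_nonneg_left ((hF i).le_invDensity _ hm) (by positivity)

theorem exists_tendsto (l : Ultrafilter ι) (hF : ∀ i, EvenConvexDensity (F i)) :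
    ∃ f : ℝ → ℝ, ∀ x ∈ Ioo (-1 : ℝ) 1, Tendsto (fun i => F i x) l (𝓝 (f x)) := by
  have : ∀ x : ℝ, ∃ y, x ∈ Ioo (-1 : ℝ) 1 → Tendsto (fun i => F i x) l (𝓝 y) := by
    intro x
    by_cases hx : x ∈ Ioo (-1 : ℝ) 1
    · have hmem : ∀ᶠ i in (l : Filter ι), F i x ∈ Icc 0 (invDensity x) :=
        Eventually.of_forall fun i => ⟨(hF i).nonneg x hx, (hF i).le_invDensity x hx⟩
      obtain ⟨y, -, hy⟩ := isCompact_Icc.ultrafilter_le_nhds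
        (l.map fun i => F i x) (le_principal_iff.2 hmem)
      exact ⟨y, fun _ => hy⟩
    · exact ⟨0, fun h => absurd h hx⟩
  choose f hf using this
  exact ⟨f, hf⟩

theorem one_sub_pow_mem_Ioo {i : ℕ} : 1 - (1 / 2 : ℝ) ^ i ∈ Ioo (-1 : ℝ) 1 := by
  have h1 : (0 : ℝ) < (1 / 2) ^ i := by positivity
  have h2 : (1 / 2 : ℝ) ^ i ≤ 1 := pow_le_one₀ (by norm_num) (by norm_num)
  constructor <;> linarith

theorem sum_mul_pow_le (hf : EvenConvexDensity f)
    (hint : ∫⁻ x in Ioo (-1 : ℝ) 1, ENNReal.ofReal (f x) ≤ 2) (m : ℕ) :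
    ∑ i ∈ Finset.range m, f (1 - (1 / 2) ^ i) * (1 / 2) ^ (i + 1) ≤ 2 := by
  have key : ∀ m : ℕ, ENNReal.ofReal
      (∑ i ∈ Finset.range m, f (1 - (1 / 2) ^ i) * (1 / 2) ^ (i + 1)) ≤
      ∫⁻ x in Ico (0 : ℝ) (1 - (1 / 2) ^ m), ENNReal.ofReal (f x) := by
    intro m
    induction m with
    | zero => simp
    | succ m ih =>
      have h0 : (0 : ℝ) ≤ 1 - (1 / 2) ^ m :=
        sub_nonneg.2 (pow_le_one₀ (by norm_num) (by norm_num))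
      have hle : 1 - (1 / 2 : ℝ) ^ m ≤ 1 - (1 / 2) ^ (m + 1) :=
        sub_le_sub_left (pow_le_pow_of_le_one (by norm_num) (by norm_num) m.le_succ) 1
      rw [Finset.sum_range_succ, ENNReal.ofReal_add
        (Finset.sum_nonneg fun i _ =>
          mul_nonneg (hf.nonneg _ one_sub_pow_mem_Ioo) (by positivity))
        (mul_nonneg (hf.nonneg _ one_sub_pow_mem_Ioo) (by positivity)),
        ← Ico_union_Ico_eq_Ico h0 hle,
        lintegral_union measurableSet_Ico (Ico_disjoint_Ico_same)]
      refine add_le_add ih ?_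
      calc ENNReal.ofReal (f (1 - (1 / 2) ^ m) * (1 / 2) ^ (m + 1))
          = ∫⁻ _ in Ico (1 - (1 / 2 : ℝ) ^ m) (1 - (1 / 2) ^ (m + 1)),
              ENNReal.ofReal (f (1 - (1 / 2) ^ m)) := by
            rw [setLIntegral_const, Real.volume_Ico,
              ENNReal.ofReal_mul (hf.nonneg _ one_sub_pow_mem_Ioo)]
            congr 2
            ring
        _ ≤ _ := setLIntegral_mono' measurableSet_Ico fun x hx =>
            ENNReal.ofReal_le_ofReal (hf.le_of_abs_le
              ⟨by linarith [hx.1], hx.2.trans one_sub_pow_mem_Ioo.2⟩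
              (by rw [abs_of_nonneg h0]; exact hx.1))
  have hsub : Ico (0 : ℝ) (1 - (1 / 2) ^ m) ⊆ Ioo (-1) 1 := fun x hx =>
    ⟨by linarith [hx.1], hx.2.trans one_sub_pow_mem_Ioo.2⟩
  have h2 := (key m).trans ((lintegral_mono_set hsub).trans hint)
  simpa using (ENNReal.ofReal_le_iff_le_toReal (by norm_num)).1 h2

theorem exists_one_sub_sq_mul_le (hf : EvenConvexDensity f)
    (hsum : ∀ m, ∑ i ∈ Finset.range m, f (1 - (1 / 2) ^ i) * (1 / 2) ^ (i + 1) ≤ 2)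
    {ε : ℝ} (hε : 0 < ε) :
    ∃ r < 1, ∀ t, r ≤ |t| → |t| < 1 → (1 - t ^ 2) * f t ≤ ε := by
  have hlim := (summable_of_sum_range_le (fun i =>
    mul_nonneg (hf.nonneg _ (one_sub_pow_mem_Ioo (i := i))) (by positivity))
    hsum).tendsto_atTop_zero
  obtain ⟨N, hN⟩ := eventually_atTop.1
    (hlim.eventually (gt_mem_nhds (by positivity : 0 < ε / 8)))
  refine ⟨1 - (1 / 2) ^ N, one_sub_pow_mem_Ioo.2, fun t hrt ht1 => ?_⟩
  obtain ⟨n, hn1, hn2⟩ := exists_nat_pow_near_of_lt_one (sub_pos.2 ht1)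
    (sub_le_self _ (abs_nonneg t)) (by norm_num : (0 : ℝ) < 1 / 2) (by norm_num)
  have hNn : N ≤ n + 1 := by
    by_contra! h
    have := pow_le_pow_of_le_one (by norm_num : (0 : ℝ) ≤ 1 / 2) (by norm_num) h.le
    linarith
  have hft : f t ≤ f (1 - (1 / 2) ^ (n + 1)) :=
    hf.le_of_abs_le one_sub_pow_mem_Ioo (by linarith)
  have h0 := hf.nonneg _ (one_sub_pow_mem_Ioo (i := n + 1))
  have hsmall := hN (n + 1) hNn
  have htt : 1 - t ^ 2 ≤ 2 * (1 / 2) ^ n := by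
    rw [← sq_abs]
    nlinarith [abs_nonneg t]
  have h1 : 0 ≤ 1 - t ^ 2 := (one_sub_sq_pos (abs_lt.1 ht1)).le
  calc (1 - t ^ 2) * f t
      ≤ 2 * (1 / 2) ^ n * f (1 - (1 / 2) ^ (n + 1)) :=
        mul_le_mul htt hft (hf.nonneg t (abs_lt.1 ht1)) (by positivity)
    _ = 8 * (f (1 - (1 / 2) ^ (n + 1)) * (1 / 2) ^ (n + 1 + 1)) := by ring
    _ ≤ ε := by linarith

end EvenConvexDensity

theorem iterate_gaussTransfer_one (n : ℕ) : ∀ x ∈ Ioo (-1 : ℝ) 1,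
    (gaussTransfer^[n] 1) x = ENNReal.ofReal ((realTransfer^[n] 1) x) := by
  induction n with
  | zero => simp
  | succ n ih =>
    intro x hx
    rw [Function.iterate_succ_apply', Function.iterate_succ_apply']
    exact (EvenConvexDensity.one.iterate n).gaussTransfer_ofReal ih hx

theorem lintegral_iterate_realTransfer_one (n : ℕ) :
    ∫⁻ x in Ioo (-1 : ℝ) 1, ENNReal.ofReal ((realTransfer^[n] 1) x) ≤ 2 := by
  rw [← setLIntegral_congr_fun measurableSet_Ioo (iterate_gaussTransfer_one n),
    lintegral_iterate_gaussTransfer measurable_one]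
  simp only [Pi.one_apply, setLIntegral_one, Real.volume_Ioo]
  norm_num

/-- The iterates of `1` decay pointwise along a subsequence: otherwise a limit of their Cesàro means
would be a nonzero integrable invariant density. -/
theorem exists_iterate_realTransfer_one_lt {a : ℝ} (ha : a ∈ Ioo (-1 : ℝ) 1) {c : ℝ}
    (hc : 0 < c) : ∃ n, (realTransfer^[n] 1) a < c := by
  by_contra! hcon
  have hF : ∀ n, EvenConvexDensity (realTransfer^[n] 1) := EvenConvexDensity.one.iterate
  obtain ⟨f, hlim⟩ := EvenConvexDensity.exists_tendsto (hyperfilter ℕ)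
    (EvenConvexDensity.average hF)
  have hf := EvenConvexDensity.of_tendsto (EvenConvexDensity.average hF) hlim
  have hinv : ∀ x ∈ Ioo (-1 : ℝ) 1, realTransfer f x = f x := by
    intro x hx
    have hd : Tendsto (fun N : ℕ => ((N : ℝ) + 1)⁻¹ *
        ((realTransfer^[N + 1] 1) x - (realTransfer^[0] 1) x)) (hyperfilter ℕ) (𝓝 0) := by
      refine Tendsto.mono_left ?_ Nat.hyperfilter_le_atTop
      refine squeeze_zero_norm (a := fun N : ℕ => 1 / ((N : ℝ) + 1) * invDensity x)
        (fun N => ?_) ?_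
      · rw [norm_mul, one_div, Real.norm_of_nonneg (by positivity)]
        refine mul_le_mul_of_nonneg_left (abs_le.2 ⟨?_, ?_⟩) (by positivity)
        · linarith [(hF (N + 1)).nonneg x hx, (hF 0).le_invDensity x hx]
        · linarith [(hF 0).nonneg x hx, (hF (N + 1)).le_invDensity x hx]
      · simpa using (tendsto_one_div_add_atTop_nhds_zero_nat (𝕜 := ℝ)).mul_const (invDensity x)
    refine tendsto_nhds_unique
      (EvenConvexDensity.tendsto_realTransfer (EvenConvexDensity.average hF) hlim hx) ?_
    simpa only [add_zero] using ((hlim x hx).add hd).congr fun N => by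
      rw [EvenConvexDensity.realTransfer_average hF N hx, ← mul_add,
        ← Finset.sum_range_sub (fun n => (realTransfer^[n] 1) x), ← Finset.sum_add_distrib]
      simp only [add_sub_cancel, Function.iterate_succ_apply']
  have hsum : ∀ m, ∑ i ∈ Finset.range m, f (1 - (1 / 2) ^ i) * (1 / 2) ^ (i + 1) ≤ 2 := by
    intro m
    refine le_of_tendsto' (tendsto_finsetSum _ fun i _ =>
      (hlim _ EvenConvexDensity.one_sub_pow_mem_Ioo).mul_const _) fun N => ?_
    simp only [mul_assoc, Finset.sum_mul]
    rw [← Finset.mul_sum, inv_mul_le_iff₀ (by positivity), Finset.sum_comm]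
    refine (Finset.sum_le_card_nsmul _ _ 2 fun n _ =>
      (hF n).sum_mul_pow_le (lintegral_iterate_realTransfer_one n) m).trans_eq ?_
    simp
  have hzero := hf.eq_zero_of_realTransfer_eq hinv
    (fun ε hε => hf.exists_one_sub_sq_mul_le hsum hε) a ha
  have hca : c ≤ f a := ge_of_tendsto' (hlim a ha) fun N => by
    rw [le_inv_mul_iff₀ (by positivity)]
    refine le_trans (by simp) (Finset.card_nsmul_le_sum _ _ c fun n _ => hcon n)
  linarith

theorem exists_lintegral_iterate_gaussTransfer_one_le {a : ℝ} (ha : a ∈ Ioo (0 : ℝ) 1)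
    {δ : ℝ≥0∞} (hδ : δ ≠ 0) : ∃ n, ∫⁻ x in Ioo (-a) a, (gaussTransfer^[n] 1) x ≤ δ := by
  have ha' : a ∈ Ioo (-1 : ℝ) 1 := ⟨by linarith [ha.1], ha.2⟩
  have hδ1 : min δ 1 ≠ ∞ := ne_top_of_le_ne_top ENNReal.one_ne_top (min_le_right _ _)
  have hc : 0 < (min δ 1).toReal / 2 :=
    half_pos (ENNReal.toReal_pos (lt_min (pos_iff_ne_zero.2 hδ) one_pos).ne' hδ1)
  obtain ⟨n, hn⟩ := exists_iterate_realTransfer_one_lt ha' hc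
  refine ⟨n, ?_⟩
  calc ∫⁻ x in Ioo (-a) a, (gaussTransfer^[n] 1) x
      ≤ ∫⁻ _ in Ioo (-a) a, ENNReal.ofReal ((min δ 1).toReal / 2) :=
        setLIntegral_mono' measurableSet_Ioo fun x hx => by
          rw [iterate_gaussTransfer_one n x
            ⟨by linarith [hx.1, ha.2], hx.2.trans ha.2⟩]
          exact ENNReal.ofReal_le_ofReal (((EvenConvexDensity.one.iterate n).le_of_abs_le ha'
            (abs_lt.2 hx).le).trans hn.le)
    _ = ENNReal.ofReal ((min δ 1).toReal / 2 * (a - -a)) := by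
        rw [setLIntegral_const, Real.volume_Ioo, ENNReal.ofReal_mul hc.le]
    _ ≤ ENNReal.ofReal (min δ 1).toReal := ENNReal.ofReal_le_ofReal (by nlinarith [ha.2])
    _ ≤ δ := by
        rw [ENNReal.ofReal_toReal hδ1]
        exact min_le_left _ _

theorem ae_eq_zero_of_integral_exp_eq_zero {φ : ℝ → ℂ} (hm : Measurable φ)
    (hφ : Integrable φ) (ω₁ ω₂ : ℝ)
    (h1 : ∀ m : ℤ, ∫ t : ℝ, Complex.exp (Complex.I * Real.pi * ((m : ℂ) + ω₁) * t) * φ t = 0)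
    (h2 : ∀ n : ℤ,
      ∫ t : ℝ, Complex.exp (-(Complex.I * Real.pi * ((n : ℂ) + ω₂)) / t) * φ t = 0) :
    ∀ᵐ t : ℝ, φ t = 0 := by
  obtain ⟨ψ, hψdef⟩ : ∃ ψ : ℝ → ℂ, ψ = fun s => (s ^ 2)⁻¹ • φ (-s⁻¹) := ⟨_, rfl⟩
  have hψm : Measurable ψ := by
    rw [hψdef]
    fun_prop
  have hψ : Integrable ψ := hψdef ▸ integrable_comp_neg_inv hφ
  have h2' : ∀ n : ℤ,
      ∫ s : ℝ, Complex.exp (Complex.I * Real.pi * ((n : ℂ) + ω₂) * s) * ψ s = 0 := by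
    intro n
    refine Eq.trans ?_ ((integral_comp_neg_inv _).trans (h2 n))
    refine integral_congr_ae (ae_of_all _ fun s => ?_)
    simp only [hψdef]
    rw [mul_smul_comm]
    push_cast
    rw [neg_div_neg_eq, div_inv_eq_mul]
  have hψφ : ∀ s, ‖ψ s‖ₑ = ENNReal.ofReal (s ^ 2)⁻¹ * ‖φ (-s⁻¹)‖ₑ := fun s => by
    rw [hψdef]
    simp only [enorm_smul]
    rw [Real.enorm_of_nonneg (by positivity)]
  have hφψ : ∀ t ≠ 0, ‖φ t‖ₑ = ENNReal.ofReal (t ^ 2)⁻¹ * ‖ψ (-t⁻¹)‖ₑ := fun t ht => by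
    rw [hψφ, ← mul_assoc, ← ENNReal.ofReal_mul (by positivity)]
    have : (t ^ 2)⁻¹ * ((-t⁻¹) ^ 2)⁻¹ = 1 := by field_simp
    rw [this]
    simp
  obtain ⟨ρ, hρdef⟩ : ∃ ρ : ℝ → ℝ≥0∞, ρ = (fun t => ‖φ t‖ₑ) + fun t => ‖ψ t‖ₑ := ⟨_, rfl⟩
  have hρ : ρ ≤ᵐ[volume.restrict (Ioo (-1) 1)] gaussTransfer ρ := by
    rw [hρdef, gaussTransfer_add, add_comm (gaussTransfer _)]
    refine (ae_restrict_iff' measurableSet_Ioo).2 ?_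
    filter_upwards [ae_enorm_le_tsum_of_integral_exp_eq_zero hφ ω₁ h1,
      ae_enorm_le_tsum_of_integral_exp_eq_zero hψ ω₂ h2'] with t ht1 ht2 ht
    refine add_le_add ((ht1 ht).trans_eq (tsum_congr fun j => ?_))
      ((ht2 ht).trans_eq (tsum_congr fun j => ?_))
    · split_ifs with hj
      · rfl
      · exact hφψ _ (abs_pos.1 (one_pos.trans (one_lt_abs_add_two_mul ht hj)))
    · split_ifs
      · rfl
      · exact hψφ _
  have hρm : Measurable ρ := by
    rw [hρdef]
    fun_prop
  have hρfin : ∫⁻ t in Ioo (-1 : ℝ) 1, ρ t ≠ ∞ := by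
    refine ne_top_of_le_ne_top ?_ (setLIntegral_le_lintegral _ _)
    simp only [hρdef, Pi.add_apply]
    rw [lintegral_add_left hm.enorm]
    exact ENNReal.add_ne_top.2 ⟨hφ.2.ne, hψ.2.ne⟩
  have hzero := (ae_restrict_iff' measurableSet_Ioo).1 (ae_eq_zero_of_le_gaussTransfer
    (fun a ha δ hδ => exists_lintegral_iterate_gaussTransfer_one_le ha hδ) hρm hρfin hρ)
  have hout : ∫⁻ t, (Ioo (-1 : ℝ) 1)ᶜ.indicator (fun t => ‖φ t‖ₑ) t = 0 := by
    rw [← lintegral_comp_neg_inv, lintegral_eq_zero_iff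
      (by have := hm.enorm.indicator (measurableSet_Ioo (a := (-1 : ℝ)) (b := 1)).compl; fun_prop)]
    filter_upwards [hzero, Measure.ae_ne volume 1, Measure.ae_ne volume (-1 : ℝ)]
      with x hx hx1 hx2
    by_cases hxI : -x⁻¹ ∈ Ioo (-1 : ℝ) 1
    · simp [hxI]
    · have hxmem : x ∈ Ioo (-1 : ℝ) 1 := by
        have hle : |x| ≤ 1 := not_lt.1 fun h => hxI (neg_inv_mem_Ioo h)
        exact ⟨(abs_le.1 hle).1.lt_of_ne' hx2, (abs_le.1 hle).2.lt_of_ne hx1⟩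
      have hv := hx hxmem
      rw [hρdef, Pi.add_apply, Pi.zero_apply, add_eq_zero] at hv
      rw [indicator_of_mem hxI, ← hψφ]
      exact hv.2
  rw [lintegral_eq_zero_iff (hm.enorm.indicator measurableSet_Ioo.compl)] at hout
  filter_upwards [hzero, hout] with t ht hto
  by_cases hI : t ∈ Ioo (-1 : ℝ) 1
  · have hv := ht hI
    rw [hρdef, Pi.add_apply, Pi.zero_apply, add_eq_zero] at hv
    exact enorm_eq_zero.1 hv.1
  · rw [indicator_of_mem hI] at hto
    exact enorm_eq_zero.1 hto

end KleinGordon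

/-- Fix `ω₁ ω₂ ∈ ℝ`. If `φ ∈ L¹(ℝ)` satisfies
`∫ e^{iπ(m+ω₁)t} φ(t) dt = 0` for every `m ∈ ℤ` and `∫ e^{-iπ(n+ω₂)/t} φ(t) dt = 0`
for every `n ∈ ℤ`, then `φ = 0` a.e. -/
theorem statement2 (ω₁ ω₂ : ℝ) (φ : ℝ → ℂ) (hφ : Integrable φ)
    (h1 : ∀ m : ℤ,
      ∫ t : ℝ, Complex.exp (Complex.I * (Real.pi : ℂ) * ((m : ℂ) + (ω₁ : ℂ)) * (t : ℂ)) * φ t = 0)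
    (h2 : ∀ n : ℤ,
      ∫ t : ℝ, Complex.exp (-(Complex.I * (Real.pi : ℂ) * ((n : ℂ) + (ω₂ : ℂ))) / (t : ℂ)) * φ t = 0) :
    ∀ᵐ t : ℝ ∂(volume : Measure ℝ), φ t = 0 := by
  have hae := hφ.1.ae_eq_mk
  have h0 := KleinGordon.ae_eq_zero_of_integral_exp_eq_zero
    hφ.1.stronglyMeasurable_mk.measurable (hφ.congr hae) ω₁ ω₂
    (fun m => (integral_congr_ae (hae.symm.mono fun t ht => by simp only [ht])).trans (h1 m))
    (fun n => (integral_congr_ae (hae.symm.mono fun t ht => by simp only [ht])).trans (h2 n))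
  filter_upwards [hae, h0] with t ht ht0
  rw [ht, ht0]
end

section
/- Fix an integer k ≥ 0. Suppose φ ∈ L¹(ℝ) satisfies the extra integrability condition ∫_ℝ |φ(t)| (1 + |t|^k) dt < +∞, and suppose that ∫_ℝ e^{iπmt} φ(t) dt = 0 for every m ∈ ℤ and ∫_ℝ e^{−iπn/t} t^k φ(t) dt = 0 for every n ∈ ℤ. Then φ = 0 almost everywhere on ℝ. -/
open MeasureTheory

section

open Set Filter Topology
open scoped ENNReal

theorem iUnion_Ioc_two_mul : ⋃ j : ℤ, Ioc (-1 + 2 * (j : ℝ)) (1 + 2 * j) = univ := by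
  have h := iUnion_Ioc_add_zsmul (two_pos (α := ℝ)) (-1)
  rw [← h]
  refine iUnion_congr fun j => ?_
  simp only [zsmul_eq_mul]
  push_cast
  congr 1 <;> ring

theorem pairwise_disjoint_Ioc_two_mul :
    Pairwise (Function.onFun Disjoint fun j : ℤ => Ioc (-1 + 2 * (j : ℝ)) (1 + 2 * j)) := by
  have h := pairwise_disjoint_Ioc_add_zsmul (-1 : ℝ) 2
  convert h using 3 with j
  simp only [zsmul_eq_mul]
  push_cast
  congr 1 <;> ring

theorem preimage_add_two_mul_Ioc (j : ℤ) :
    (fun t : ℝ => t + 2 * j) ⁻¹' Ioc (-1 + 2 * (j : ℝ)) (1 + 2 * j) = Ioc (-1) 1 := by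
  ext t; simp

theorem setLIntegral_tsum_add_two_mul {f : ℝ → ℝ≥0∞} (hf : Measurable f) :
    ∫⁻ t in Ioo (-1 : ℝ) 1, ∑' j : ℤ, f (t + 2 * j) = ∫⁻ t, f t := by
  rw [setLIntegral_congr Ioo_ae_eq_Ioc, lintegral_tsum fun j => by fun_prop,
    ← setLIntegral_univ, ← iUnion_Ioc_two_mul,
    lintegral_iUnion (fun _ => measurableSet_Ioc) pairwise_disjoint_Ioc_two_mul]
  refine tsum_congr fun j => ?_
  rw [← preimage_add_two_mul_Ioc j]
  exact (measurePreserving_add_right volume (2 * (j : ℝ))).setLIntegral_comp_preimage_emb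
    (measurableEmbedding_addRight _) f _

theorem setIntegral_tsum_add_two_mul {f : ℝ → ℂ} (hf : Integrable f) (hm : Measurable f) :
    ∫ t in Ioo (-1 : ℝ) 1, ∑' j : ℤ, f (t + 2 * j) = ∫ t, f t := by
  have hfin := setLIntegral_tsum_add_two_mul hm.enorm
  rw [lintegral_tsum fun j => by fun_prop] at hfin
  rw [integral_tsum (fun j => by
    exact (hm.comp (measurable_add_const _)).aestronglyMeasurable) (by rw [hfin]; exact hf.2.ne)]
  have := hasSum_integral_iUnion (f := f) (μ := volume) (fun _ => measurableSet_Ioc)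
    pairwise_disjoint_Ioc_two_mul hf.integrableOn
  rw [iUnion_Ioc_two_mul, setIntegral_univ] at this
  rw [← this.tsum_eq]
  refine tsum_congr fun j => ?_
  rw [← integral_Ioc_eq_integral_Ioo, ← preimage_add_two_mul_Ioc j]
  exact (measurePreserving_add_right volume (2 * (j : ℝ))).setIntegral_preimage_emb
    (measurableEmbedding_addRight _) f _

theorem integral_continuousMap_mul_eq_zero {f : ℝ → ℂ} (hf : Integrable f)
    (h : ∀ m : ℤ,
      ∫ t : ℝ, Complex.exp (Complex.I * (Real.pi : ℂ) * (m : ℂ) * (t : ℂ)) * f t = 0)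
    (c : C(AddCircle (2 : ℝ), ℂ)) : ∫ t : ℝ, c (t : AddCircle (2 : ℝ)) * f t = 0 := by
  have : Fact ((0 : ℝ) < 2) := ⟨two_pos⟩
  have hint (c : C(AddCircle (2 : ℝ), ℂ)) :
      Integrable fun t : ℝ => c (t : AddCircle (2 : ℝ)) * f t := by
    refine hf.bdd_mul (c := ‖c‖) ?_ (.of_forall fun t => c.norm_coe_le_norm _)
    exact (c.continuous.comp (AddCircle.continuous_mk' 2)).aestronglyMeasurable
  let L : C(AddCircle (2 : ℝ), ℂ) →ₗ[ℂ] ℂ :=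
    { toFun := fun c => ∫ t : ℝ, c (t : AddCircle (2 : ℝ)) * f t
      map_add' := fun c d => by
        simp only [ContinuousMap.add_apply, add_mul]
        exact integral_add (hint c) (hint d)
      map_smul' := fun r c => by
        simp only [ContinuousMap.smul_apply, smul_eq_mul, mul_assoc, RingHom.id_apply]
        exact integral_const_mul _ _ }
  have hL : Continuous L := by
    refine AddMonoidHomClass.continuous_of_bound L (∫ t, ‖f t‖) fun c => ?_
    rw [mul_comm, ← integral_const_mul]
    refine norm_integral_le_of_norm_le (hf.norm.const_mul _) (.of_forall fun t => ?_)
    rw [norm_mul]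
    gcongr
    exact c.norm_coe_le_norm _
  have hle : (Submodule.span ℂ (range (@fourier 2))).topologicalClosure ≤ LinearMap.ker L := by
    refine Submodule.topologicalClosure_minimal _ (Submodule.span_le.2 ?_) ?_
    · rintro _ ⟨m, rfl⟩
      change ∫ t : ℝ, fourier m (t : AddCircle (2 : ℝ)) * f t = 0
      rw [← h m]
      congr 1 with t
      rw [fourier_coe_apply]
      congr 2
      push_cast
      ring
    · exact isClosed_singleton.preimage hL
  rw [span_fourier_closure_eq_top] at hle
  exact hle (Submodule.mem_top (x := c))

theorem ae_tsum_add_two_mul_eq_zero {f : ℝ → ℂ} (hf : Integrable f) (hm : Measurable f)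
    (h : ∀ m : ℤ,
      ∫ t : ℝ, Complex.exp (Complex.I * (Real.pi : ℂ) * (m : ℂ) * (t : ℂ)) * f t = 0) :
    ∀ᵐ t : ℝ, t ∈ Ioo (-1 : ℝ) 1 → ∑' j : ℤ, f (t + 2 * j) = 0 := by
  have : Fact ((0 : ℝ) < 2) := ⟨two_pos⟩
  have hfin := setLIntegral_tsum_add_two_mul hm.enorm
  refine isOpen_Ioo.ae_eq_zero_of_integral_contDiff_smul_eq_zero ?_ fun g hg _ hsupp => ?_
  · refine IntegrableOn.locallyIntegrableOn ⟨?_, ?_⟩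
    · exact (Measurable.tsum fun j => by fun_prop).aestronglyMeasurable
    · refine lt_of_le_of_lt (lintegral_mono fun t => ?_) (hfin.trans_lt hf.2)
      exact enorm_tsum_le_tsum_enorm
  · have hg0 : ∀ t, t ∉ Ioo (-1 : ℝ) 1 → g t = 0 := fun t ht =>
      image_eq_zero_of_notMem_tsupport fun h' => ht (hsupp h')
    let G : ℝ → ℂ := fun t => (g t : ℂ)
    have hG : Continuous (AddCircle.liftIoc 2 (-1) G) := by
      refine AddCircle.liftIoc_continuous ?_ ?_
      · simp only [G]
        rw [hg0 (-1) (by simp), hg0 (-1 + 2) (by norm_num)]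
      · exact (Complex.continuous_ofReal.comp hg.continuous).continuousOn
    have key := integral_continuousMap_mul_eq_zero hf h ⟨_, hG⟩
    simp only [ContinuousMap.coe_mk] at key
    have hcm : Continuous fun t : ℝ => AddCircle.liftIoc 2 (-1) G (t : AddCircle (2 : ℝ)) :=
      hG.comp (AddCircle.continuous_mk' 2)
    obtain ⟨C, hC⟩ := (isCompact_range hG).isBounded.exists_norm_le
    rw [← setIntegral_tsum_add_two_mul
      (hf.bdd_mul (c := C) hcm.aestronglyMeasurable
        (.of_forall fun t => hC _ ⟨_, rfl⟩)) (hcm.measurable.mul hm)] at key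
    rw [← setIntegral_eq_integral_of_forall_compl_eq_zero (s := Ioo (-1 : ℝ) 1), ← key]
    · refine setIntegral_congr_fun measurableSet_Ioo fun t ht => ?_
      have hper (j : ℤ) : AddCircle.liftIoc 2 (-1) G ((t + 2 * j : ℝ) : AddCircle (2 : ℝ)) = G t := by
        have : ((t + 2 * j : ℝ) : AddCircle (2 : ℝ)) = (t : AddCircle (2 : ℝ)) := by
          rw [AddCircle.coe_add, add_eq_left, AddCircle.coe_eq_zero_iff]
          exact ⟨j, by simp [mul_comm]⟩
        rw [this, AddCircle.liftIoc_coe_apply]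
        exact ⟨ht.1, by linarith [ht.2]⟩
      simp only [hper, tsum_mul_left]
      simp [G]
    · intro t ht
      simp [hg0 t ht]

theorem ae_enorm_le_tsum_add_two_mul {f : ℝ → ℂ} (hf : Integrable f) (hm : Measurable f)
    (h : ∀ m : ℤ,
      ∫ t : ℝ, Complex.exp (Complex.I * (Real.pi : ℂ) * (m : ℂ) * (t : ℂ)) * f t = 0) :
    ∀ᵐ t : ℝ, t ∈ Ioo (-1 : ℝ) 1 → ‖f t‖ₑ ≤ ∑' j : {j : ℤ // j ≠ 0}, ‖f (t + 2 * j)‖ₑ := by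
  have hfin := setLIntegral_tsum_add_two_mul hm.enorm
  have hsum : ∀ᵐ t : ℝ, t ∈ Ioo (-1 : ℝ) 1 → ∑' j : ℤ, ‖f (t + 2 * j)‖ₑ < ∞ := by
    rw [← ae_restrict_iff' measurableSet_Ioo]
    refine ae_lt_top (Measurable.tsum fun j => by fun_prop) ?_
    rw [hfin]
    exact hf.2.ne
  filter_upwards [hsum, ae_tsum_add_two_mul_eq_zero hf hm h] with t h1 h2 ht
  have hs : Summable fun j : ℤ => f (t + 2 * j) :=
    .of_nnnorm (tsum_enorm_ne_top_iff_summable_nnnorm.1 (h1 ht).ne)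
  have h3 := hs.sum_add_tsum_compl (s := {0})
  rw [h2 ht, Finset.sum_singleton] at h3
  simp only [Int.cast_zero, mul_zero, add_zero] at h3
  rw [eq_neg_of_add_eq_zero_left h3, enorm_neg]
  refine enorm_tsum_le_tsum_enorm.trans_eq ?_
  rw [Finset.coe_singleton]
  rfl

/-- The transfer operator of the Gauss-type map `x ↦ -1 / x mod 2` on `(-1, 1)`. -/
noncomputable def gaussTransfer (F : ℝ → ℝ≥0∞) (s : ℝ) : ℝ≥0∞ :=
  ∑' j : {j : ℤ // j ≠ 0}, ENNReal.ofReal (1 / (s + 2 * j) ^ 2) * F (-1 / (s + 2 * j))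

theorem one_lt_abs_add_two_mul {s : ℝ} (hs : s ∈ Ioo (-1 : ℝ) 1) {j : ℤ} (hj : j ≠ 0) :
    1 < |s + 2 * j| := by
  rcases lt_or_gt_of_ne hj with h | h
  · have : (j : ℝ) ≤ -1 := by exact_mod_cast Int.le_sub_one_of_lt h
    rw [lt_abs]
    right
    linarith [hs.2]
  · have : (1 : ℝ) ≤ j := by exact_mod_cast h
    rw [lt_abs]
    left
    linarith [hs.1]

theorem neg_one_div_mem_Ioo {y : ℝ} (hy : 1 < |y|) : -1 / y ∈ Ioo (-1 : ℝ) 1 := by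
  rw [mem_Ioo, ← abs_lt, abs_div, abs_neg, abs_one]
  exact (div_lt_one (by linarith)).2 hy

theorem gaussTransfer_measurable {F : ℝ → ℝ≥0∞} (hF : Measurable F) :
    Measurable (gaussTransfer F) :=
  Measurable.tsum fun j => by fun_prop

theorem gaussTransfer_mono {F G : ℝ → ℝ≥0∞} (h : ∀ x ∈ Ioo (-1 : ℝ) 1, F x ≤ G x) {s : ℝ}
    (hs : s ∈ Ioo (-1 : ℝ) 1) : gaussTransfer F s ≤ gaussTransfer G s :=
  ENNReal.tsum_le_tsum fun j =>
    mul_le_mul_right (h _ (neg_one_div_mem_Ioo (one_lt_abs_add_two_mul hs j.2))) _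

theorem gaussTransfer_add (F G : ℝ → ℝ≥0∞) (s : ℝ) :
    gaussTransfer (fun x => F x + G x) s = gaussTransfer F s + gaussTransfer G s := by
  simp only [gaussTransfer, mul_add, ENNReal.tsum_add]

theorem gaussTransfer_const_mul (c : ℝ≥0∞) (F : ℝ → ℝ≥0∞) (s : ℝ) :
    gaussTransfer (fun x => c * F x) s = c * gaussTransfer F s := by
  simp only [gaussTransfer, ← ENNReal.tsum_mul_left]
  exact tsum_congr fun j => mul_left_comm _ _ _

theorem hasDerivAt_neg_one_div {y : ℝ} (hy : y ≠ 0) :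
    HasDerivAt (fun y : ℝ => -1 / y) (1 / y ^ 2) y := by
  simpa [neg_div, Function.comp_def, Pi.neg_def] using (hasDerivAt_inv hy).neg

theorem injective_neg_one_div : Function.Injective fun y : ℝ => -1 / y := by
  intro a b h
  simpa [neg_div] using h

theorem image_neg_one_div_one_lt_abs :
    (fun y : ℝ => -1 / y) '' {y | 1 < |y|} = Ioo (-1) 1 \ {0} := by
  ext x
  constructor
  · rintro ⟨y, hy, rfl⟩
    have : y ≠ 0 := by rintro rfl; simp at hy; linarith
    exact ⟨neg_one_div_mem_Ioo hy, by simpa using this⟩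
  · rintro ⟨hx, hx0⟩
    have hx0 : x ≠ 0 := hx0
    refine ⟨-1 / x, ?_, by field_simp⟩
    rw [mem_ofPred_eq, abs_div, abs_neg, abs_one, one_lt_div (abs_pos.2 hx0)]
    exact abs_lt.2 hx

theorem setLIntegral_gaussTransfer {F : ℝ → ℝ≥0∞} (hF : Measurable F) :
    ∫⁻ s in Ioo (-1 : ℝ) 1, gaussTransfer F s = ∫⁻ x in Ioo (-1 : ℝ) 1, F x := by
  let S : Set ℝ := {y | 1 < |y|}
  have hS : MeasurableSet S := measurableSet_lt measurable_const measurable_id.abs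
  let f : ℝ → ℝ≥0∞ := S.indicator fun y => ENNReal.ofReal (1 / y ^ 2) * F (-1 / y)
  have hf : Measurable f := Measurable.indicator (by fun_prop) hS
  have h1 : ∀ s ∈ Ioo (-1 : ℝ) 1, gaussTransfer F s = ∑' j : ℤ, f (s + 2 * j) := by
    intro s hs
    rw [← tsum_subtype_eq_of_support_subset (s := {j : ℤ | j ≠ 0})]
    · refine tsum_congr fun j => ?_
      exact (indicator_of_mem (s := S) (one_lt_abs_add_two_mul hs j.2)
        fun y : ℝ => ENNReal.ofReal (1 / y ^ 2) * F (-1 / y)).symm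
    · intro j hj h0
      subst h0
      refine hj (indicator_of_notMem (s := S) ?_ _)
      have := abs_lt.2 hs
      simpa [S] using this.le
  rw [setLIntegral_congr_fun measurableSet_Ioo h1, setLIntegral_tsum_add_two_mul hf,
    lintegral_indicator hS]
  have hne : ∀ y ∈ S, y ≠ 0 := by
    rintro y hy rfl
    simp only [S, mem_ofPred_eq, abs_zero] at hy
    linarith
  have h2 := lintegral_image_eq_lintegral_abs_deriv_mul hS
    (fun y hy => (hasDerivAt_neg_one_div (hne y hy)).hasDerivWithinAt)
    injective_neg_one_div.injOn F
  rw [image_neg_one_div_one_lt_abs] at h2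
  rw [setLIntegral_congr (sdiff_null_ae_eq_self (measure_singleton 0))] at h2
  rw [h2]
  refine lintegral_congr fun y => ?_
  rw [abs_of_nonneg (by positivity)]

theorem gaussTransfer_ae_mono {F G : ℝ → ℝ≥0∞}
    (h : ∀ᵐ x, x ∈ Ioo (-1 : ℝ) 1 → F x ≤ G x) :
    ∀ᵐ s, s ∈ Ioo (-1 : ℝ) 1 → gaussTransfer F s ≤ gaussTransfer G s := by
  obtain ⟨N, hN, hNm, hN0⟩ := exists_measurable_superset_of_null h
  let u : ℝ → ℝ≥0∞ := N.indicator fun _ => 1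
  have hu : Measurable u := measurable_const.indicator hNm
  have h0 : ∫⁻ s in Ioo (-1 : ℝ) 1, gaussTransfer u s = 0 := by
    rw [setLIntegral_gaussTransfer hu, ← nonpos_iff_eq_zero]
    refine (setLIntegral_le_lintegral _ _).trans ?_
    simp [u, lintegral_indicator hNm, hN0]
  rw [lintegral_eq_zero_iff (gaussTransfer_measurable hu), Filter.EventuallyEq,
    ae_restrict_iff' measurableSet_Ioo] at h0
  filter_upwards [h0] with s hs hsI
  refine ENNReal.tsum_le_tsum fun j => mul_le_mul_right ?_ _
  have hj := ENNReal.tsum_eq_zero.1 (hs hsI) j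
  have hy := one_lt_abs_add_two_mul hsI j.2
  have hpos : ENNReal.ofReal (1 / (s + 2 * (j : ℤ)) ^ 2) ≠ 0 := by
    have : s + 2 * ((j : ℤ) : ℝ) ≠ 0 := by rw [← abs_pos]; linarith
    simp only [ne_eq, ENNReal.ofReal_eq_zero, not_le]
    positivity
  have hnot : -1 / (s + 2 * ((j : ℤ) : ℝ)) ∉ N := fun hmem => by
    rcases mul_eq_zero.1 hj with h' | h'
    · exact hpos h'
    · simp [u, hmem] at h'
  by_contra hlt
  exact hnot (hN fun h' => hlt (h' (neg_one_div_mem_Ioo hy)))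

theorem hasSum_one_div_add_two_mul_sq_sub_one_nat {s : ℝ} (hs : s ∈ Ioo (-1 : ℝ) 1) :
    HasSum (fun n : ℕ => 1 / ((s + 2 * (n + 1 : ℝ)) ^ 2 - 1)) (1 / (2 * (1 + s))) := by
  have hs1 := hs.1
  have hpos (n : ℕ) : 0 < s + 2 * (n : ℝ) + 1 := by
    have : (0 : ℝ) ≤ n := n.cast_nonneg
    linarith
  have heq (n : ℕ) : 1 / ((s + 2 * (n + 1 : ℝ)) ^ 2 - 1) =
      1 / (2 * (s + 2 * (n : ℝ) + 1)) - 1 / (2 * (s + 2 * ((n + 1 : ℕ) : ℝ) + 1)) := by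
    have h1 := hpos n
    have h2 := hpos (n + 1)
    have h3 : (s + 2 * (n + 1 : ℝ)) ^ 2 - 1 =
      (s + 2 * (n : ℝ) + 1) * (s + 2 * ((n + 1 : ℕ) : ℝ) + 1) := by push_cast; ring
    rw [h3]
    field_simp
    push_cast
    ring
  rw [hasSum_iff_tendsto_nat_of_nonneg]
  · simp_rw [heq]
    simp_rw [Finset.sum_range_sub']
    rw [show 1 / (2 * (1 + s)) = 1 / (2 * (s + 2 * ((0 : ℕ) : ℝ) + 1)) - 0 by
      push_cast; ring_nf]
    refine tendsto_const_nhds.sub ?_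
    refine Tendsto.div_atTop tendsto_const_nhds ?_
    refine Tendsto.const_mul_atTop two_pos (tendsto_atTop_add_const_right _ _ ?_)
    exact tendsto_atTop_add_const_left _ _
      (tendsto_natCast_atTop_atTop.const_mul_atTop two_pos)
  · intro n
    refine one_div_nonneg.2 ?_
    have := hpos n
    nlinarith

theorem hasSum_one_div_add_two_mul_sq_sub_one {s : ℝ} (hs : s ∈ Ioo (-1 : ℝ) 1) :
    HasSum (fun j : {j : ℤ // j ≠ 0} => 1 / ((s + 2 * (j : ℤ)) ^ 2 - 1)) (1 / (1 - s ^ 2)) := by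
  have h1 := hasSum_one_div_add_two_mul_sq_sub_one_nat hs
  have h2 := hasSum_one_div_add_two_mul_sq_sub_one_nat (s := -s)
    ⟨by linarith [hs.2], by linarith [hs.1]⟩
  let f : ℤ → ℝ := ({j : ℤ | j ≠ 0}).indicator fun j => 1 / ((s + 2 * (j : ℝ)) ^ 2 - 1)
  have h3 : HasSum f (1 / (2 * (1 + s)) + f 0 + 1 / (2 * (1 + -s))) := by
    refine HasSum.of_add_one_of_neg_add_one ?_ ?_
    · convert h1 using 2 with n
      rw [show f (n + 1) = _ from indicator_of_mem (by simp; omega) _]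
      push_cast
      rfl
    · convert h2 using 2 with n
      rw [show f (-(n + 1)) = _ from indicator_of_mem (by simp; omega) _]
      push_cast
      ring_nf
  have h4 : 1 / (2 * (1 + s)) + f 0 + 1 / (2 * (1 + -s)) = 1 / (1 - s ^ 2) := by
    have : f 0 = 0 := by simp [f]
    have ha : 1 + s ≠ 0 := by linarith [hs.1]
    have hb : 1 + -s ≠ 0 := by linarith [hs.2]
    rw [this, show 1 - s ^ 2 = (1 + s) * (1 + -s) by ring]
    field_simp
    ring
  rw [h4] at h3
  exact hasSum_subtype_iff_indicator.2 h3

theorem gaussTransfer_invariantDensity {s : ℝ} (hs : s ∈ Ioo (-1 : ℝ) 1) :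
    gaussTransfer (fun x => ENNReal.ofReal (1 / (1 - x ^ 2))) s =
      ENNReal.ofReal (1 / (1 - s ^ 2)) := by
  have h := hasSum_one_div_add_two_mul_sq_sub_one hs
  have hy (j : {j : ℤ // j ≠ 0}) : 0 < (s + 2 * ((j : ℤ) : ℝ)) ^ 2 - 1 := by
    have := (one_lt_sq_iff_one_lt_abs _).2 (one_lt_abs_add_two_mul hs j.2)
    linarith
  rw [← h.tsum_eq, ENNReal.ofReal_tsum_of_nonneg (fun j => (one_div_pos.2 (hy j)).le) h.summable]
  refine tsum_congr fun j => ?_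
  rw [← ENNReal.ofReal_mul (by positivity)]
  congr 1
  have := hy j
  have h0 : s + 2 * ((j : ℤ) : ℝ) ≠ 0 := by rintro h0; rw [h0] at this; norm_num at this
  rw [one_div_mul_one_div]
  congr 1
  field_simp

/-- The iterates of the constant function `1` under `gaussTransfer`. -/
noncomputable def gaussIterate (n : ℕ) : ℝ → ℝ≥0∞ := gaussTransfer^[n] fun _ => 1

theorem gaussIterate_succ (n : ℕ) : gaussIterate (n + 1) = gaussTransfer (gaussIterate n) :=
  Function.iterate_succ_apply' _ _ _

theorem gaussIterate_measurable (n : ℕ) : Measurable (gaussIterate n) := by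
  induction n with
  | zero => exact measurable_const
  | succ n ih => rw [gaussIterate_succ]; exact gaussTransfer_measurable ih

theorem setLIntegral_gaussIterate (n : ℕ) : ∫⁻ s in Ioo (-1 : ℝ) 1, gaussIterate n s = 2 := by
  induction n with
  | zero =>
    simp only [gaussIterate, Function.iterate_zero, id_eq, lintegral_const,
      Measure.restrict_apply_univ, Real.volume_Ioo, one_mul]
    norm_num
  | succ n ih =>
    rw [gaussIterate_succ, setLIntegral_gaussTransfer (gaussIterate_measurable n), ih]

theorem one_sub_sq_pos {s : ℝ} (hs : s ∈ Ioo (-1 : ℝ) 1) : 0 < 1 - s ^ 2 := by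
  nlinarith [hs.1, hs.2]

theorem gaussIterate_le (n : ℕ) {s : ℝ} (hs : s ∈ Ioo (-1 : ℝ) 1) :
    gaussIterate n s ≤ ENNReal.ofReal (1 / (1 - s ^ 2)) := by
  induction n generalizing s with
  | zero =>
    change 1 ≤ _
    rw [ENNReal.one_le_ofReal, one_le_div (one_sub_sq_pos hs)]
    nlinarith [sq_nonneg s]
  | succ n ih =>
    rw [gaussIterate_succ, ← gaussTransfer_invariantDensity hs]
    exact gaussTransfer_mono (fun x hx => ih hx) hs

theorem gaussIterate_ne_top (n : ℕ) {s : ℝ} (hs : s ∈ Ioo (-1 : ℝ) 1) :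
    gaussIterate n s ≠ ∞ :=
  ne_top_of_le_ne_top ENNReal.ofReal_ne_top (gaussIterate_le n hs)

theorem gaussIterate_neg (n : ℕ) (s : ℝ) : gaussIterate n (-s) = gaussIterate n s := by
  induction n generalizing s with
  | zero => rfl
  | succ n ih =>
    rw [gaussIterate_succ, gaussTransfer, gaussTransfer,
      ← ((Equiv.neg ℤ).subtypeEquiv (p := fun j => j ≠ 0) (q := fun j => j ≠ 0)
        (by simp)).tsum_eq]
    refine tsum_congr fun j => ?_
    simp only [Equiv.subtypeEquiv_apply, Equiv.neg_apply, Int.cast_neg]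
    rw [← ih]
    congr 2
    · congr 1
      ring
    · rw [← neg_div_neg_eq, neg_div]
      ring_nf

theorem div_sub_one_monotone_aux {s t : ℝ} (hs : s ∈ Ioo (-1 : ℝ) 1) (ht : t ∈ Ioo (-1 : ℝ) 1)
    (hst : s ≤ t) {j : ℤ} (hj : j ≠ 0) :
    (1 + s) ^ 2 / (s + 2 * j - 1) ^ 2 ≤ (1 + t) ^ 2 / (t + 2 * j - 1) ^ 2 := by
  have hs1 := hs.1
  have ht2 := ht.2
  rw [← div_pow, ← div_pow, sq_le_sq]
  rcases lt_or_gt_of_ne hj with h | h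
  · have : (j : ℝ) ≤ -1 := by exact_mod_cast Int.le_sub_one_of_lt h
    rw [abs_div, abs_div, abs_of_pos (by linarith : 0 < 1 + s),
      abs_of_pos (by linarith : 0 < 1 + t), abs_of_neg (by linarith : s + 2 * j - 1 < 0),
      abs_of_neg (by linarith : t + 2 * j - 1 < 0), div_le_div_iff₀ (by linarith) (by linarith)]
    nlinarith
  · have : (1 : ℝ) ≤ j := by exact_mod_cast h
    rw [abs_div, abs_div, abs_of_pos (by linarith : 0 < 1 + s),
      abs_of_pos (by linarith : 0 < 1 + t), abs_of_pos (by linarith : 0 < s + 2 * j - 1),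
      abs_of_pos (by linarith : 0 < t + 2 * j - 1), div_le_div_iff₀ (by linarith) (by linarith)]
    nlinarith

theorem neg_one_div_add_two_mul_le {s t : ℝ} (hs : s ∈ Ioo (-1 : ℝ) 1)
    (ht : t ∈ Ioo (-1 : ℝ) 1) (hst : s ≤ t) {j : ℤ} (hj : j ≠ 0) :
    -1 / (s + 2 * (j : ℝ)) ≤ -1 / (t + 2 * j) := by
  have hs1 := hs.1
  have ht2 := ht.2
  rw [neg_div, neg_div, neg_le_neg_iff]
  rcases lt_or_gt_of_ne hj with h | h
  · have : (j : ℝ) ≤ -1 := by exact_mod_cast Int.le_sub_one_of_lt h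
    exact one_div_le_one_div_of_neg_of_le (by linarith) (by linarith)
  · have : (1 : ℝ) ≤ j := by exact_mod_cast h
    exact one_div_le_one_div_of_le (by linarith) (by linarith)

theorem ofReal_one_add_sq_mul_gaussTransfer (F : ℝ → ℝ≥0∞) {s : ℝ} (hs : s ∈ Ioo (-1 : ℝ) 1) :
    ENNReal.ofReal ((1 + s) ^ 2) * gaussTransfer F s =
      ∑' j : {j : ℤ // j ≠ 0}, ENNReal.ofReal ((1 + s) ^ 2 / (s + 2 * (j : ℤ) - 1) ^ 2) *
        (ENNReal.ofReal ((1 + -1 / (s + 2 * (j : ℤ))) ^ 2) * F (-1 / (s + 2 * (j : ℤ)))) := by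
  rw [gaussTransfer, ← ENNReal.tsum_mul_left]
  refine tsum_congr fun j => ?_
  rw [← mul_assoc, ← mul_assoc, ← ENNReal.ofReal_mul (by positivity),
    ← ENNReal.ofReal_mul (by positivity)]
  congr 2
  have hy := one_lt_abs_add_two_mul hs j.2
  have h0 : s + 2 * ((j : ℤ) : ℝ) ≠ 0 := by rw [← abs_pos]; linarith
  have h1 : s + 2 * ((j : ℤ) : ℝ) - 1 ≠ 0 := by
    intro h
    rw [sub_eq_zero.1 h, abs_one] at hy
    exact lt_irrefl _ hy
  field_simp
  ring

theorem gaussIterate_monotone (n : ℕ) {s t : ℝ} (hs : s ∈ Ioo (-1 : ℝ) 1)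
    (ht : t ∈ Ioo (-1 : ℝ) 1) (hst : s ≤ t) :
    ENNReal.ofReal ((1 + s) ^ 2) * gaussIterate n s ≤
      ENNReal.ofReal ((1 + t) ^ 2) * gaussIterate n t := by
  induction n generalizing s t with
  | zero =>
    refine mul_le_mul_left (ENNReal.ofReal_le_ofReal ?_) _
    have := hs.1
    gcongr
    linarith
  | succ n ih =>
    rw [gaussIterate_succ, ofReal_one_add_sq_mul_gaussTransfer _ hs,
      ofReal_one_add_sq_mul_gaussTransfer _ ht]
    refine ENNReal.tsum_le_tsum fun j => mul_le_mul' ?_ ?_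
    · exact ENNReal.ofReal_le_ofReal (div_sub_one_monotone_aux hs ht hst j.2)
    · exact ih (neg_one_div_mem_Ioo (one_lt_abs_add_two_mul hs j.2))
        (neg_one_div_mem_Ioo (one_lt_abs_add_two_mul ht j.2))
        (neg_one_div_add_two_mul_le hs ht hst j.2)

/-- The density of `gaussIterate n` with respect to the invariant measure `dx / (1 - x ^ 2)`. -/
noncomputable def gaussRatio (n : ℕ) (x : ℝ) : ℝ := (1 - x ^ 2) * (gaussIterate n x).toReal

theorem gaussRatio_measurable (n : ℕ) : Measurable (gaussRatio n) :=
  (by fun_prop : Measurable fun x : ℝ => 1 - x ^ 2).mul (gaussIterate_measurable n).ennreal_toReal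

theorem gaussRatio_mem_Icc (n : ℕ) {s : ℝ} (hs : s ∈ Ioo (-1 : ℝ) 1) :
    gaussRatio n s ∈ Icc (0 : ℝ) 1 := by
  have h := one_sub_sq_pos hs
  refine ⟨mul_nonneg h.le ENNReal.toReal_nonneg, ?_⟩
  have := ENNReal.toReal_le_of_le_ofReal (one_div_nonneg.2 h.le) (gaussIterate_le n hs)
  calc _ ≤ (1 - s ^ 2) * (1 / (1 - s ^ 2)) := by unfold gaussRatio; gcongr
    _ = 1 := by field_simp

theorem gaussIterate_eq_ofReal (n : ℕ) {s : ℝ} (hs : s ∈ Ioo (-1 : ℝ) 1) :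
    gaussIterate n s = ENNReal.ofReal (gaussRatio n s / (1 - s ^ 2)) := by
  have h := one_sub_sq_pos hs
  rw [gaussRatio, mul_div_cancel_left₀ _ h.ne', ENNReal.ofReal_toReal (gaussIterate_ne_top n hs)]

theorem abs_gaussRatio_sub_le (n : ℕ) {x : ℝ} (hx : x ∈ Ico (0 : ℝ) 1) :
    |gaussRatio n x - gaussRatio n 0| ≤ 2 * x / (1 - x) := by
  have h0 : (0 : ℝ) ∈ Ioo (-1 : ℝ) 1 := by simp
  have hx' : x ∈ Ioo (-1 : ℝ) 1 := ⟨by linarith [hx.1], hx.2⟩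
  have hxn : -x ∈ Ioo (-1 : ℝ) 1 := ⟨by linarith [hx.2], by linarith [hx.1]⟩
  have h1 := ENNReal.toReal_mono
    (ENNReal.mul_ne_top ENNReal.ofReal_ne_top (gaussIterate_ne_top n hx'))
    (gaussIterate_monotone n h0 hx' hx.1)
  have h2 := ENNReal.toReal_mono
    (ENNReal.mul_ne_top ENNReal.ofReal_ne_top (gaussIterate_ne_top n h0))
    (gaussIterate_monotone n hxn h0 (by linarith [hx.1]))
  rw [gaussIterate_neg] at h2
  rw [ENNReal.toReal_mul, ENNReal.toReal_mul, ENNReal.toReal_ofReal (by positivity),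
    ENNReal.toReal_ofReal (by positivity)] at h1 h2
  have hc := gaussRatio_mem_Icc n h0
  have hd := gaussRatio_mem_Icc n hx'
  unfold gaussRatio at hc hd ⊢
  set a := (gaussIterate n 0).toReal
  set b := (gaussIterate n x).toReal
  have h1x : 0 < 1 - x := by linarith [hx.2]
  have ha0 := hc.1
  have ha1 := hc.2
  obtain ⟨hx0, hx1⟩ := hx
  set G := (1 - x ^ 2) * b with hG
  have h3 : (1 - x) * a ≤ (1 + x) * G := by
    rw [hG]
    nlinarith [mul_le_mul_of_nonneg_left h1 h1x.le]
  have h4 : (1 - x) * G ≤ (1 + x) * a := by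
    rw [hG]
    nlinarith [mul_le_mul_of_nonneg_left h2 (by linarith : 0 ≤ 1 + x)]
  have h5 : x * a ≤ x := by nlinarith
  rw [show (1 - (0 : ℝ) ^ 2) * a = a by ring, abs_le, ← neg_div, div_le_iff₀ h1x,
    le_div_iff₀ h1x]
  constructor
  · rcases le_total 0 (G - a) with h | h
    · nlinarith
    · nlinarith [mul_nonneg hx0 (neg_nonneg.2 h)]
  · nlinarith

/-- The variance of `a` against the weights `W` dominates each of its terms. -/
theorem HasSum.weighted_sq_add_defect_le {ι : Type*} {W a : ι → ℝ} {w m S : ℝ} (hW : ∀ j, 0 ≤ W j)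
    (h0 : HasSum W w) (h1 : HasSum (fun j => W j * a j) (w * m))
    (h2 : HasSum (fun j => W j * a j ^ 2) S) (i : ι) :
    w * m ^ 2 + W i * (a i - m) ^ 2 ≤ S := by
  have h : HasSum (fun j => W j * (a j - m) ^ 2) (S - 2 * m * (w * m) + m ^ 2 * w) := by
    have := (h2.sub (h1.mul_left (2 * m))).add (h0.mul_left (m ^ 2))
    simpa only [show ∀ j, W j * a j ^ 2 - 2 * m * (W j * a j) + m ^ 2 * W j =
      W j * (a j - m) ^ 2 from fun j => by ring] using this
  have := le_hasSum h i fun j _ => mul_nonneg (hW j) (sq_nonneg _)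
  linarith

theorem one_lt_add_two_mul_sq {s : ℝ} (hs : s ∈ Ioo (-1 : ℝ) 1) (j : {j : ℤ // j ≠ 0}) :
    0 < (s + 2 * ((j : ℤ) : ℝ)) ^ 2 - 1 :=
  sub_pos.2 ((one_lt_sq_iff_one_lt_abs _).2 (one_lt_abs_add_two_mul hs j.2))

theorem hasSum_gaussRatio (n : ℕ) {s : ℝ} (hs : s ∈ Ioo (-1 : ℝ) 1) :
    HasSum (fun j : {j : ℤ // j ≠ 0} =>
      1 / ((s + 2 * (j : ℤ)) ^ 2 - 1) * gaussRatio n (-1 / (s + 2 * (j : ℤ))))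
      (1 / (1 - s ^ 2) * gaussRatio (n + 1) s) := by
  have hne := gaussIterate_ne_top (n + 1) hs
  rw [gaussIterate_succ, gaussTransfer] at hne
  have h := ENNReal.hasSum_toReal hne
  have h1 : 1 / (1 - s ^ 2) * gaussRatio (n + 1) s = (gaussIterate (n + 1) s).toReal := by
    rw [gaussRatio, ← mul_assoc, one_div_mul_cancel (one_sub_sq_pos hs).ne', one_mul]
  rw [h1, gaussIterate_succ, gaussTransfer, ENNReal.tsum_toReal_eq (ENNReal.ne_top_of_tsum_ne_top hne)]
  convert h using 2 with j
  rw [ENNReal.toReal_mul, ENNReal.toReal_ofReal (by positivity), gaussRatio, ← mul_assoc]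
  congr 1
  have hy := one_lt_add_two_mul_sq hs j
  have h0 : s + 2 * ((j : ℤ) : ℝ) ≠ 0 := by rintro h0; rw [h0] at hy; norm_num at hy
  field_simp

/-- The density of the square of `gaussRatio n` with respect to Lebesgue measure. -/
noncomputable def gaussEnergy (n : ℕ) (x : ℝ) : ℝ≥0∞ :=
  ENNReal.ofReal (1 / (1 - x ^ 2) * gaussRatio n x ^ 2)

/-- The loss of energy in one step along the branch `i`. -/
noncomputable def gaussDefect (i : {j : ℤ // j ≠ 0}) (n : ℕ) (s : ℝ) : ℝ≥0∞ :=
  ENNReal.ofReal (1 / ((s + 2 * (i : ℤ)) ^ 2 - 1) *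
    (gaussRatio n (-1 / (s + 2 * (i : ℤ))) - gaussRatio (n + 1) s) ^ 2)

theorem gaussEnergy_measurable (n : ℕ) : Measurable (gaussEnergy n) := by
  have := gaussRatio_measurable n
  unfold gaussEnergy
  fun_prop

theorem gaussDefect_measurable (i : {j : ℤ // j ≠ 0}) (n : ℕ) : Measurable (gaussDefect i n) := by
  have := gaussRatio_measurable n
  have := gaussRatio_measurable (n + 1)
  unfold gaussDefect
  fun_prop

theorem gaussEnergy_succ_add_gaussDefect_le (i : {j : ℤ // j ≠ 0}) (n : ℕ) {s : ℝ}
    (hs : s ∈ Ioo (-1 : ℝ) 1) :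
    gaussEnergy (n + 1) s + gaussDefect i n s ≤ gaussTransfer (gaussEnergy n) s := by
  have h0 := hasSum_one_div_add_two_mul_sq_sub_one hs
  have h1 := hasSum_gaussRatio n hs
  have hW (j : {j : ℤ // j ≠ 0}) : 0 ≤ 1 / ((s + 2 * ((j : ℤ) : ℝ)) ^ 2 - 1) :=
    (one_div_pos.2 (one_lt_add_two_mul_sq hs j)).le
  have h2 : Summable fun j : {j : ℤ // j ≠ 0} =>
      1 / ((s + 2 * (j : ℤ)) ^ 2 - 1) * gaussRatio n (-1 / (s + 2 * (j : ℤ))) ^ 2 := by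
    refine Summable.of_nonneg_of_le (fun j => mul_nonneg (hW j) (sq_nonneg _)) (fun j => ?_)
      h0.summable
    have := gaussRatio_mem_Icc n (neg_one_div_mem_Ioo (one_lt_abs_add_two_mul hs j.2))
    exact mul_le_of_le_one_right (hW j) (pow_le_one₀ this.1 this.2)
  have key := HasSum.weighted_sq_add_defect_le hW h0 h1 h2.hasSum i
  have hT : gaussTransfer (gaussEnergy n) s = ENNReal.ofReal (∑' j : {j : ℤ // j ≠ 0},
      1 / ((s + 2 * (j : ℤ)) ^ 2 - 1) * gaussRatio n (-1 / (s + 2 * (j : ℤ))) ^ 2) := by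
    rw [ENNReal.ofReal_tsum_of_nonneg (fun j => mul_nonneg (hW j) (sq_nonneg _)) h2]
    refine tsum_congr fun j => ?_
    rw [gaussEnergy, ← ENNReal.ofReal_mul (by positivity), ← mul_assoc]
    congr 2
    have hy := one_lt_add_two_mul_sq hs j
    have h0 : s + 2 * ((j : ℤ) : ℝ) ≠ 0 := by rintro h0; rw [h0] at hy; norm_num at hy
    rw [one_div_mul_one_div]
    congr 1
    field_simp
  rw [hT, gaussEnergy, gaussDefect, ← ENNReal.ofReal_add
    (mul_nonneg (one_div_pos.2 (one_sub_sq_pos hs)).le (sq_nonneg _))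
    (mul_nonneg (hW i) (sq_nonneg _))]
  exact ENNReal.ofReal_le_ofReal key

theorem setLIntegral_gaussEnergy_zero_ne_top :
    ∫⁻ s in Ioo (-1 : ℝ) 1, gaussEnergy 0 s ≠ ∞ := by
  refine ne_top_of_le_ne_top (b := ∫⁻ s in Ioo (-1 : ℝ) 1, gaussIterate 0 s)
    (by simp [setLIntegral_gaussIterate]) ?_
  refine setLIntegral_mono (gaussIterate_measurable 0) fun s hs => ?_
  rw [gaussIterate_eq_ofReal 0 hs, gaussEnergy]
  refine ENNReal.ofReal_le_ofReal ?_
  have h := gaussRatio_mem_Icc 0 hs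
  have h1 := one_sub_sq_pos hs
  rw [one_div_mul_eq_div, div_le_div_iff_of_pos_right h1]
  nlinarith [h.1, h.2]

theorem sum_setLIntegral_gaussDefect_add_le (i : {j : ℤ // j ≠ 0}) (N : ℕ) :
    ∑ n ∈ Finset.range N, (∫⁻ s in Ioo (-1 : ℝ) 1, gaussDefect i n s) +
      ∫⁻ s in Ioo (-1 : ℝ) 1, gaussEnergy N s ≤ ∫⁻ s in Ioo (-1 : ℝ) 1, gaussEnergy 0 s := by
  induction N with
  | zero => simp
  | succ N ih =>
    refine le_trans ?_ ih
    rw [Finset.sum_range_succ, add_assoc]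
    gcongr
    rw [← setLIntegral_gaussTransfer (gaussEnergy_measurable N), add_comm,
      ← lintegral_add_left (gaussEnergy_measurable (N + 1))]
    exact setLIntegral_mono (gaussTransfer_measurable (gaussEnergy_measurable N)) fun s hs =>
      gaussEnergy_succ_add_gaussDefect_le i N hs

theorem ae_tendsto_gaussRatio_branch :
    ∀ᵐ s : ℝ, s ∈ Ioo (-1 : ℝ) 1 → ∀ i : {j : ℤ // j ≠ 0},
      Tendsto (fun n => gaussRatio n (-1 / (s + 2 * (i : ℤ))) - gaussRatio (n + 1) s)
        atTop (𝓝 0) := by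
  rw [← ae_restrict_iff' measurableSet_Ioo, ae_all_iff]
  intro i
  have hfin : ∫⁻ s in Ioo (-1 : ℝ) 1, ∑' n, gaussDefect i n s ≠ ∞ := by
    rw [lintegral_tsum fun n => (gaussDefect_measurable i n).aemeasurable]
    refine ne_top_of_le_ne_top setLIntegral_gaussEnergy_zero_ne_top ?_
    refine ENNReal.tsum_le_of_sum_range_le fun N => ?_
    exact le_self_add.trans (sum_setLIntegral_gaussDefect_add_le i N)
  filter_upwards [ae_lt_top (Measurable.tsum fun n => gaussDefect_measurable i n) hfin,
    ae_restrict_mem measurableSet_Ioo] with s hs hsI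
  have h := (ENNReal.tendsto_toReal ENNReal.zero_ne_top).comp
    (ENNReal.tendsto_atTop_zero_of_tsum_ne_top hs.ne)
  have hy := one_lt_add_two_mul_sq hsI i
  have h2 := h.const_mul ((s + 2 * ((i : ℤ) : ℝ)) ^ 2 - 1)
  have h3 : Tendsto (fun n => (gaussRatio n (-1 / (s + 2 * (i : ℤ))) -
      gaussRatio (n + 1) s) ^ 2) atTop (𝓝 0) := by
    convert h2 using 1
    · ext n
      rw [Function.comp_apply, gaussDefect, ENNReal.toReal_ofReal (by positivity)]
      field_simp
    · simp
  rw [tendsto_zero_iff_abs_tendsto_zero]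
  have h4 := (Real.continuous_sqrt.tendsto 0).comp h3
  simpa only [Function.comp_def, Real.sqrt_sq_eq_abs, Real.sqrt_zero] using h4

theorem ae_tendsto_gaussRatio_sub_zero :
    ∀ᵐ s : ℝ, s ∈ Ioo (-1 : ℝ) 1 →
      Tendsto (fun n => gaussRatio (n + 1) s - gaussRatio n 0) atTop (𝓝 0) := by
  filter_upwards [ae_tendsto_gaussRatio_branch] with s hs hsI
  have hx : Tendsto (fun N : ℕ => -1 / (s + 2 * ((-(N + 1 : ℤ) : ℤ) : ℝ))) atTop (𝓝 0) := by
    have : Tendsto (fun N : ℕ => s + 2 * ((-(N + 1 : ℤ) : ℤ) : ℝ)) atTop atBot := by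
      refine tendsto_atBot_add_const_left _ _ (Tendsto.const_mul_atBot two_pos ?_)
      push_cast
      refine tendsto_neg_atTop_atBot.comp ?_
      exact tendsto_atTop_add_const_right _ _ tendsto_natCast_atTop_atTop
    exact this.const_div_atBot (-1)
  have hb : Tendsto (fun x : ℝ => 2 * x / (1 - x)) (𝓝 0) (𝓝 0) := by
    have : ContinuousAt (fun x : ℝ => 2 * x / (1 - x)) 0 := by
      refine ContinuousAt.div (by fun_prop) (by fun_prop) (by norm_num)
    simpa [ContinuousAt] using this
  rw [Metric.tendsto_atTop]
  intro ε hε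
  obtain ⟨N, hN⟩ := ((hb.comp hx).eventually (gt_mem_nhds (half_pos hε))).exists
  have hj : -(N + 1 : ℤ) ≠ 0 := by omega
  set x := -1 / (s + 2 * ((-(N + 1 : ℤ) : ℤ) : ℝ)) with hxdef
  have hxI : x ∈ Ico (0 : ℝ) 1 := by
    refine ⟨?_, (neg_one_div_mem_Ioo (one_lt_abs_add_two_mul hsI hj)).2⟩
    refine div_nonneg_of_nonpos (by norm_num) ?_
    push_cast
    have : (0 : ℝ) ≤ N := N.cast_nonneg
    linarith [hsI.2]
  obtain ⟨n₀, hn₀⟩ := Metric.tendsto_atTop.1 (hs hsI ⟨_, hj⟩) (ε / 2) (half_pos hε)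
  refine ⟨n₀, fun n hn => ?_⟩
  have h1 := hn₀ n hn
  have h2 := (abs_gaussRatio_sub_le n hxI).trans_lt hN
  rw [Real.dist_eq, sub_zero] at h1 ⊢
  change |gaussRatio n x - gaussRatio (n + 1) s| < ε / 2 at h1
  rw [abs_lt] at *
  constructor <;> linarith [h1.1, h1.2, h2.1, h2.2]

theorem setLIntegral_one_div_one_sub_sq :
    ∫⁻ s in Ioo (-1 : ℝ) 1, ENNReal.ofReal (1 / (1 - s ^ 2)) = ∞ := by
  by_contra hne
  have h1 : IntegrableOn (fun s : ℝ => 1 / (1 - s ^ 2)) (Ioo 0 1) := by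
    refine ⟨by measurability, ?_⟩
    rw [hasFiniteIntegral_iff_ofReal]
    · refine lt_of_le_of_lt (lintegral_mono_set (Ioo_subset_Ioo_left (by norm_num)))
        (Ne.lt_top hne)
    · filter_upwards [ae_restrict_mem measurableSet_Ioo] with s hs
      exact (one_div_pos.2 (one_sub_sq_pos ⟨by linarith [hs.1], hs.2⟩)).le
  have h2 : IntegrableOn (fun s : ℝ => (s - 1)⁻¹) (Ioo 0 1) := by
    refine (h1.const_mul 2).mono (by fun_prop) ?_
    filter_upwards [ae_restrict_mem measurableSet_Ioo] with s hs
    have ha : 0 < 1 - s := by linarith [hs.2]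
    have hb : 0 < 1 + s := by linarith [hs.1]
    rw [← norm_neg, ← inv_neg, neg_sub, Real.norm_of_nonneg (by positivity),
      show 1 - s ^ 2 = (1 - s) * (1 + s) by ring, Real.norm_of_nonneg (by positivity),
      ← one_div, mul_one_div, div_le_div_iff₀ ha (by positivity)]
    nlinarith [hs.2]
  have h3 : IntervalIntegrable (fun s : ℝ => (s - 1)⁻¹) volume 0 1 := by
    rw [intervalIntegrable_iff_integrableOn_Ioc_of_le zero_le_one]
    exact (integrableOn_Ioc_iff_integrableOn_Ioo (by simp)).2 h2
  rw [intervalIntegrable_sub_inv_iff] at h3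
  simp at h3

theorem exists_subseq_ae_tendsto_gaussIterate_zero :
    ∃ ν : ℕ → ℕ, ∀ᵐ s : ℝ, s ∈ Ioo (-1 : ℝ) 1 →
      Tendsto (fun k => gaussIterate (ν k) s) atTop (𝓝 0) := by
  obtain ⟨c, hc, ν, hν, hlim⟩ := isCompact_Icc.tendsto_subseq (x := fun n => gaussRatio n 0)
    fun n => gaussRatio_mem_Icc n (by simp)
  have hae : ∀ᵐ s : ℝ, s ∈ Ioo (-1 : ℝ) 1 →
      Tendsto (fun k => gaussIterate (ν k + 1) s) atTop
        (𝓝 (ENNReal.ofReal (c / (1 - s ^ 2)))) := by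
    filter_upwards [ae_tendsto_gaussRatio_sub_zero] with s hs hsI
    have h1 := ((hs hsI).comp hν.tendsto_atTop).add hlim
    simp only [Function.comp_def, sub_add_cancel, zero_add] at h1
    simp only [gaussIterate_eq_ofReal _ hsI]
    exact ENNReal.tendsto_ofReal (h1.div_const _)
  have hle : ∫⁻ s in Ioo (-1 : ℝ) 1, ENNReal.ofReal (c / (1 - s ^ 2)) ≤ 2 := by
    calc ∫⁻ s in Ioo (-1 : ℝ) 1, ENNReal.ofReal (c / (1 - s ^ 2))
        = ∫⁻ s in Ioo (-1 : ℝ) 1, liminf (fun k => gaussIterate (ν k + 1) s) atTop := by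
          refine setLIntegral_congr_fun_ae measurableSet_Ioo ?_
          filter_upwards [hae] with s hs hsI
          exact (hs hsI).liminf_eq.symm
      _ ≤ liminf (fun k => ∫⁻ s in Ioo (-1 : ℝ) 1, gaussIterate (ν k + 1) s) atTop :=
          lintegral_liminf_le fun k => gaussIterate_measurable _
      _ = 2 := by simp [setLIntegral_gaussIterate]
  have hc0 : c = 0 := by
    by_contra hne
    have hpos : 0 < c := lt_of_le_of_ne hc.1 (Ne.symm hne)
    simp only [div_eq_mul_one_div c, ENNReal.ofReal_mul hpos.le] at hle
    rw [lintegral_const_mul _ (by fun_prop), setLIntegral_one_div_one_sub_sq,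
      ENNReal.mul_top (by simpa using hpos)] at hle
    exact absurd hle (by simp)
  refine ⟨fun k => ν k + 1, ?_⟩
  simpa [hc0] using hae

/-- An integrable function which is dominated by its own transfer vanishes: the map has no finite
absolutely continuous invariant measure. -/
theorem ae_eq_zero_of_le_gaussTransfer {H : ℝ → ℝ≥0∞} (hH : Measurable H)
    (hfin : ∫⁻ x in Ioo (-1 : ℝ) 1, H x ≠ ∞)
    (hle : ∀ᵐ x, x ∈ Ioo (-1 : ℝ) 1 → H x ≤ gaussTransfer H x) :
    ∀ᵐ x, x ∈ Ioo (-1 : ℝ) 1 → H x = 0 := by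
  obtain ⟨ν, hν⟩ := exists_subseq_ae_tendsto_gaussIterate_zero
  have hR (M : ℕ) : Measurable fun x => H x - M := hH.sub_const _
  have hRit (M n : ℕ) : Measurable (gaussTransfer^[n] fun x => H x - M) := by
    induction n with
    | zero => exact hR M
    | succ n ih => rw [Function.iterate_succ_apply']; exact gaussTransfer_measurable ih
  have hiter (M n : ℕ) : ∀ᵐ x, x ∈ Ioo (-1 : ℝ) 1 →
      H x ≤ M * gaussIterate n x + (gaussTransfer^[n] fun x => H x - M) x := by
    induction n with
    | zero =>
      refine .of_forall fun x _ => ?_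
      simp only [gaussIterate, Function.iterate_zero, id_eq, mul_one]
      exact le_add_tsub
    | succ n ih =>
      filter_upwards [hle, gaussTransfer_ae_mono ih] with x h1 h2 hx
      refine (h1 hx).trans ((h2 hx).trans_eq ?_)
      rw [gaussTransfer_add, gaussTransfer_const_mul, gaussIterate_succ,
        Function.iterate_succ_apply']
  have hRint (M n : ℕ) : ∫⁻ x in Ioo (-1 : ℝ) 1, (gaussTransfer^[n] fun x => H x - M) x =
      ∫⁻ x in Ioo (-1 : ℝ) 1, (H x - M) := by
    induction n with
    | zero => rfl
    | succ n ih => rw [Function.iterate_succ_apply', setLIntegral_gaussTransfer (hRit M n), ih]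
  let ρ : ℝ → ℝ≥0∞ := fun x => ENNReal.ofReal (1 - x ^ 2)
  have hρ : Measurable ρ := by fun_prop
  have hρ1 (x : ℝ) : ρ x ≤ 1 := ENNReal.ofReal_le_one.2 (by nlinarith [sq_nonneg x])
  have hbound (M n : ℕ) : ∫⁻ x in Ioo (-1 : ℝ) 1, ρ x * H x ≤
      (M * ∫⁻ x in Ioo (-1 : ℝ) 1, ρ x * gaussIterate n x) +
        ∫⁻ x in Ioo (-1 : ℝ) 1, (H x - M) := by
    have hm : Measurable fun x => ρ x * gaussIterate n x :=
      hρ.mul (gaussIterate_measurable n)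
    rw [← hRint M n, ← lintegral_const_mul _ hm, ← lintegral_add_left (hm.const_mul _)]
    refine setLIntegral_mono_ae ((hm.const_mul _).add (hRit M n)).aemeasurable ?_
    filter_upwards [hiter M n] with x hx hxI
    calc ρ x * H x ≤ ρ x * (M * gaussIterate n x + (gaussTransfer^[n] fun x => H x - M) x) := by
          gcongr
          exact hx hxI
      _ = M * (ρ x * gaussIterate n x) + ρ x * (gaussTransfer^[n] fun x => H x - M) x := by ring
      _ ≤ _ := by
          refine add_le_add le_rfl (mul_le_of_le_one_left' (hρ1 x))
  have hlim1 : Tendsto (fun k => ∫⁻ x in Ioo (-1 : ℝ) 1, ρ x * gaussIterate (ν k) x)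
      atTop (𝓝 0) := by
    have := tendsto_lintegral_of_dominated_convergence (μ := volume.restrict (Ioo (-1 : ℝ) 1))
      (F := fun k x => ρ x * gaussIterate (ν k) x) (f := fun _ => 0) (fun _ => 1)
      (fun k => hρ.mul (gaussIterate_measurable _)) (fun k => ?_) (by simp) ?_
    · simpa using this
    · filter_upwards [ae_restrict_mem measurableSet_Ioo] with x hx
      have h := one_sub_sq_pos hx
      refine (mul_le_mul_right (gaussIterate_le _ hx) _).trans_eq ?_
      rw [← ENNReal.ofReal_mul h.le, mul_one_div_cancel h.ne', ENNReal.ofReal_one]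
    · rw [ae_restrict_iff' measurableSet_Ioo]
      filter_upwards [hν] with x hx hxI
      simpa using ENNReal.Tendsto.const_mul (hx hxI) (Or.inr ENNReal.ofReal_ne_top)
  have hbound2 (M : ℕ) : ∫⁻ x in Ioo (-1 : ℝ) 1, ρ x * H x ≤
      ∫⁻ x in Ioo (-1 : ℝ) 1, (H x - M) := by
    have h := (ENNReal.Tendsto.const_mul hlim1 (Or.inr (ENNReal.natCast_ne_top M))).add_const
      (∫⁻ x in Ioo (-1 : ℝ) 1, (H x - M))
    rw [mul_zero, zero_add] at h
    exact ge_of_tendsto' h fun k => hbound M (ν k)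
  have hlim2 : Tendsto (fun M : ℕ => ∫⁻ x in Ioo (-1 : ℝ) 1, (H x - M)) atTop (𝓝 0) := by
    have := tendsto_lintegral_of_dominated_convergence (μ := volume.restrict (Ioo (-1 : ℝ) 1))
      (F := fun (M : ℕ) x => H x - M) (f := fun _ => 0) H hR
      (fun M => .of_forall fun x => tsub_le_self) hfin ?_
    · simpa using this
    · filter_upwards [ae_lt_top hH hfin] with x hx
      obtain ⟨N, hN⟩ := ENNReal.exists_nat_gt hx.ne
      refine tendsto_const_nhds.congr' ?_
      filter_upwards [eventually_ge_atTop N] with M hM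
      refine (tsub_eq_zero_of_le (hN.le.trans ?_)).symm
      exact_mod_cast hM
  have hzero : ∫⁻ x in Ioo (-1 : ℝ) 1, ρ x * H x = 0 :=
    nonpos_iff_eq_zero.1 (ge_of_tendsto' hlim2 hbound2)
  rw [lintegral_eq_zero_iff (show Measurable fun x => ρ x * H x from hρ.mul hH), Filter.EventuallyEq,
    ae_restrict_iff' measurableSet_Ioo] at hzero
  filter_upwards [hzero] with x hx hxI
  refine (mul_eq_zero.1 (hx hxI)).resolve_left ?_
  simpa [ρ] using one_sub_sq_pos hxI

theorem image_neg_one_div_compl_zero : (fun y : ℝ => -1 / y) '' {0}ᶜ = {0}ᶜ := by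
  ext x
  constructor
  · rintro ⟨y, hy, rfl⟩
    simpa using hy
  · intro hx
    have hx : x ≠ 0 := hx
    exact ⟨-1 / x, by simpa using hx, by field_simp⟩

/-- The pullback of `t ^ k * φ t` under `t = -1 / s`, with the Jacobian. -/
noncomputable def inversion (k : ℕ) (φ : ℝ → ℂ) (s : ℝ) : ℂ :=
  ((1 / s ^ 2 : ℝ) : ℂ) * (((-1 / s : ℝ) : ℂ) ^ k * φ (-1 / s))

theorem inversion_measurable (k : ℕ) {φ : ℝ → ℂ} (hφ : Measurable φ) :
    Measurable (inversion k φ) := by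
  unfold inversion
  fun_prop

theorem enorm_inversion_le (k : ℕ) (φ : ℝ → ℂ) {y : ℝ} (hy : 1 < |y|) :
    ‖inversion k φ y‖ₑ ≤ ENNReal.ofReal (1 / y ^ 2) * ‖φ (-1 / y)‖ₑ := by
  have h := abs_lt.2 (neg_one_div_mem_Ioo hy)
  rw [inversion, enorm_mul, enorm_mul, enorm_pow]
  gcongr
  · rw [← ofReal_norm, Complex.norm_real, Real.norm_of_nonneg (by positivity)]
  · refine mul_le_of_le_one_left' (pow_le_one₀ zero_le ?_)
    rw [← ofReal_norm, Complex.norm_real, Real.norm_eq_abs]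
    exact ENNReal.ofReal_le_one.2 h.le

theorem inversion_inversion (k : ℕ) (φ : ℝ → ℂ) {y : ℝ} (hy : y ≠ 0) :
    inversion k (inversion k φ) y = (-1) ^ k * φ y := by
  have hy' : (y : ℂ) ≠ 0 := by exact_mod_cast hy
  have : -1 / (-1 / y) = y := by field_simp
  rw [inversion, inversion, this]
  push_cast
  rw [show ((1 : ℂ) / y ^ 2 * ((-1 / y) ^ k * (1 / (-1 / y) ^ 2 * (y ^ k * φ y)))) =
    (1 / (y : ℂ) ^ 2 * (1 / (-1 / y) ^ 2)) * ((-1 / y * y) ^ k * φ y) by rw [mul_pow]; ring]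
  rw [div_mul_cancel₀ _ hy']
  field_simp

theorem enorm_le_of_one_lt_abs (k : ℕ) (φ : ℝ → ℂ) {y : ℝ} (hy : 1 < |y|) :
    ‖φ y‖ₑ ≤ ENNReal.ofReal (1 / y ^ 2) * ‖inversion k φ (-1 / y)‖ₑ := by
  have h0 : y ≠ 0 := by rw [← abs_pos]; linarith
  have h := enorm_inversion_le k (inversion k φ) hy
  rwa [inversion_inversion k φ h0, enorm_mul, enorm_pow, enorm_neg, enorm_one, one_pow,
    one_mul] at h

theorem ae_eq_zero_of_integral_eq_zero (k : ℕ) {φ : ℝ → ℂ} (hm : Measurable φ)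
    (hφ : Integrable φ) (hint : Integrable (fun t : ℝ => (t : ℂ) ^ k * φ t))
    (h1 : ∀ m : ℤ,
      ∫ t : ℝ, Complex.exp (Complex.I * (Real.pi : ℂ) * (m : ℂ) * (t : ℂ)) * φ t = 0)
    (h2 : ∀ n : ℤ,
      ∫ t : ℝ, Complex.exp (-(Complex.I * (Real.pi : ℂ) * (n : ℂ)) / (t : ℂ)) *
        (t : ℂ) ^ k * φ t = 0) :
    ∀ᵐ t : ℝ, φ t = 0 := by
  have hms : MeasurableSet ({0}ᶜ : Set ℝ) := (measurableSet_singleton 0).compl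
  have hae : ({0}ᶜ : Set ℝ) =ᵐ[volume] univ := by simp [ae_eq_univ]
  have hder : ∀ y ∈ ({0}ᶜ : Set ℝ),
      HasDerivWithinAt (fun y : ℝ => -1 / y) (1 / y ^ 2) {0}ᶜ y :=
    fun y hy => (hasDerivAt_neg_one_div hy).hasDerivWithinAt
  have hψm := inversion_measurable k hm
  have hψ : Integrable (inversion k φ) := by
    have := (integrableOn_image_iff_integrableOn_abs_deriv_smul hms hder
      injective_neg_one_div.injOn fun t : ℝ => (t : ℂ) ^ k * φ t).1
      (by rw [image_neg_one_div_compl_zero]; exact hint.integrableOn)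
    rw [integrableOn_congr_set_ae hae, integrableOn_univ] at this
    refine this.congr (.of_forall fun s => ?_)
    simp only [abs_of_nonneg (by positivity : 0 ≤ 1 / s ^ 2), inversion, Complex.real_smul]
  have h3 : ∀ n : ℤ, ∫ s : ℝ, Complex.exp (Complex.I * (Real.pi : ℂ) * (n : ℂ) * (s : ℂ)) *
      inversion k φ s = 0 := by
    intro n
    have := integral_image_eq_integral_abs_deriv_smul hms hder injective_neg_one_div.injOn
      fun t : ℝ => Complex.exp (-(Complex.I * (Real.pi : ℂ) * (n : ℂ)) / (t : ℂ)) *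
        (t : ℂ) ^ k * φ t
    rw [image_neg_one_div_compl_zero, setIntegral_congr_set hae, setIntegral_univ, h2,
      setIntegral_congr_set hae, setIntegral_univ] at this
    rw [this]
    refine integral_congr_ae ?_
    filter_upwards [compl_mem_ae_iff.2 (measure_singleton (0 : ℝ))] with s hs
    have hs : (s : ℂ) ≠ 0 := by exact_mod_cast hs
    have he : -(Complex.I * (Real.pi : ℂ) * (n : ℂ)) / ((-1 / s : ℝ) : ℂ) =
        Complex.I * Real.pi * n * s := by
      push_cast
      field_simp
    simp only [abs_of_nonneg (by positivity : 0 ≤ 1 / s ^ 2), inversion, Complex.real_smul, he]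
    ring
  let H : ℝ → ℝ≥0∞ := fun x => ‖φ x‖ₑ + ‖inversion k φ x‖ₑ
  have hzero := ae_eq_zero_of_le_gaussTransfer (H := H) (hm.enorm.add hψm.enorm) ?_ ?_
  · have hS : MeasurableSet {y : ℝ | 1 < |y|} := measurableSet_lt measurable_const measurable_id.abs
    have himage := lintegral_image_eq_lintegral_abs_deriv_mul hS
      (fun y hy => (hasDerivAt_neg_one_div
        (abs_pos.1 (zero_lt_one.trans hy))).hasDerivWithinAt)
      injective_neg_one_div.injOn fun x => ‖inversion k φ x‖ₑ
    rw [image_neg_one_div_one_lt_abs] at himage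
    have hvanish : ∫⁻ x in Ioo (-1 : ℝ) 1 \ {0}, ‖inversion k φ x‖ₑ = 0 := by
      rw [lintegral_eq_zero_iff hψm.enorm, Filter.EventuallyEq,
        ae_restrict_iff' (measurableSet_Ioo.diff (measurableSet_singleton 0))]
      filter_upwards [hzero] with x hx hxI
      exact (add_eq_zero.1 (hx hxI.1)).2
    have hφS : ∫⁻ y in {y : ℝ | 1 < |y|}, ‖φ y‖ₑ = 0 := by
      refine nonpos_iff_eq_zero.1 ?_
      rw [← hvanish, himage]
      refine setLIntegral_mono' hS fun y hy => ?_
      rw [abs_of_nonneg (by positivity)]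
      exact enorm_le_of_one_lt_abs k φ hy
    rw [lintegral_eq_zero_iff hm.enorm, Filter.EventuallyEq, ae_restrict_iff' hS] at hφS
    filter_upwards [hzero, hφS, compl_mem_ae_iff.2 (measure_singleton (1 : ℝ)),
      compl_mem_ae_iff.2 (measure_singleton (-1 : ℝ))] with t hin hout hne hne'
    rcases lt_trichotomy |t| 1 with ht | ht | ht
    · exact enorm_eq_zero.1 (add_eq_zero.1 (hin (abs_lt.1 ht))).1
    · rcases eq_or_eq_neg_of_abs_eq ht with rfl | rfl
      · exact absurd rfl hne
      · exact absurd rfl hne'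
    · exact enorm_eq_zero.1 (hout ht)
  · rw [lintegral_add_left hm.enorm]
    refine ENNReal.add_ne_top.2 ⟨?_, ?_⟩
    · exact ((setLIntegral_le_lintegral _ _).trans_lt hφ.2).ne
    · exact ((setLIntegral_le_lintegral _ _).trans_lt hψ.2).ne
  · filter_upwards [ae_enorm_le_tsum_add_two_mul hφ hm h1,
      ae_enorm_le_tsum_add_two_mul hψ hψm h3] with x hx1 hx2 hx
    simp only [H, gaussTransfer, mul_add, ENNReal.tsum_add]
    rw [add_comm (∑' _, _)]
    refine add_le_add ((hx1 hx).trans ?_) ((hx2 hx).trans ?_)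
    · exact ENNReal.tsum_le_tsum fun j =>
        enorm_le_of_one_lt_abs k φ (one_lt_abs_add_two_mul hx j.2)
    · exact ENNReal.tsum_le_tsum fun j =>
        enorm_inversion_le k φ (one_lt_abs_add_two_mul hx j.2)

end

/-- Fix `k ≥ 0`. If `φ ∈ L¹(ℝ)` has the extra integrability
`∫ |φ(t)| (1 + |t|^k) dt < ∞`, and `∫ e^{iπmt} φ(t) dt = 0` for every `m ∈ ℤ`
while `∫ e^{-iπn/t} t^k φ(t) dt = 0` for every `n ∈ ℤ`, then `φ = 0` a.e. -/
theorem statement3 (k : ℕ) (φ : ℝ → ℂ) (hφ : Integrable φ)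
    (hint : Integrable (fun t : ℝ => ‖φ t‖ * (1 + |t| ^ k)))
    (h1 : ∀ m : ℤ,
      ∫ t : ℝ, Complex.exp (Complex.I * (Real.pi : ℂ) * (m : ℂ) * (t : ℂ)) * φ t = 0)
    (h2 : ∀ n : ℤ,
      ∫ t : ℝ, Complex.exp (-(Complex.I * (Real.pi : ℂ) * (n : ℂ)) / (t : ℂ)) * (t : ℂ) ^ k * φ t = 0) :
    ∀ᵐ t : ℝ ∂(volume : Measure ℝ), φ t = 0 := by
  have hae := hφ.1.ae_eq_mk
  have hpow : Integrable (fun t : ℝ => (t : ℂ) ^ k * φ t) := by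
    refine hint.mono ?_ (.of_forall fun t => ?_)
    · exact (Complex.continuous_ofReal.pow k).aestronglyMeasurable.mul hφ.1
    · rw [norm_mul, norm_pow, Complex.norm_real, Real.norm_eq_abs,
        Real.norm_of_nonneg (by positivity), mul_comm]
      gcongr
      linarith
  have hzero : ∀ᵐ t : ℝ, hφ.1.mk φ t = 0 := by
    refine ae_eq_zero_of_integral_eq_zero k hφ.1.stronglyMeasurable_mk.measurable
      (hφ.congr hae) (hpow.congr ?_) (fun m => ?_) (fun n => ?_)
    · filter_upwards [hae] with t ht
      rw [ht]
    · rw [← h1 m]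
      refine integral_congr_ae ?_
      filter_upwards [hae] with t ht
      rw [ht]
    · rw [← h2 n]
      refine integral_congr_ae ?_
      filter_upwards [hae] with t ht
      rw [ht]
  filter_upwards [hae, hzero] with t ht h0
  rw [ht, h0]
end

section
/- Suppose a₀ ∈ ℂ and aₙ, bₙ ∈ ℂ for n ∈ ℤ \ {0} satisfy the subexponential growth bound: for every ε > 0 one has |aₙ|, |bₙ| = O(e^{ε|n|}) as |n| → +∞. Suppose moreover that the associated harmonic hyperbolic Fourier series is trivial, i.e. a₀ + Σ_{n>0} (aₙ e^{iπnτ} + bₙ e^{−iπn/τ}) + Σ_{n<0} (aₙ e^{iπn·conj(τ)} + bₙ e^{−iπn/conj(τ)}) = 0 for every τ ∈ ℍ, and that |aₙ| = o(|n|^{−3/4} exp(2π√|n|)) as |n| → +∞. Then a₀ = 0 and aₙ = bₙ = 0 for all n ∈ ℤ \ {0}. -/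
noncomputable section

/-- The `n`-th term of the harmonic hyperbolic Fourier series with coefficients
`a b : ℤ → ℂ` at a point `τ` of the upper half-plane: for `n > 0` the term
`aₙ e^{iπnτ} + bₙ e^{-iπn/τ}`, for `n < 0` the term
`aₙ e^{iπn·conj τ} + bₙ e^{-iπn/conj τ}`, and the constant `a₀` for `n = 0`. -/
def hfsTerm (a b : ℤ → ℂ) (τ : ℂ) (n : ℤ) : ℂ :=
  if 0 < n then
    a n * Complex.exp (Complex.I * (Real.pi : ℂ) * (n : ℂ) * τ)
      + b n * Complex.exp (-(Complex.I * (Real.pi : ℂ) * (n : ℂ)) / τ)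
  else if n < 0 then
    a n * Complex.exp (Complex.I * (Real.pi : ℂ) * (n : ℂ) * (starRingEnd ℂ τ))
      + b n * Complex.exp (-(Complex.I * (Real.pi : ℂ) * (n : ℂ)) / (starRingEnd ℂ τ))
  else a 0

open UpperHalfPlane ModularGroup CongruenceSubgroup MatrixGroups ModularForm Filter Topology

/-- A level one modular function of weight zero that is holomorphic on the upper half-plane and
tends to zero at the cusp vanishes. -/
lemma eq_zero_of_levelOne_of_zero_at_inf {f : ℂ → ℂ}
    (hf : DifferentiableOn ℂ f {τ | 0 < τ.im})
    (hT : ∀ τ : ℂ, 0 < τ.im → f (τ + 1) = f τ) (hS : ∀ τ : ℂ, 0 < τ.im → f (-1 / τ) = f τ)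
    (h0 : ∀ ε : ℝ, 0 < ε → ∃ M : ℝ, ∀ τ : ℂ, M < τ.im → ‖f τ‖ ≤ ε) :
    ∀ τ : ℂ, 0 < τ.im → f τ = 0 := by
  let F : ℍ → ℂ := fun τ => f τ
  have hinv : ∀ γ : SL(2, ℤ), F ∣[(0 : ℤ)] γ = F := by
    apply SlashInvariantForm.slash_action_generators_SL2Z
    · ext τ
      rw [SlashInvariantForm.slash_S_apply]
      have : f (-(τ : ℂ))⁻¹ = f τ := by
        rw [← hS τ τ.im_pos, neg_div, one_div, inv_neg]
      simpa [F] using this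
    · ext τ
      rw [SL_slash_apply, modular_T_smul]
      have := hT τ τ.im_pos
      simpa [F, add_comm] using this
  have hbdd : IsBoundedAtImInfty F := by
    obtain ⟨M, hM⟩ := h0 1 one_pos
    rw [isBoundedAtImInfty_iff]
    exact ⟨1, M + 1, fun z hz => hM z (by simpa using (by linarith : M < z.im))⟩
  let G : ModularForm 𝒮ℒ 0 :=
    { toFun := F
      slash_action_eq' := by rintro _ ⟨γ, rfl⟩; exact hinv γ
      holo' := by
        rw [UpperHalfPlane.mdifferentiable_iff]
        refine hf.congr fun z hz => ?_
        simp [F, ofComplex_apply_of_im_pos (show 0 < z.im from hz)]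
      bdd_at_cusps' := by
        intro c hc
        rw [OnePoint.isBoundedAt_iff_forall_SL2Z hc]
        intro γ hγ
        rw [hinv γ]
        exact hbdd }
  obtain ⟨c, hc⟩ := ModularFormClass.levelOne_weight_zero_const G
  have hfc : ∀ τ : ℂ, 0 < τ.im → f τ = c := fun τ hτ => congrFun hc ⟨τ, hτ⟩
  have hc0 : c = 0 := by
    rw [← norm_le_zero_iff]
    refine le_of_forall_pos_le_add fun ε hε => ?_
    obtain ⟨M, hM⟩ := h0 ε hε
    have := hM ((max M 0 + 1 : ℝ) * Complex.I) (by simp; linarith [le_max_left M 0])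
    rw [hfc _ (by simp; linarith [le_max_right M 0])] at this
    simpa using this
  intro τ hτ
  rw [hfc τ hτ, hc0]

/-- A `2`-periodic holomorphic function that is `o(exp(π Im τ))` at `i∞` is bounded there, since
its singularity in the variable `exp(πiτ)` is removable. -/
lemma bounded_at_inf_of_periodic_of_isLittleO_exp {g : ℂ → ℂ}
    (hg : DifferentiableOn ℂ g {τ | 0 < τ.im})
    (hper : ∀ τ : ℂ, 0 < τ.im → g (τ + 2) = g τ)
    (hlo : ∀ ε : ℝ, 0 < ε → ∃ M : ℝ, ∀ τ : ℂ, M < τ.im → ‖g τ‖ ≤ ε * Real.exp (Real.pi * τ.im)) :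
    ∃ C M : ℝ, ∀ τ : ℂ, M < τ.im → ‖g τ‖ ≤ C := by
  let f : ℂ → ℂ := fun z => if 0 < z.im then g z else 0
  have hf : ∀ z : ℂ, 0 < z.im → f z = g z := fun z hz => if_pos hz
  have hfper : Function.Periodic f ((2 : ℝ) : ℂ) := by
    intro z
    by_cases hz : 0 < z.im
    · have := hper z hz
      simpa [f, hz] using this
    · simp [f, hz]
  have hdiff : ∀ᶠ z in comap Complex.im atTop, DifferentiableAt ℂ f z := by
    filter_upwards [preimage_mem_comap (Ioi_mem_atTop (0 : ℝ))] with z hz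
    have hU : {τ : ℂ | 0 < τ.im} ∈ 𝓝 z :=
      (isOpen_lt continuous_const Complex.continuous_im).mem_nhds hz
    refine (hg.differentiableAt hU).congr_of_eventuallyEq ?_
    filter_upwards [hU] with w hw using hf w hw
  have hcusp := Function.Periodic.eventually_differentiableAt_cuspFunction_nhds_ne_zero
    (h := 2) two_pos hfper hdiff
  set F := Function.Periodic.cuspFunction 2 f with hF
  have hsmall : (fun q => F q - F 0) =o[𝓝[≠] (0 : ℂ)] fun q => (q - 0)⁻¹ := by
    have hinv : Tendsto (fun q : ℂ => ‖q⁻¹‖) (𝓝[≠] 0) atTop :=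
      tendsto_norm_cobounded_atTop.comp tendsto_inv₀_nhdsNE_zero
    refine Asymptotics.IsLittleO.sub ?_ ?_
    · rw [Asymptotics.isLittleO_iff]
      intro ε hε
      obtain ⟨M, hM⟩ := hlo ε hε
      have h1 := (Function.Periodic.invQParam_tendsto (h := 2) two_pos).eventually
        (preimage_mem_comap (Ioi_mem_atTop (max M 0)))
      filter_upwards [h1, self_mem_nhdsWithin] with q hq hq0
      have hq' : max M 0 < (Function.Periodic.invQParam 2 q).im := hq
      rw [hF, Function.Periodic.cuspFunction_eq_of_nonzero _ _ hq0,
        hf _ ((le_max_right _ _).trans_lt hq')]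
      refine (hM _ ((le_max_left _ _).trans_lt hq')).trans (le_of_eq ?_)
      rw [Function.Periodic.im_invQParam, sub_zero, norm_inv]
      congr 1
      rw [show Real.pi * (-2 / (2 * Real.pi) * Real.log ‖q‖) = -Real.log ‖q‖ by
        field_simp, Real.exp_neg, Real.exp_log (norm_pos_iff.2 hq0)]
    · rw [Asymptotics.isLittleO_const_left]
      right
      simpa [Function.comp_def] using hinv
  have hlim := Complex.tendsto_limUnder_of_differentiable_on_punctured_nhds_of_isLittleO
    hcusp hsmall
  have hlim2 := (hlim.comp (Function.Periodic.qParam_tendsto (h := 2) two_pos)).norm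
  have hev := hlim2.eventually (Iio_mem_nhds (lt_add_one _))
  obtain ⟨t, ht, hsub⟩ := mem_comap.1 hev
  obtain ⟨M, hM⟩ := mem_atTop_sets.1 ht
  refine ⟨‖limUnder (𝓝[≠] (0 : ℂ)) F‖ + 1, max M 0, fun τ hτ => ?_⟩
  have h2 := hsub (show τ ∈ Complex.im ⁻¹' t from hM _ ((le_max_left _ _).trans hτ.le))
  have h3 : F (Function.Periodic.qParam 2 τ) = g τ := by
    rw [hF, Function.Periodic.eq_cuspFunction two_ne_zero hfper,
      hf _ ((le_max_right _ _).trans_lt hτ)]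
  rw [← h3]
  exact le_of_lt h2

lemma sub_div_le_arctan_sub_arctan {a b : ℝ} (hab : a ≤ b) (hb : b ≤ a + 1) :
    (b - a) / (3 * (1 + a ^ 2)) ≤ Real.arctan b - Real.arctan a := by
  have key := (convex_Icc a b).mul_sub_le_image_sub_of_le_deriv (f := Real.arctan)
    Real.continuous_arctan.continuousOn Real.differentiable_arctan.differentiableOn
    (C := 1 / (3 * (1 + a ^ 2))) (fun x hx => ?_) a (Set.left_mem_Icc.2 hab) b
    (Set.right_mem_Icc.2 hab) hab
  · calc (b - a) / (3 * (1 + a ^ 2)) = 1 / (3 * (1 + a ^ 2)) * (b - a) := by ring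
      _ ≤ _ := key
  · rw [interior_Icc] at hx
    simp only [Real.deriv_arctan]
    apply one_div_le_one_div_of_le (by positivity)
    nlinarith [hx.1, hx.2, sq_nonneg (2 * a - x), sq_nonneg (x - a), sq_nonneg (x - a - 1)]

lemma rpow_mul_exp_le_arctan_sub {y : ℝ} (hy : 0 < y) (n : ℕ) :
    ((n + 1 : ℕ) : ℝ) ^ (-(3 / 4 : ℝ)) *
        Real.exp (2 * Real.pi * Real.sqrt ((n + 1 : ℕ) : ℝ) - Real.pi * ((n + 1 : ℕ) : ℝ) * y) ≤
      45 * Real.exp (Real.pi / y) *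
        (Real.arctan (((n + 1 + 1 : ℕ) : ℝ) ^ (1 / 4 : ℝ) - Real.sqrt (1 / y)) -
          Real.arctan (((n + 1 : ℕ) : ℝ) ^ (1 / 4 : ℝ) - Real.sqrt (1 / y))) := by
  have hx1 : (1 : ℝ) ≤ ((n + 1 : ℕ) : ℝ) := by simp
  rw [show (((n + 1 + 1 : ℕ) : ℝ)) = ((n + 1 : ℕ) : ℝ) + 1 by push_cast; ring]
  generalize ((n + 1 : ℕ) : ℝ) = x at hx1 ⊢
  have hx0 : 0 ≤ x := by linarith
  obtain ⟨v, hv⟩ : ∃ v, v = x ^ (1 / 4 : ℝ) := ⟨_, rfl⟩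
  obtain ⟨w, hw⟩ : ∃ w, w = (x + 1) ^ (1 / 4 : ℝ) := ⟨_, rfl⟩
  obtain ⟨r, hr⟩ : ∃ r, r = Real.sqrt (1 / y) := ⟨_, rfl⟩
  have hv4 : v ^ 4 = x := by
    rw [hv, ← Real.rpow_natCast, ← Real.rpow_mul hx0]; norm_num
  have hw4 : w ^ 4 = x + 1 := by
    rw [hw, ← Real.rpow_natCast, ← Real.rpow_mul (by linarith)]; norm_num
  have hv1 : 1 ≤ v := by rw [hv]; exact Real.one_le_rpow hx1 (by norm_num)
  have hw1 : 1 ≤ w := by rw [hw]; exact Real.one_le_rpow (by linarith) (by norm_num)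
  have hvx : x ^ (-(3 / 4 : ℝ)) = (v ^ 3)⁻¹ := by
    rw [hv, ← Real.rpow_natCast, ← Real.rpow_mul hx0, ← Real.rpow_neg hx0]; norm_num
  have hsq : Real.sqrt x = v ^ 2 := by
    rw [← hv4, show v ^ 4 = (v ^ 2) ^ 2 by ring, Real.sqrt_sq (by positivity)]
  have hr0 : 0 < r := by rw [hr]; positivity
  have hr2 : r ^ 2 = 1 / y := by rw [hr, Real.sq_sqrt (by positivity)]
  have hyr : y = 1 / r ^ 2 := by rw [hr2]; simp
  rw [← hv, ← hw, ← hr, hvx, hsq]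
  have hvw : v ≤ w := by
    rw [hv, hw]; exact Real.rpow_le_rpow hx0 (by linarith) (by norm_num)
  have hw2v : w ≤ 2 * v := by
    apply le_of_pow_le_pow_left₀ (n := 4) (by norm_num) (by positivity)
    rw [mul_pow, hv4, hw4]; linarith
  have hfac : (w - v) * ((w + v) * (w ^ 2 + v ^ 2)) = 1 := by
    linear_combination hw4 - hv4
  have hwv0 : 0 ≤ w - v := by linarith
  have hlow : (v ^ 3)⁻¹ ≤ 15 * (w - v) := by
    rw [inv_le_iff_one_le_mul₀ (by positivity), ← hfac]
    have : (w + v) * (w ^ 2 + v ^ 2) ≤ (3 * v) * (5 * v ^ 2) := by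
      apply mul_le_mul (by linarith) (by nlinarith) (by positivity) (by positivity)
    nlinarith [mul_le_mul_of_nonneg_left this hwv0]
  have hup : w - v ≤ 1 := by
    have : 1 ≤ (w + v) * (w ^ 2 + v ^ 2) := by nlinarith [sq_nonneg (w - 1), sq_nonneg (v - 1)]
    nlinarith
  have harc := sub_div_le_arctan_sub_arctan (a := v - r) (b := w - r) (by linarith) (by linarith)
  have hexp : 2 * Real.pi * v ^ 2 - Real.pi * x * y ≤ Real.pi / y - (v - r) ^ 2 := by
    have h1 : Real.pi / y - (2 * Real.pi * v ^ 2 - Real.pi * x * y)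
        = Real.pi * ((v - r) ^ 2 * ((v + r) ^ 2 / r ^ 2)) := by
      rw [← hv4, hyr]; field_simp; ring
    have h2 : 1 ≤ (v + r) ^ 2 / r ^ 2 := by
      rw [le_div_iff₀ (by positivity)]; nlinarith
    have h3 : (v - r) ^ 2 ≤ (v - r) ^ 2 * ((v + r) ^ 2 / r ^ 2) :=
      le_mul_of_one_le_right (sq_nonneg _) h2
    nlinarith [Real.pi_gt_three, sq_nonneg (v - r)]
  have hexp2 : Real.exp (-(v - r) ^ 2) ≤ 1 / (1 + (v - r) ^ 2) := by
    rw [Real.exp_neg, ← one_div]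
    apply one_div_le_one_div_of_le (by positivity)
    linarith [Real.add_one_le_exp ((v - r) ^ 2)]
  calc (v ^ 3)⁻¹ * Real.exp (2 * Real.pi * v ^ 2 - Real.pi * x * y)
      ≤ (15 * (w - v)) * (Real.exp (Real.pi / y) * (1 / (1 + (v - r) ^ 2))) := by
        apply mul_le_mul hlow _ (Real.exp_pos _).le (by positivity)
        calc _ ≤ Real.exp (Real.pi / y + -(v - r) ^ 2) := Real.exp_le_exp.2 (by linarith)
          _ ≤ _ := by rw [Real.exp_add]; gcongr
    _ = 45 * Real.exp (Real.pi / y) * ((w - r - (v - r)) / (3 * (1 + (v - r) ^ 2))) := by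
        field_simp; ring
    _ ≤ _ := by gcongr

/-- If `aₙ = o(n^{-3/4} exp(2π√n))`, then `∑ |aₙ| exp(-πny) = o(exp(π/y))` as `y → 0⁺`. -/
lemma tsum_mul_exp_le_of_isLittleO {a : ℕ → ℂ} (h0 : a 0 = 0)
    (hlo : ∀ ε : ℝ, 0 < ε → ∃ N : ℝ, ∀ n : ℕ, N ≤ (n : ℝ) →
      ‖a n‖ ≤ ε * (n : ℝ) ^ (-(3 / 4 : ℝ)) * Real.exp (2 * Real.pi * Real.sqrt n))
    {ε : ℝ} (hε : 0 < ε) :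
    ∃ K : ℝ, ∀ y : ℝ, 0 < y →
      ∑' n : ℕ, ‖a n‖ * Real.exp (-(Real.pi * n * y)) ≤ K + ε * Real.exp (Real.pi / y) := by
  obtain ⟨N, hN⟩ := hlo (ε / (45 * Real.pi)) (by positivity)
  obtain ⟨M, hM⟩ := exists_nat_ge N
  refine ⟨∑ n ∈ Finset.range M, ‖a n‖, fun y hy => ?_⟩
  have hterm : ∀ n : ℕ, ‖a (n + 1)‖ * Real.exp (-(Real.pi * (n + 1 : ℕ) * y)) ≤
      (if n + 1 < M then ‖a (n + 1)‖ else 0) + ε / (45 * Real.pi) *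
        (45 * Real.exp (Real.pi / y) *
        (Real.arctan (((n + 1 + 1 : ℕ) : ℝ) ^ (1 / 4 : ℝ) - Real.sqrt (1 / y)) -
          Real.arctan (((n + 1 : ℕ) : ℝ) ^ (1 / 4 : ℝ) - Real.sqrt (1 / y)))) := by
    intro n
    have h1 := rpow_mul_exp_le_arctan_sub hy n
    have h2 := mul_le_mul_of_nonneg_left h1 (show 0 ≤ ε / (45 * Real.pi) by positivity)
    split_ifs with h
    · refine le_add_of_le_of_nonneg (mul_le_of_le_one_right (norm_nonneg _) ?_)
        (le_trans (by positivity) h2)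
      rw [Real.exp_le_one_iff, neg_nonpos]; positivity
    · rw [zero_add]
      refine le_trans ?_ h2
      have h3 := hN (n + 1) (hM.trans (by exact_mod_cast not_lt.1 h))
      refine (mul_le_mul_of_nonneg_right h3 (Real.exp_pos _).le).trans (le_of_eq ?_)
      rw [sub_eq_add_neg, Real.exp_add]; ring
  refine Real.tsum_le_of_sum_range_le (fun n => by positivity) fun k => ?_
  have hmono : ∑ n ∈ Finset.range k, ‖a n‖ * Real.exp (-(Real.pi * n * y)) ≤
      ∑ n ∈ Finset.range (k + 1), ‖a n‖ * Real.exp (-(Real.pi * n * y)) :=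
    Finset.sum_le_sum_of_subset_of_nonneg (by simp) (fun _ _ _ => by positivity)
  refine hmono.trans ?_
  rw [Finset.sum_range_succ', h0, norm_zero, zero_mul, add_zero]
  refine (Finset.sum_le_sum fun n _ => hterm n).trans ?_
  rw [Finset.sum_add_distrib, ← Finset.mul_sum, ← Finset.mul_sum,
    Finset.sum_range_sub (fun n => Real.arctan (((n + 1 : ℕ) : ℝ) ^ (1 / 4 : ℝ) - √(1 / y)))]
  gcongr ?_ + ?_
  · rw [← Finset.sum_filter]
    calc _ = ∑ n ∈ ((Finset.range k).filter (fun n => n + 1 < M)).image (· + 1), ‖a n‖ := by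
          rw [Finset.sum_image (by simp)]
      _ ≤ _ := Finset.sum_le_sum_of_subset_of_nonneg
          (by intro n; simp; rintro m - h rfl; exact h) (fun _ _ _ => norm_nonneg _)
  · have h1 := Real.arctan_lt_pi_div_two (((k + 1 : ℕ) : ℝ) ^ (1 / 4 : ℝ) - √(1 / y))
    have h2 := Real.neg_pi_div_two_lt_arctan (((0 + 1 : ℕ) : ℝ) ^ (1 / 4 : ℝ) - √(1 / y))
    calc _ ≤ ε / (45 * Real.pi) * (45 * Real.exp (Real.pi / y) * Real.pi) := by
          gcongr; linarith
      _ = _ := by field_simp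

lemma Complex.im_neg_one_div_pos {τ : ℂ} (hτ : 0 < τ.im) : 0 < (-1 / τ).im := by
  have h : 0 < Complex.normSq τ := Complex.normSq_pos.2 (by rintro rfl; simp at hτ)
  rw [Complex.div_im]
  simp only [Complex.neg_im, Complex.one_im, Complex.neg_re, Complex.one_re]
  have : 0 < τ.im / Complex.normSq τ := by positivity
  calc (0 : ℝ) < _ := this
    _ = _ := by ring

lemma Complex.ne_zero_of_im_pos {τ : ℂ} (hτ : 0 < τ.im) : τ ≠ 0 := by
  rintro rfl; simp at hτ

section ThetaGroup

variable {A : ℂ → ℂ}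

lemma comp_one_sub_inv_periodic (hT : ∀ τ : ℂ, 0 < τ.im → A (τ + 2) = A τ)
    (hD : ∀ τ : ℂ, 0 < τ.im → A (-1 / (τ + 2)) = A (-1 / τ)) (τ : ℂ) (hτ : 0 < τ.im) :
    A (1 - 1 / (τ + 2)) = A (1 - 1 / τ) := by
  have h0 := Complex.ne_zero_of_im_pos hτ
  have h1 : τ + 1 ≠ 0 := Complex.ne_zero_of_im_pos (by simpa using hτ)
  have h2 : τ + 2 ≠ 0 := Complex.ne_zero_of_im_pos (by simpa using hτ)
  have hi1 : 0 < (-1 / (τ + 1)).im := Complex.im_neg_one_div_pos (by simpa using hτ)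
  have hi0 : 0 < (-1 / τ).im := Complex.im_neg_one_div_pos hτ
  have e1 := hD (-1 + -1 / (τ + 1)) (by simpa using hi1)
  have e2 := hT (-1 + -1 / τ) (by simpa using hi0)
  have t1 : -1 + -1 / (τ + 1) ≠ 0 := Complex.ne_zero_of_im_pos (by simpa using hi1)
  have t2 : -1 + -1 / (τ + 1) + 2 ≠ 0 := Complex.ne_zero_of_im_pos (by simpa using hi1)
  rw [show -1 / (-1 + -1 / (τ + 1) + 2) = -1 + -1 / τ by
      rw [div_eq_iff t2]; field_simp; ring,
    show -1 / (-1 + -1 / (τ + 1)) = 1 - 1 / (τ + 2) by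
      rw [div_eq_iff t1]; field_simp; ring] at e1
  rw [← e1, ← e2]
  congr 1
  ring

lemma exists_abs_re_le_one_add_two_mul (τ : ℂ) : ∃ n : ℤ, |(τ + 2 * n).re| ≤ 1 := by
  refine ⟨-round (τ.re / 2), ?_⟩
  have := abs_sub_round (τ.re / 2)
  rw [abs_le] at this ⊢
  simp
  constructor <;> linarith [this.1, this.2]

lemma apply_add_two_mul_int {g : ℂ → ℂ} (hg : ∀ τ : ℂ, 0 < τ.im → g (τ + 2) = g τ)
    (τ : ℂ) (hτ : 0 < τ.im) (n : ℤ) : g (τ + 2 * n) = g τ := by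
  induction n with
  | zero => simp
  | succ n ih =>
    rw [← ih, ← hg (τ + 2 * (n : ℤ)) (by simpa using hτ)]
    congr 1; push_cast; ring
  | pred n ih =>
    rw [← ih, ← hg (τ + 2 * (-(n : ℤ) - 1 : ℤ)) (by simpa using hτ)]
    congr 1; push_cast; ring

lemma differentiableOn_comp_im_pos {φ : ℂ → ℂ} (hA : DifferentiableOn ℂ A {τ | 0 < τ.im})
    (hφ : ∀ τ : ℂ, 0 < τ.im → DifferentiableAt ℂ φ τ ∧ 0 < (φ τ).im) :
    DifferentiableOn ℂ (fun τ => A (φ τ)) {τ | 0 < τ.im} :=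
  hA.comp (fun τ hτ => (hφ τ hτ).1.differentiableWithinAt) fun τ hτ => (hφ τ hτ).2

/-- A holomorphic function invariant under `τ ↦ τ + 2` and `τ ↦ τ / (1 - 2τ)` that vanishes at
`i∞`, is bounded at `0`, and has no pole at the cusp `1`, is zero: the product of its six
translates under `SL(2, ℤ)` is a level one modular function vanishing at the cusp. -/
theorem eq_zero_of_thetaGroup_invariant (hA : DifferentiableOn ℂ A {τ | 0 < τ.im})
    (hT : ∀ τ : ℂ, 0 < τ.im → A (τ + 2) = A τ)
    (hD : ∀ τ : ℂ, 0 < τ.im → A (-1 / (τ + 2)) = A (-1 / τ))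
    (h0 : ∀ ε : ℝ, 0 < ε → ∃ M : ℝ, ∀ τ : ℂ, M < τ.im → ‖A τ‖ ≤ ε)
    (hb : ∃ C M : ℝ, ∀ τ : ℂ, M < τ.im → ‖A (-1 / τ)‖ ≤ C)
    (hlo : ∀ ε : ℝ, 0 < ε → ∃ M : ℝ, ∀ τ : ℂ, |τ.re| ≤ 1 → M < τ.im →
      ‖A (1 - 1 / τ)‖ ≤ ε * Real.exp (Real.pi * τ.im)) :
    ∀ τ : ℂ, 0 < τ.im → A τ = 0 := by
  have hg2 := comp_one_sub_inv_periodic hT hD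
  have hU : IsOpen {τ : ℂ | 0 < τ.im} := isOpen_lt continuous_const Complex.continuous_im
  have hinv : ∀ τ : ℂ, 0 < τ.im → 0 < (-1 / τ).im := fun τ => Complex.im_neg_one_div_pos
  have dinv : ∀ τ : ℂ, 0 < τ.im → DifferentiableAt ℂ (fun τ => -1 / τ) τ := fun τ hτ =>
    (differentiableAt_const _).div differentiableAt_id (Complex.ne_zero_of_im_pos hτ)
  have hs : ∀ τ : ℂ, 0 < τ.im → 0 < (τ + 1).im := fun τ hτ => by simpa using hτ
  have dinv1 : ∀ τ : ℂ, 0 < τ.im → DifferentiableAt ℂ (fun τ => -1 / (τ + 1)) τ := fun τ hτ =>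
    (differentiableAt_const _).div (differentiableAt_id.add_const _)
      (Complex.ne_zero_of_im_pos (hs τ hτ))
  have hsub : ∀ τ : ℂ, (1 - 1 / τ) = -1 / τ + 1 := fun τ => by ring
  simp only [hsub] at hlo hg2
  have d1 := hA
  have d2 : DifferentiableOn ℂ (fun τ => A (τ + 1)) {τ | 0 < τ.im} :=
    differentiableOn_comp_im_pos hA fun τ hτ => ⟨differentiableAt_id.add_const _, hs τ hτ⟩
  have d3 : DifferentiableOn ℂ (fun τ => A (-1 / τ)) {τ | 0 < τ.im} :=
    differentiableOn_comp_im_pos hA fun τ hτ => ⟨dinv τ hτ, hinv τ hτ⟩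
  have d4 : DifferentiableOn ℂ (fun τ => A (-1 / (τ + 1))) {τ | 0 < τ.im} :=
    differentiableOn_comp_im_pos hA fun τ hτ => ⟨dinv1 τ hτ, hinv _ (hs τ hτ)⟩
  have d5 : DifferentiableOn ℂ (fun τ => A (-1 / τ + 1)) {τ | 0 < τ.im} :=
    differentiableOn_comp_im_pos hA fun τ hτ => ⟨(dinv τ hτ).add_const _, hs _ (hinv τ hτ)⟩
  have d6 : DifferentiableOn ℂ (fun τ => A (-1 / (τ + 1) + 1)) {τ | 0 < τ.im} :=
    differentiableOn_comp_im_pos hA fun τ hτ =>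
      ⟨(dinv1 τ hτ).add_const _, hs _ (hinv _ (hs τ hτ))⟩
  obtain ⟨C₅, M₅, hb5⟩ := bounded_at_inf_of_periodic_of_isLittleO_exp d5 hg2 (by
    intro ε hε
    obtain ⟨M, hM⟩ := hlo ε hε
    refine ⟨max M 0, fun τ hτ => ?_⟩
    obtain ⟨n, hn⟩ := exists_abs_re_le_one_add_two_mul τ
    rw [← apply_add_two_mul_int (g := fun τ => A (-1 / τ + 1)) hg2 τ
      ((le_max_right _ _).trans_lt hτ) n]
    refine (hM _ hn (by simpa using (le_max_left _ _).trans_lt hτ)).trans (le_of_eq ?_)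
    simp)
  obtain ⟨C₃, M₃, hb3⟩ := hb
  have hC3 : 0 ≤ C₃ := (norm_nonneg _).trans (hb3 ((M₃ + 1 : ℝ) * Complex.I) (by simp))
  have hC5 : 0 ≤ C₅ := (norm_nonneg _).trans (hb5 ((M₅ + 1 : ℝ) * Complex.I) (by simp))
  have hP := eq_zero_of_levelOne_of_zero_at_inf
    (f := fun τ => A τ * (A (τ + 1) * (A (-1 / τ) * (A (-1 / (τ + 1)) *
      (A (-1 / τ + 1) * A (-1 / (τ + 1) + 1))))))
    (d1.mul (d2.mul (d3.mul (d4.mul (d5.mul d6))))) ?_ ?_ ?_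
  · have hc : IsPreconnected {τ : ℂ | 0 < τ.im} := (convex_halfSpace_im_gt 0).isPreconnected
    have an : ∀ {f : ℂ → ℂ}, DifferentiableOn ℂ f {τ | 0 < τ.im} →
      AnalyticOnNhd ℂ f {τ | 0 < τ.im} := fun h => h.analyticOnNhd hU
    have hm : ∀ τ : ℂ, 0 < τ.im → 0 < (τ - 1).im := fun τ hτ => by simpa using hτ
    rcases AnalyticOnNhd.eq_zero_or_eq_zero_of_mul_eq_zero (an d1)
      (an (d2.mul (d3.mul (d4.mul (d5.mul d6))))) hP hc with h | hP
    · exact h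
    rcases AnalyticOnNhd.eq_zero_or_eq_zero_of_mul_eq_zero (an d2)
      (an (d3.mul (d4.mul (d5.mul d6)))) hP hc with h | hP
    · intro τ hτ
      simpa using h (τ - 1) (hm τ hτ)
    rcases AnalyticOnNhd.eq_zero_or_eq_zero_of_mul_eq_zero (an d3)
      (an (d4.mul (d5.mul d6))) hP hc with h | hP
    · intro τ hτ
      have := h (-1 / τ) (hinv τ hτ)
      rwa [show -1 / (-1 / τ) = τ by field_simp] at this
    rcases AnalyticOnNhd.eq_zero_or_eq_zero_of_mul_eq_zero (an d4)
      (an (d5.mul d6)) hP hc with h | hP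
    · intro τ hτ
      have := h (-1 / τ - 1) (hm _ (hinv τ hτ))
      rwa [show -1 / (-1 / τ - 1 + 1) = τ by rw [sub_add_cancel]; field_simp] at this
    rcases AnalyticOnNhd.eq_zero_or_eq_zero_of_mul_eq_zero (an d5) (an d6) hP hc with h | h
    · intro τ hτ
      have := h (-1 / (τ - 1)) (hinv _ (hm τ hτ))
      rwa [show -1 / (-1 / (τ - 1)) + 1 = τ by
        have := Complex.ne_zero_of_im_pos (hm τ hτ); field_simp; ring] at this
    · intro τ hτ
      have := h (-1 / (τ - 1) - 1) (hm _ (hinv _ (hm τ hτ)))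
      rwa [sub_add_cancel, show -1 / (-1 / (τ - 1)) + 1 = τ by
        have := Complex.ne_zero_of_im_pos (hm τ hτ); field_simp; ring] at this
  · intro τ hτ
    have e1 := hT τ hτ
    have e2 := hD τ hτ
    have e3 := hg2 τ hτ
    simp only [add_assoc, one_add_one_eq_two] at e1 e2 e3 ⊢
    rw [e1, e2, e3]
    ring
  · intro τ hτ
    have n0 := Complex.ne_zero_of_im_pos hτ
    have hm : 0 < (τ - 1).im := by simpa using hτ
    have n1 := Complex.ne_zero_of_im_pos hm
    have n2 := Complex.ne_zero_of_im_pos (hs _ (hinv τ hτ))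
    have i1 : -1 / (-1 / τ) = τ := by field_simp
    have i2 : -1 / (-1 / τ + 1) = -1 / (τ - 1) - 1 := by
      rw [div_eq_iff n2]; field_simp; ring
    have e1 := hT (-1 / (τ - 1) - 1) (by simpa using hinv _ hm)
    have e2 := hg2 (τ - 1) hm
    have e3 := hD (τ - 1) hm
    rw [show -1 / (τ - 1) - 1 + 2 = -1 / (τ - 1) + 1 by ring] at e1
    rw [show τ - 1 + 2 = τ + 1 by ring] at e2 e3
    simp only [i1, i2, sub_add_cancel]
    rw [← e1, ← e2, ← e3]
    ring
  · intro ε hε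
    obtain ⟨M₁, hM₁⟩ := h0 (ε / (1 + C₃ * (C₃ * (C₅ * C₅)))) (by positivity)
    obtain ⟨M₂, hM₂⟩ := h0 1 one_pos
    refine ⟨max (max M₁ M₂) (max M₃ M₅), fun τ hτ => ?_⟩
    simp only [max_lt_iff] at hτ
    obtain ⟨⟨h1, h2⟩, h3, h5⟩ := hτ
    have him : (τ + 1).im = τ.im := by simp
    simp only [norm_mul]
    calc _ ≤ (ε / (1 + C₃ * (C₃ * (C₅ * C₅)))) * (1 * (C₃ * (C₃ * (C₅ * C₅)))) := by
          gcongr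
          · exact hM₁ τ h1
          · exact hM₂ _ (him ▸ h2)
          · exact hb3 τ h3
          · exact hb3 _ (him ▸ h3)
          · exact hb5 τ h5
          · exact hb5 _ (him ▸ h5)
      _ ≤ ε := by
          rw [div_mul_eq_mul_div, div_le_iff₀ (by positivity)]
          nlinarith

end ThetaGroup

lemma eq_const_of_add_conj_eq_const {U : Set ℂ} (hU : IsOpen U) (hc : IsPreconnected U)
    {F G : ℂ → ℂ} (hF : DifferentiableOn ℂ F U) (hG : DifferentiableOn ℂ G U) {c : ℂ}
    (h : ∀ z ∈ U, F z + starRingEnd ℂ (G z) = c) : ∃ d, ∀ z ∈ U, F z = d := by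
  refine hU.exists_is_const_of_deriv_eq_zero hc hF fun z hz => ?_
  have hF' := (hF.differentiableAt (hU.mem_nhds hz)).hasDerivAt
  have hG' := (hG.differentiableAt (hU.mem_nhds hz)).hasDerivAt
  have key : ∀ v : ℂ, deriv F z * v + starRingEnd ℂ (deriv G z * v) = 0 := by
    intro v
    have hl : HasDerivAt (fun t : ℝ => z + (t : ℂ) * v) v 0 := by
      simpa using ((Complex.ofRealCLM.hasDerivAt (x := 0)).mul_const v).const_add z
    have hl0 : z + ((0 : ℝ) : ℂ) * v = z := by simp
    have h1 : HasDerivAt (fun t : ℝ => F (z + (t : ℂ) * v)) (deriv F z * v) 0 :=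
      HasDerivAt.comp (0 : ℝ) (by simpa using hF') hl
    have h2 : HasDerivAt (fun t : ℝ => G (z + (t : ℂ) * v)) (deriv G z * v) 0 :=
      HasDerivAt.comp (0 : ℝ) (by simpa using hG') hl
    have h3 : HasDerivAt (fun t : ℝ => F (z + (t : ℂ) * v) + starRingEnd ℂ (G (z + (t : ℂ) * v)))
        (deriv F z * v + starRingEnd ℂ (deriv G z * v)) 0 := h1.add h2.star
    have hev : (fun t : ℝ => F (z + (t : ℂ) * v) + starRingEnd ℂ (G (z + (t : ℂ) * v)))
        =ᶠ[𝓝 0] fun _ => c := by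
      have : ∀ᶠ t : ℝ in 𝓝 0, z + (t : ℂ) * v ∈ U :=
        hl.continuousAt.eventually_mem (by rw [hl0]; exact hU.mem_nhds hz)
      filter_upwards [this] with t ht using h _ ht
    exact h3.unique ((hasDerivAt_const (0 : ℝ) c).congr_of_eventuallyEq hev)
  have k1 := key 1
  have k2 := key Complex.I
  simp only [mul_one, map_mul, Complex.conj_I] at k1 k2
  have : deriv F z * 2 * Complex.I = 0 := by linear_combination Complex.I * k1 + k2
  simpa using this

section PowerSeries

variable {a : ℕ → ℂ}

lemma summable_norm_mul_pow_of_subexp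
    (ha : ∀ ε : ℝ, 0 < ε → ∃ C : ℝ, ∀ n : ℕ, ‖a n‖ ≤ C * Real.exp (ε * n)) {r : ℝ}
    (hr0 : 0 ≤ r) (hr1 : r < 1) : Summable fun n => ‖a n‖ * r ^ n := by
  obtain ⟨ρ, hρ, hρ1⟩ := exists_between hr1
  have hρ0 : 0 < ρ := hr0.trans_lt hρ
  obtain ⟨C, hC⟩ := ha (-Real.log ρ) (by simpa using Real.log_neg hρ0 hρ1)
  have hgeo : Summable fun n : ℕ => C * (r / ρ) ^ n :=
    (summable_geometric_of_lt_one (by positivity) ((div_lt_one hρ0).2 hρ)).mul_left C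
  refine hgeo.of_nonneg_of_le (fun n => by positivity) fun n => ?_
  have hexp : Real.exp (-Real.log ρ * n) = (ρ ^ n)⁻¹ := by
    rw [mul_comm, Real.exp_nat_mul, Real.exp_neg, Real.exp_log hρ0, inv_pow]
  calc ‖a n‖ * r ^ n ≤ C * Real.exp (-Real.log ρ * n) * r ^ n := by gcongr; exact hC n
    _ = C * (r / ρ) ^ n := by rw [hexp, div_pow]; ring

lemma hasFPowerSeriesOnBall_of_subexp
    (ha : ∀ ε : ℝ, 0 < ε → ∃ C : ℝ, ∀ n : ℕ, ‖a n‖ ≤ C * Real.exp (ε * n)) :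
    HasFPowerSeriesOnBall (fun q : ℂ => ∑' n : ℕ, a n * q ^ n)
      (FormalMultilinearSeries.ofScalars ℂ a) 0 1 := by
  have hrad : 1 ≤ (FormalMultilinearSeries.ofScalars ℂ a).radius := by
    refine ENNReal.le_of_forall_nnreal_lt fun r hr => ?_
    refine FormalMultilinearSeries.le_radius_of_summable _ ?_
    have hr1 : (r : ℝ) < 1 := by exact_mod_cast hr
    refine (summable_norm_mul_pow_of_subexp ha r.2 hr1).congr fun n => ?_
    simp
  have h := (FormalMultilinearSeries.ofScalars ℂ a).hasFPowerSeriesOnBall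
    (one_pos.trans_le hrad)
  have hsum : (FormalMultilinearSeries.ofScalars ℂ a).sum = fun q : ℂ => ∑' n : ℕ, a n * q ^ n := by
    ext q
    simp [FormalMultilinearSeries.sum, mul_comm]
  rw [hsum] at h
  exact h.mono one_pos hrad

lemma eq_zero_of_tsum_mul_pow_eq_zero
    (ha : ∀ ε : ℝ, 0 < ε → ∃ C : ℝ, ∀ n : ℕ, ‖a n‖ ≤ C * Real.exp (ε * n)) (ha0 : a 0 = 0)
    (h : ∀ τ : ℂ, 0 < τ.im → ∑' n : ℕ, a n * Complex.exp (Complex.I * Real.pi * τ) ^ n = 0)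
    (n : ℕ) : a n = 0 := by
  have hp := (hasFPowerSeriesOnBall_of_subexp ha).hasFPowerSeriesAt
  have hev : (fun q : ℂ => ∑' n : ℕ, a n * q ^ n) =ᶠ[𝓝 0] 0 := by
    filter_upwards [Metric.ball_mem_nhds (0 : ℂ) one_pos] with q hq
    rw [mem_ball_zero_iff] at hq
    rcases eq_or_ne q 0 with rfl | hq0
    · rw [tsum_eq_single 0 (by intro n hn; simp [hn])]
      simp [ha0]
    · have hexp : Complex.I * Real.pi * (-Complex.I * Complex.log q / Real.pi) = Complex.log q := by
        have : (Real.pi : ℂ) ≠ 0 := by exact_mod_cast Real.pi_ne_zero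
        field_simp
        rw [Complex.I_sq]; ring
      have := h (-Complex.I * Complex.log q / Real.pi) (by
        rw [Complex.div_ofReal_im]
        simp only [neg_mul, Complex.neg_im, Complex.I_mul_im, Complex.log_re]
        have := Real.log_neg (norm_pos_iff.2 hq0) hq
        exact div_pos (by linarith) Real.pi_pos)
      rwa [hexp, Complex.exp_log hq0] at this
  have hz := (hp.congr hev).eq_zero
  rw [← FormalMultilinearSeries.coeff_ofScalars (p := a), hz, FormalMultilinearSeries.coeff_eq_zero,
    FormalMultilinearSeries.zero_apply]

lemma norm_exp_I_mul_pi_mul (τ : ℂ) :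
    ‖Complex.exp (Complex.I * Real.pi * τ)‖ = Real.exp (-(Real.pi * τ.im)) := by
  rw [Complex.norm_exp]
  simp [mul_assoc]

lemma norm_exp_I_mul_pi_mul_lt_one {τ : ℂ} (hτ : 0 < τ.im) :
    ‖Complex.exp (Complex.I * Real.pi * τ)‖ < 1 := by
  rw [norm_exp_I_mul_pi_mul, Real.exp_lt_one_iff, neg_lt_zero]
  positivity

lemma differentiableOn_tsum_mul_exp_pow
    (ha : ∀ ε : ℝ, 0 < ε → ∃ C : ℝ, ∀ n : ℕ, ‖a n‖ ≤ C * Real.exp (ε * n)) :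
    DifferentiableOn ℂ (fun τ : ℂ => ∑' n : ℕ, a n * Complex.exp (Complex.I * Real.pi * τ) ^ n)
      {τ | 0 < τ.im} := by
  have h1 : DifferentiableOn ℂ (fun q : ℂ => ∑' n : ℕ, a n * q ^ n) (Metric.ball 0 1) := by
    have := (hasFPowerSeriesOnBall_of_subexp ha).differentiableOn
    rwa [← ENNReal.ofReal_one, Metric.eball_ofReal] at this
  refine h1.comp (t := Metric.ball 0 1) (f := fun τ : ℂ => Complex.exp (Complex.I * Real.pi * τ))
    (by fun_prop) fun τ hτ => ?_
  rw [mem_ball_zero_iff]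
  exact norm_exp_I_mul_pi_mul_lt_one hτ

lemma tsum_mul_exp_pow_zero_at_inf
    (ha : ∀ ε : ℝ, 0 < ε → ∃ C : ℝ, ∀ n : ℕ, ‖a n‖ ≤ C * Real.exp (ε * n)) (ha0 : a 0 = 0)
    {ε : ℝ} (hε : 0 < ε) :
    ∃ M : ℝ, ∀ τ : ℂ, M < τ.im →
      ‖∑' n : ℕ, a n * Complex.exp (Complex.I * Real.pi * τ) ^ n‖ ≤ ε := by
  have hct := (hasFPowerSeriesOnBall_of_subexp ha).hasFPowerSeriesAt.continuousAt
  have h0 : ∑' n : ℕ, a n * (0 : ℂ) ^ n = 0 := by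
    rw [tsum_eq_single 0 (by intro n hn; simp [hn])]
    simp [ha0]
  obtain ⟨δ, hδ, h⟩ := Metric.continuousAt_iff.1 hct ε hε
  refine ⟨-Real.log δ / Real.pi, fun τ hτ => ?_⟩
  have := h (x := Complex.exp (Complex.I * Real.pi * τ)) (by
    rw [dist_zero_right, norm_exp_I_mul_pi_mul, ← Real.lt_log_iff_exp_lt hδ]
    rw [div_lt_iff₀ Real.pi_pos] at hτ
    linarith)
  rw [h0, dist_zero_right] at this
  exact this.le

end PowerSeries

lemma one_div_im_one_sub_one_div_le {τ : ℂ} (hre : |τ.re| ≤ 1) (him : 1 ≤ τ.im) :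
    0 < (1 - 1 / τ).im ∧ 1 / (1 - 1 / τ).im ≤ τ.im + 1 := by
  have h : (1 - 1 / τ).im = τ.im / Complex.normSq τ := by
    simp [neg_div]
  have hn : Complex.normSq τ = τ.re ^ 2 + τ.im ^ 2 := by rw [Complex.normSq_apply]; ring
  have hn0 : 0 < Complex.normSq τ := by rw [hn]; positivity
  refine ⟨by rw [h]; positivity, ?_⟩
  rw [h, one_div_div, div_le_iff₀ (by linarith), hn]
  nlinarith [sq_le_one_iff_abs_le_one τ.re |>.2 hre]

/-- Uniqueness for holomorphic hyperbolic Fourier series. -/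
theorem coeff_eq_zero_of_tsum_add_tsum_eq_const {a b : ℕ → ℂ} (ha0 : a 0 = 0) (hb0 : b 0 = 0)
    (ha : ∀ ε : ℝ, 0 < ε → ∃ C : ℝ, ∀ n : ℕ, ‖a n‖ ≤ C * Real.exp (ε * n))
    (hb : ∀ ε : ℝ, 0 < ε → ∃ C : ℝ, ∀ n : ℕ, ‖b n‖ ≤ C * Real.exp (ε * n))
    (hlo : ∀ ε : ℝ, 0 < ε → ∃ N : ℝ, ∀ n : ℕ, N ≤ (n : ℝ) →
      ‖a n‖ ≤ ε * (n : ℝ) ^ (-(3 / 4 : ℝ)) * Real.exp (2 * Real.pi * Real.sqrt n))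
    {c : ℂ} (h : ∀ τ : ℂ, 0 < τ.im →
      ∑' n : ℕ, a n * Complex.exp (Complex.I * Real.pi * τ) ^ n +
        ∑' n : ℕ, b n * Complex.exp (Complex.I * Real.pi * (-1 / τ)) ^ n = c) :
    (∀ n, a n = 0) ∧ ∀ n, b n = 0 := by
  have hD : ∀ τ : ℂ, 0 < τ.im → ∑' n : ℕ, a n * Complex.exp (Complex.I * Real.pi * (-1 / τ)) ^ n =
      c - ∑' n : ℕ, b n * Complex.exp (Complex.I * Real.pi * τ) ^ n := by
    intro τ hτ
    have := h (-1 / τ) (Complex.im_neg_one_div_pos hτ)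
    rw [show -1 / (-1 / τ) = τ by
      have := Complex.ne_zero_of_im_pos hτ; field_simp] at this
    exact eq_sub_of_add_eq this
  have hexp : ∀ τ : ℂ, Complex.exp (Complex.I * Real.pi * (τ + 2)) =
      Complex.exp (Complex.I * Real.pi * τ) := fun τ => by
    rw [← Complex.exp_periodic (Complex.I * Real.pi * τ)]
    congr 1; ring
  have hA := eq_zero_of_thetaGroup_invariant
    (A := fun τ => ∑' n : ℕ, a n * Complex.exp (Complex.I * Real.pi * τ) ^ n)
    (differentiableOn_tsum_mul_exp_pow ha) (fun τ _ => by simp only [hexp])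
    (fun τ hτ => by rw [hD _ (by simpa using hτ), hD τ hτ, hexp])
    (fun ε hε => tsum_mul_exp_pow_zero_at_inf ha ha0 hε) ?_ ?_
  · refine ⟨eq_zero_of_tsum_mul_pow_eq_zero ha ha0 hA, ?_⟩
    have hB : ∀ τ : ℂ, 0 < τ.im →
        ∑' n : ℕ, b n * Complex.exp (Complex.I * Real.pi * τ) ^ n = c := fun τ hτ => by
      have := hA _ (Complex.im_neg_one_div_pos hτ)
      rw [hD τ hτ] at this
      exact (sub_eq_zero.1 this).symm
    have hc : c = 0 := by
      rw [← norm_le_zero_iff]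
      refine le_of_forall_pos_le_add fun ε hε => ?_
      obtain ⟨M, hM⟩ := tsum_mul_exp_pow_zero_at_inf hb hb0 hε
      have := hM ((max M 0 + 1 : ℝ) * Complex.I) (by simp; linarith [le_max_left M 0])
      rw [hB _ (by simp; linarith [le_max_right M 0])] at this
      simpa using this
    exact eq_zero_of_tsum_mul_pow_eq_zero hb hb0 (hc ▸ hB)
  · obtain ⟨M, hM⟩ := tsum_mul_exp_pow_zero_at_inf hb hb0 one_pos
    refine ⟨‖c‖ + 1, max M 0, fun τ hτ => ?_⟩
    rw [max_lt_iff] at hτ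
    rw [hD τ hτ.2]
    exact (norm_sub_le _ _).trans (by gcongr; exact hM τ hτ.1)
  · intro ε hε
    obtain ⟨K, hK⟩ := tsum_mul_exp_le_of_isLittleO ha0 hlo
      (show 0 < ε / 2 * Real.exp (-Real.pi) by positivity)
    refine ⟨max 1 (2 * K / ε), fun τ hre hτ => ?_⟩
    rw [max_lt_iff] at hτ
    obtain ⟨hy, hy1⟩ := one_div_im_one_sub_one_div_le hre hτ.1.le
    have hnorm : ∀ n : ℕ, ‖a n * Complex.exp (Complex.I * Real.pi * (1 - 1 / τ)) ^ n‖ =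
        ‖a n‖ * Real.exp (-(Real.pi * n * (1 - 1 / τ).im)) := fun n => by
      rw [norm_mul, norm_pow, norm_exp_I_mul_pi_mul, ← Real.exp_nat_mul]
      congr 2; ring
    have hs : Summable fun n : ℕ =>
        ‖a n * Complex.exp (Complex.I * Real.pi * (1 - 1 / τ)) ^ n‖ := by
      simp only [norm_mul, norm_pow]
      exact summable_norm_mul_pow_of_subexp ha (norm_nonneg _) (norm_exp_I_mul_pi_mul_lt_one hy)
    refine (norm_tsum_le_tsum_norm hs).trans ?_
    simp only [hnorm]
    refine (hK _ hy).trans ?_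
    have h1 : Real.exp (Real.pi / (1 - 1 / τ).im) ≤
        Real.exp Real.pi * Real.exp (Real.pi * τ.im) := by
      rw [← Real.exp_add, Real.exp_le_exp, div_eq_mul_one_div]
      nlinarith [Real.pi_pos]
    have h2 : K ≤ ε / 2 * Real.exp (Real.pi * τ.im) := by
      have h3 := hτ.2
      rw [div_lt_iff₀ hε] at h3
      have h4 : τ.im ≤ Real.exp (Real.pi * τ.im) := by
        have := Real.add_one_le_exp (Real.pi * τ.im)
        nlinarith [Real.pi_gt_three]
      nlinarith
    calc K + ε / 2 * Real.exp (-Real.pi) * Real.exp (Real.pi / (1 - 1 / τ).im)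
        ≤ ε / 2 * Real.exp (Real.pi * τ.im) + ε / 2 * Real.exp (-Real.pi) *
          (Real.exp Real.pi * Real.exp (Real.pi * τ.im)) := by gcongr
      _ = ε / 2 * Real.exp (Real.pi * τ.im) + ε / 2 * (Real.exp (-Real.pi) *
          Real.exp Real.pi) * Real.exp (Real.pi * τ.im) := by ring
      _ = ε * Real.exp (Real.pi * τ.im) := by
          rw [← Real.exp_add, neg_add_cancel, Real.exp_zero]; ring

section HyperbolicFourierSeries

variable {a b : ℤ → ℂ}

lemma hfsTerm_natCast (τ : ℂ) (n : ℕ) :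
    hfsTerm a b τ n = (if n = 0 then 0 else a n) * Complex.exp (Complex.I * Real.pi * τ) ^ n +
      (if n = 0 then 0 else b n) * Complex.exp (Complex.I * Real.pi * (-1 / τ)) ^ n +
      if n = 0 then a 0 else 0 := by
  rcases Nat.eq_zero_or_pos n with rfl | hn
  · simp [hfsTerm]
  · rw [hfsTerm, if_pos (by exact_mod_cast hn), ← Complex.exp_nat_mul, ← Complex.exp_nat_mul]
    simp only [hn.ne', if_false, add_zero, Int.cast_natCast]
    congr 3 <;> ring

lemma hfsTerm_neg_natCast (τ : ℂ) (n : ℕ) :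
    hfsTerm a b τ (-n) =
      starRingEnd ℂ ((if n = 0 then 0 else starRingEnd ℂ (a (-n))) *
          Complex.exp (Complex.I * Real.pi * τ) ^ n +
        (if n = 0 then 0 else starRingEnd ℂ (b (-n))) *
          Complex.exp (Complex.I * Real.pi * (-1 / τ)) ^ n) +
      if n = 0 then a 0 else 0 := by
  rcases Nat.eq_zero_or_pos n with rfl | hn
  · simp [hfsTerm]
  · rw [hfsTerm, if_neg (by simp), if_pos (by simpa using hn), ← Complex.exp_nat_mul,
      ← Complex.exp_nat_mul]
    simp only [hn.ne', if_false, add_zero, map_add, map_mul, Complex.conj_conj, ← Complex.exp_conj,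
      Complex.conj_I, Complex.conj_ofReal, map_natCast, map_div₀, map_neg, map_one, Int.cast_neg,
      Int.cast_natCast]
    congr 3 <;> ring

lemma subexp_ite {f : ℤ → ℂ} {u : ℕ → ℂ} {g : ℕ → ℤ} (hg : ∀ n : ℕ, |((g n : ℤ) : ℝ)| = n)
    (hu : ∀ n : ℕ, ‖u n‖ = ‖f (g n)‖)
    (hf : ∀ ε : ℝ, 0 < ε → ∃ C : ℝ, ∀ n : ℤ, ‖f n‖ ≤ C * Real.exp (ε * |(n : ℝ)|)) :
    ∀ ε : ℝ, 0 < ε → ∃ C : ℝ, ∀ n : ℕ, ‖if n = 0 then 0 else u n‖ ≤ C * Real.exp (ε * n) := by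
  intro ε hε
  obtain ⟨C, hC⟩ := hf ε hε
  refine ⟨C, fun n => ?_⟩
  have h := hC (g n)
  rw [hg, ← hu] at h
  split_ifs
  · rw [norm_zero]; exact (norm_nonneg _).trans h
  · exact h

lemma isLittleO_ite {f : ℤ → ℂ} {u : ℕ → ℂ} {g : ℕ → ℤ} (hg : ∀ n : ℕ, |((g n : ℤ) : ℝ)| = n)
    (hu : ∀ n : ℕ, ‖u n‖ = ‖f (g n)‖) {φ : ℝ → ℝ → ℝ}
    (hf : ∀ ε : ℝ, 0 < ε → ∃ N : ℝ, ∀ n : ℤ, N ≤ |(n : ℝ)| → ‖f n‖ ≤ φ ε |(n : ℝ)|) :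
    ∀ ε : ℝ, 0 < ε → ∃ N : ℝ, ∀ n : ℕ, N ≤ (n : ℝ) → ‖if n = 0 then 0 else u n‖ ≤ φ ε n := by
  intro ε hε
  obtain ⟨N, hN⟩ := hf ε hε
  refine ⟨N, fun n hn => ?_⟩
  have h := hN (g n)
  rw [hg, ← hu] at h
  split_ifs
  · rw [norm_zero]; exact (norm_nonneg _).trans (h hn)
  · exact h hn

end HyperbolicFourierSeries

/-- **uniqueness.** If the coefficients `aₙ, bₙ` grow subexponentially,
the associated harmonic hyperbolic Fourier series vanishes identically on the upper
half-plane, and moreover `|aₙ| = o(|n|^{-3/4} exp(2π√|n|))` as `|n| → ∞`, then all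
the coefficients vanish. -/
theorem statement5 (a b : ℤ → ℂ)
    (hsub : ∀ ε : ℝ, 0 < ε → ∃ C : ℝ, ∀ n : ℤ,
      ‖a n‖ ≤ C * Real.exp (ε * |(n : ℝ)|) ∧ ‖b n‖ ≤ C * Real.exp (ε * |(n : ℝ)|))
    (htriv : ∀ τ : ℂ, 0 < τ.im → ∑' n : ℤ, hfsTerm a b τ n = 0)
    (hlo : ∀ ε : ℝ, 0 < ε → ∃ N : ℝ, ∀ n : ℤ, N ≤ |(n : ℝ)| →
      ‖a n‖ ≤ ε * |(n : ℝ)| ^ (-(3 / 4 : ℝ)) * Real.exp (2 * Real.pi * Real.sqrt |(n : ℝ)|)) :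
    (∀ n : ℤ, a n = 0) ∧ (∀ n : ℤ, n ≠ 0 → b n = 0) := by
  have hsa : ∀ ε : ℝ, 0 < ε → ∃ C : ℝ, ∀ n : ℤ, ‖a n‖ ≤ C * Real.exp (ε * |(n : ℝ)|) :=
    fun ε hε => (hsub ε hε).imp fun C hC n => (hC n).1
  have hsb : ∀ ε : ℝ, 0 < ε → ∃ C : ℝ, ∀ n : ℤ, ‖b n‖ ≤ C * Real.exp (ε * |(n : ℝ)|) :=
    fun ε hε => (hsub ε hε).imp fun C hC n => (hC n).2
  have hpos : ∀ n : ℕ, |(((n : ℤ) : ℤ) : ℝ)| = n := fun n => by simp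
  have hneg : ∀ n : ℕ, |((-(n : ℤ) : ℤ) : ℝ)| = n := fun n => by simp
  have ha₁ := subexp_ite (u := fun n => a n) hpos (fun _ => rfl) hsa
  have hb₁ := subexp_ite (u := fun n => b n) hpos (fun _ => rfl) hsb
  have ha₂ := subexp_ite (u := fun n => starRingEnd ℂ (a (-n))) hneg
    (fun _ => RCLike.norm_conj _) hsa
  have hb₂ := subexp_ite (u := fun n => starRingEnd ℂ (b (-n))) hneg
    (fun _ => RCLike.norm_conj _) hsb
  have hl₁ := isLittleO_ite (u := fun n => a n) hpos (fun _ => rfl)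
    (φ := fun ε x => ε * x ^ (-(3 / 4 : ℝ)) * Real.exp (2 * Real.pi * Real.sqrt x)) hlo
  have hl₂ := isLittleO_ite (u := fun n => starRingEnd ℂ (a (-n))) hneg
    (fun _ => RCLike.norm_conj _)
    (φ := fun ε x => ε * x ^ (-(3 / 4 : ℝ)) * Real.exp (2 * Real.pi * Real.sqrt x)) hlo
  have hU : IsOpen {τ : ℂ | 0 < τ.im} := isOpen_lt continuous_const Complex.continuous_im
  have hc : IsPreconnected {τ : ℂ | 0 < τ.im} := (convex_halfSpace_im_gt 0).isPreconnected
  have hsum : ∀ {u : ℕ → ℂ}, (∀ ε : ℝ, 0 < ε → ∃ C : ℝ, ∀ n : ℕ, ‖u n‖ ≤ C * Real.exp (ε * n)) →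
      ∀ τ : ℂ, 0 < τ.im → Summable fun n => u n * Complex.exp (Complex.I * Real.pi * τ) ^ n := by
    intro u hu τ hτ
    refine Summable.of_norm ?_
    simp only [norm_mul, norm_pow]
    exact summable_norm_mul_pow_of_subexp hu (norm_nonneg _) (norm_exp_I_mul_pi_mul_lt_one hτ)
  let series (u v : ℕ → ℂ) (τ : ℂ) : ℂ :=
    ∑' n : ℕ, u n * Complex.exp (Complex.I * Real.pi * τ) ^ n +
      ∑' n : ℕ, v n * Complex.exp (Complex.I * Real.pi * (-1 / τ)) ^ n
  have hdiff : ∀ {u v : ℕ → ℂ},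
      (∀ ε : ℝ, 0 < ε → ∃ C : ℝ, ∀ n : ℕ, ‖u n‖ ≤ C * Real.exp (ε * n)) →
      (∀ ε : ℝ, 0 < ε → ∃ C : ℝ, ∀ n : ℕ, ‖v n‖ ≤ C * Real.exp (ε * n)) →
      DifferentiableOn ℂ (series u v) {τ | 0 < τ.im} := fun hu hv =>
    (differentiableOn_tsum_mul_exp_pow hu).add
      (differentiableOn_comp_im_pos (differentiableOn_tsum_mul_exp_pow hv) fun τ hτ =>
        ⟨(differentiableAt_const _).div differentiableAt_id (Complex.ne_zero_of_im_pos hτ),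
          Complex.im_neg_one_div_pos hτ⟩)
  set α₁ : ℕ → ℂ := fun n => if n = 0 then 0 else a n with hα₁
  set β₁ : ℕ → ℂ := fun n => if n = 0 then 0 else b n with hβ₁
  set α₂ : ℕ → ℂ := fun n => if n = 0 then 0 else starRingEnd ℂ (a (-n)) with hα₂
  set β₂ : ℕ → ℂ := fun n => if n = 0 then 0 else starRingEnd ℂ (b (-n)) with hβ₂
  have hrel : ∀ τ : ℂ, 0 < τ.im →
      series α₁ β₁ τ + starRingEnd ℂ (series α₂ β₂ τ) = -a 0 := by
    intro τ hτ
    have hτ' := Complex.im_neg_one_div_pos hτ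
    have hp : HasSum (fun n : ℕ => hfsTerm a b τ n) (series α₁ β₁ τ + a 0) := by
      simp only [hfsTerm_natCast]
      exact ((hsum ha₁ τ hτ).hasSum.add (hsum hb₁ _ hτ').hasSum).add (hasSum_ite_eq 0 (a 0))
    have hn : HasSum (fun n : ℕ => hfsTerm a b τ (-n))
        (starRingEnd ℂ (series α₂ β₂ τ) + a 0) := by
      simp only [hfsTerm_neg_natCast]
      exact (Complex.hasSum_conj'.2 ((hsum ha₂ τ hτ).hasSum.add (hsum hb₂ _ hτ').hasSum)).add
        (hasSum_ite_eq 0 (a 0))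
    have h := (hp.of_nat_of_neg hn).tsum_eq
    rw [htriv τ hτ, show hfsTerm a b τ 0 = a 0 by simp [hfsTerm]] at h
    linear_combination -h
  obtain ⟨d, hd⟩ := eq_const_of_add_conj_eq_const hU hc (hdiff ha₁ hb₁) (hdiff ha₂ hb₂) hrel
  have hd₂ : ∀ τ : ℂ, 0 < τ.im → series α₂ β₂ τ = starRingEnd ℂ (-a 0 - d) := fun τ hτ => by
    rw [← hrel τ hτ, hd τ hτ, add_sub_cancel_left, Complex.conj_conj]
  obtain ⟨hA₁, hB₁⟩ := coeff_eq_zero_of_tsum_add_tsum_eq_const (a := α₁) (b := β₁) rfl rfl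
    ha₁ hb₁ hl₁ hd
  obtain ⟨hA₂, hB₂⟩ := coeff_eq_zero_of_tsum_add_tsum_eq_const (a := α₂) (b := β₂) rfl rfl
    ha₂ hb₂ hl₂ hd₂
  have ha0 : a 0 = 0 := by
    have := hrel Complex.I (by simp)
    simpa [series, hA₁, hA₂, hB₁, hB₂] using this
  refine ⟨fun n => ?_, fun n hn => ?_⟩
  · rcases eq_or_ne n 0 with rfl | hn
    · exact ha0
    obtain ⟨m, rfl | rfl⟩ := n.eq_nat_or_neg
    · simpa [hα₁, show m ≠ 0 by simpa using hn] using hA₁ m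
    · simpa [hα₂, show m ≠ 0 by simpa using hn] using hA₂ m
  · obtain ⟨m, rfl | rfl⟩ := n.eq_nat_or_neg
    · simpa [hβ₁, show m ≠ 0 by simpa using hn] using hB₁ m
    · simpa [hβ₂, show m ≠ 0 by simpa using hn] using hB₂ m

end
end
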